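/- There exists a constant C1 > 0 such that for every even n and every integer d with 3 ≤ d ≤ n^{1/10}, the total variation distance between μ_{d,n} ⊕ μ_{1,n} and μ_{d+1,n} satisfies d_TV(μ_{d,n} ⊕ μ_{1,n}, μ_{d+1,n}) ≤ C1·d^{−1.1}. -/

import Mathlib

open Filter Topology

/-- Degree of a vertex in a graph on `Fin n`. -/
noncomputable def gDeg {n : ℕ} (G : SimpleGraph (Fin n)) (v : Fin n) : ℕ :=
  Nat.card {w : Fin n // G.Adj v w}

/-- `G` is a `d`-regular graph. -/
def IsRegularGraph {n : ℕ} (G : SimpleGraph (Fin n)) (d : ℕ) : Prop :=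
  ∀ v, gDeg G v = d

open scoped Classical in
/-- The uniform probability distribution `μ_{d,n}` on the `d`-regular graphs on `{1,…,n}`. -/
noncomputable def mu (n d : ℕ) : SimpleGraph (Fin n) → ℝ := fun G =>
  if IsRegularGraph G d then
    (Nat.card {H : SimpleGraph (Fin n) // IsRegularGraph H d} : ℝ)⁻¹
  else 0

/-- `p` is a probability distribution on a finite or countable space. -/
def IsProbC {α : Type*} (p : α → ℝ) : Prop :=
  (∀ x, 0 ≤ p x) ∧ ∑' x, p x = 1

/-- Probability of an event `A` under the distribution `p`. -/
noncomputable def probOf {α : Type*} (p : α → ℝ) (A : Set α) : ℝ := ∑' x : A, p x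

/-- Total variation distance. -/
noncomputable def tvDist {α : Type*} (p q : α → ℝ) : ℝ := (1/2) * ∑' x, |p x - q x|

/-- `π` is a coupling of `p` and `q`. -/
def IsCoupling {α β : Type*} (π : α × β → ℝ) (p : α → ℝ) (q : β → ℝ) : Prop :=
  IsProbC π ∧ (∀ a, ∑' b, π (a, b) = p a) ∧ (∀ b, ∑' a, π (a, b) = q b)

/-- Expectation of `f` under the distribution `p`. -/
noncomputable def expec {α : Type*} (p f : α → ℝ) : ℝ := ∑' x, p x * f x

open scoped Classical in
/-- Unnormalised mass of `p ⊕ q` at `G`: sum over ordered pairs of edge-disjoint graphs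
with union `G`. -/
noncomputable def oplusMass {n : ℕ} (p q : SimpleGraph (Fin n) → ℝ)
    (G : SimpleGraph (Fin n)) : ℝ :=
  ∑' H : SimpleGraph (Fin n) × SimpleGraph (Fin n),
    if Disjoint H.1 H.2 ∧ H.1 ⊔ H.2 = G then p H.1 * q H.2 else 0

/-- The distribution `p ⊕ q`. -/
noncomputable def oplus {n : ℕ} (p q : SimpleGraph (Fin n) → ℝ) :
    SimpleGraph (Fin n) → ℝ :=
  fun G => oplusMass p q G / ∑' H, oplusMass p q H

namespace RegularSprinkling

open Finset

set_option linter.unusedSimpArgs false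

section

variable {n : ℕ}

open scoped Classical in
/-- Real-valued adjacency matrix. -/
noncomputable def adj (G : SimpleGraph (Fin n)) (x y : Fin n) : ℝ := if G.Adj x y then 1 else 0

open scoped Classical in
/-- The `r`-regular graphs containing `L`. -/
noncomputable def regSet (r : ℕ) (L : SimpleGraph (Fin n)) : Finset (SimpleGraph (Fin n)) :=
  univ.filter fun G => IsRegularGraph G r ∧ L ≤ G

/-- Sum of `φ` over the `r`-regular graphs containing `L`. -/
noncomputable def gsum (r : ℕ) (L : SimpleGraph (Fin n)) (φ : SimpleGraph (Fin n) → ℝ) : ℝ :=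
  ∑ G ∈ regSet r L, φ G

/-- Number of `r`-regular graphs containing `L`. -/
noncomputable def cnt (r : ℕ) (L : SimpleGraph (Fin n)) : ℝ := gsum r L fun _ => 1

/-- Residual degree of `x` once the edges of `L` are removed from an `r`-regular graph. -/
noncomputable def res (r : ℕ) (L : SimpleGraph (Fin n)) (x : Fin n) : ℝ := r - ∑ y, adj L x y

/-- Total residual degree. -/
noncomputable def tot (r : ℕ) (L : SimpleGraph (Fin n)) : ℝ := ∑ x, res r L x

open scoped Classical in
/-- Indicator of the edges of `G` that are not in `L`. -/
noncomputable def fr (L G : SimpleGraph (Fin n)) (x y : Fin n) : ℝ :=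
  if G.Adj x y ∧ ¬ L.Adj x y then 1 else 0

/-- Adjacency or equality indicator. -/
noncomputable def cl (G : SimpleGraph (Fin n)) (x y : Fin n) : ℝ :=
  adj G x y + if x = y then 1 else 0

theorem adj_nonneg (G : SimpleGraph (Fin n)) (x y : Fin n) : 0 ≤ adj G x y := by
  unfold adj; split_ifs <;> norm_num

theorem adj_le_one (G : SimpleGraph (Fin n)) (x y : Fin n) : adj G x y ≤ 1 := by
  unfold adj; split_ifs <;> norm_num

theorem adj_symm (G : SimpleGraph (Fin n)) (x y : Fin n) : adj G x y = adj G y x := by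
  unfold adj
  by_cases h : G.Adj x y
  · rw [if_pos h, if_pos h.symm]
  · rw [if_neg h, if_neg fun h' => h h'.symm]

theorem adj_self (G : SimpleGraph (Fin n)) (x : Fin n) : adj G x x = 0 := by
  simp [adj]

theorem adj_of_adj {G : SimpleGraph (Fin n)} {x y : Fin n} (h : G.Adj x y) : adj G x y = 1 := by
  simp [adj, h]

theorem adj_of_not_adj {G : SimpleGraph (Fin n)} {x y : Fin n} (h : ¬ G.Adj x y) :
    adj G x y = 0 := by
  simp [adj, h]

theorem adj_congr {G : SimpleGraph (Fin n)} {x y : Fin n} {P : Prop} [Decidable P]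
    (h : G.Adj x y ↔ P) : adj G x y = if P then 1 else 0 := by
  by_cases hP : P
  · rw [adj_of_adj (h.2 hP), if_pos hP]
  · rw [adj_of_not_adj fun h' => hP (h.1 h'), if_neg hP]

theorem cl_nonneg (G : SimpleGraph (Fin n)) (x y : Fin n) : 0 ≤ cl G x y := by
  unfold cl; have := adj_nonneg G x y; split_ifs <;> linarith

theorem cl_symm (G : SimpleGraph (Fin n)) (x y : Fin n) : cl G x y = cl G y x := by
  unfold cl; rw [adj_symm]; simp only [eq_comm]

theorem cl_le_one (G : SimpleGraph (Fin n)) (x y : Fin n) : cl G x y ≤ 1 := by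
  unfold cl
  split_ifs with h
  · subst h; rw [adj_self]; norm_num
  · simpa using adj_le_one G x y

theorem cl_eq_zero {G : SimpleGraph (Fin n)} {x y : Fin n} (h : ¬ G.Adj x y) (hne : x ≠ y) :
    cl G x y = 0 := by
  simp [cl, adj_of_not_adj h, hne]

theorem sum_cl (G : SimpleGraph (Fin n)) (x : Fin n) :
    ∑ y, cl G x y = ∑ y, adj G x y + 1 := by
  simp [cl, sum_add_distrib]

theorem fr_nonneg (L G : SimpleGraph (Fin n)) (x y : Fin n) : 0 ≤ fr L G x y := by
  unfold fr; split_ifs <;> norm_num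

theorem fr_le_one (L G : SimpleGraph (Fin n)) (x y : Fin n) : fr L G x y ≤ 1 := by
  unfold fr; split_ifs <;> norm_num

theorem fr_symm (L G : SimpleGraph (Fin n)) (x y : Fin n) : fr L G x y = fr L G y x := by
  unfold fr
  by_cases h : G.Adj x y ∧ ¬ L.Adj x y
  · rw [if_pos h, if_pos ⟨h.1.symm, fun h' => h.2 h'.symm⟩]
  · rw [if_neg h, if_neg fun h' => h ⟨h'.1.symm, fun h2 => h'.2 h2.symm⟩]

theorem fr_self (L G : SimpleGraph (Fin n)) (x : Fin n) : fr L G x x = 0 := by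
  simp [fr]

theorem fr_mul_self (L G : SimpleGraph (Fin n)) (x y : Fin n) :
    fr L G x y * fr L G x y = fr L G x y := by
  unfold fr; split_ifs <;> norm_num

theorem fr_eq_zero {L : SimpleGraph (Fin n)} {x y : Fin n} (h : L.Adj x y)
    (G : SimpleGraph (Fin n)) : fr L G x y = 0 := by
  simp [fr, h]

theorem fr_eq_adj {L : SimpleGraph (Fin n)} {x y : Fin n} (h : ¬ L.Adj x y)
    (G : SimpleGraph (Fin n)) : fr L G x y = adj G x y := by
  by_cases hG : G.Adj x y <;> simp [fr, adj, h, hG]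

theorem isRegularGraph_iff {G : SimpleGraph (Fin n)} {r : ℕ} :
    IsRegularGraph G r ↔ ∀ x, ∑ y, adj G x y = r := by
  unfold IsRegularGraph gDeg
  refine forall_congr' fun x => ?_
  classical
  rw [Nat.card_eq_fintype_card, Fintype.card_subtype]
  simp only [adj, sum_boole]
  norm_cast

theorem mem_regSet {r : ℕ} {L G : SimpleGraph (Fin n)} :
    G ∈ regSet r L ↔ IsRegularGraph G r ∧ L ≤ G := by
  simp [regSet]

theorem adj_eq_fr_add {L G : SimpleGraph (Fin n)} (h : L ≤ G) (x y : Fin n) :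
    adj G x y = fr L G x y + adj L x y := by
  unfold adj fr
  by_cases h1 : L.Adj x y
  · simp [h1, h h1]
  · by_cases hG : G.Adj x y <;> simp [h1, hG]

theorem sum_fr {r : ℕ} {L G : SimpleGraph (Fin n)} (h : G ∈ regSet r L) (x : Fin n) :
    ∑ y, fr L G x y = res r L x := by
  rw [mem_regSet, isRegularGraph_iff] at h
  rw [res, ← h.1 x, ← sum_sub_distrib]
  exact sum_congr rfl fun y _ => by rw [adj_eq_fr_add h.2]; ring

theorem res_nonneg_of_mem {r : ℕ} {L G : SimpleGraph (Fin n)} (h : G ∈ regSet r L) (x : Fin n) :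
    0 ≤ res r L x := by
  rw [← sum_fr h]; exact sum_nonneg fun y _ => fr_nonneg _ _ _ _

theorem res_le (r : ℕ) (L : SimpleGraph (Fin n)) (x : Fin n) : res r L x ≤ r := by
  unfold res; linarith [sum_nonneg fun y (_ : y ∈ univ) => adj_nonneg L x y]

theorem sum_cl_of_mem {r : ℕ} {L G : SimpleGraph (Fin n)} (h : G ∈ regSet r L) (x : Fin n) :
    ∑ y, cl G x y = r + 1 := by
  rw [mem_regSet, isRegularGraph_iff] at h
  rw [sum_cl, h.1]

theorem adj_sup_edge {L : SimpleGraph (Fin n)} {u v : Fin n} (huv : u ≠ v) (hL : ¬ L.Adj u v)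
    (x y : Fin n) : adj (L ⊔ SimpleGraph.edge u v) x y =
      adj L x y + ((if x = u ∧ y = v then 1 else 0) + if x = v ∧ y = u then 1 else 0) := by
  have hL' : ¬ L.Adj v u := fun h => hL h.symm
  classical
  rw [adj_congr (SimpleGraph.sup_adj L _ x y), adj_congr (Iff.refl (L.Adj x y))]
  simp only [SimpleGraph.edge_adj]
  by_cases h1 : x = u ∧ y = v
  · obtain ⟨rfl, rfl⟩ := h1
    simp [hL, huv]
  · by_cases h2 : x = v ∧ y = u
    · obtain ⟨rfl, rfl⟩ := h2
      simp [hL', huv, huv.symm]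
    · simp [h1, h2]

theorem sum_adj_sup_edge {L : SimpleGraph (Fin n)} {u v : Fin n} (huv : u ≠ v)
    (hL : ¬ L.Adj u v) (x : Fin n) : ∑ y, adj (L ⊔ SimpleGraph.edge u v) x y =
      ∑ y, adj L x y + ((if x = u then 1 else 0) + if x = v then 1 else 0) := by
  simp only [adj_sup_edge huv hL, sum_add_distrib]
  congr 2
  · by_cases h : x = u <;> simp [h]
  · by_cases h : x = v <;> simp [h]

theorem res_sup_edge (r : ℕ) {L : SimpleGraph (Fin n)} {u v : Fin n} (huv : u ≠ v)
    (hL : ¬ L.Adj u v) (x : Fin n) : res r (L ⊔ SimpleGraph.edge u v) x =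
      res r L x - (if x = u then 1 else 0) - if x = v then 1 else 0 := by
  rw [res, sum_adj_sup_edge huv hL, res]; ring

theorem tot_sup_edge (r : ℕ) {L : SimpleGraph (Fin n)} {u v : Fin n} (huv : u ≠ v)
    (hL : ¬ L.Adj u v) : tot r (L ⊔ SimpleGraph.edge u v) = tot r L - 2 := by
  simp only [tot, res_sup_edge r huv hL, sum_sub_distrib]
  simp; ring

theorem gsum_sup_edge (r : ℕ) (L : SimpleGraph (Fin n)) {u v : Fin n} (huv : u ≠ v)
    (φ : SimpleGraph (Fin n) → ℝ) :
    gsum r (L ⊔ SimpleGraph.edge u v) φ = gsum r L fun G => adj G u v * φ G := by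
  classical
  have : regSet r (L ⊔ SimpleGraph.edge u v) = (regSet r L).filter fun G => G.Adj u v := by
    ext G
    simp [mem_regSet, SimpleGraph.edge_le_iff, huv, and_assoc, -SimpleGraph.edge_le]
  simp [gsum, this, sum_filter, adj]

theorem gsum_fr (r : ℕ) {L : SimpleGraph (Fin n)} {u v : Fin n} (huv : u ≠ v)
    (hL : ¬ L.Adj u v) (φ : SimpleGraph (Fin n) → ℝ) :
    gsum r L (fun G => fr L G u v * φ G) = gsum r (L ⊔ SimpleGraph.edge u v) φ := by
  rw [gsum_sup_edge r L huv]
  simp only [fr_eq_adj hL]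

/-- Exchange the edges `uv`, `wx` for `uw`, `vx`. -/
def switch (G : SimpleGraph (Fin n)) (u v w x : Fin n) : SimpleGraph (Fin n) :=
  (G \ (SimpleGraph.edge u v ⊔ SimpleGraph.edge w x)) ⊔
    (SimpleGraph.edge u w ⊔ SimpleGraph.edge v x)

/-- The switching of `uv`, `wx` to `uw`, `vx` is admissible. -/
def Switchable (L G : SimpleGraph (Fin n)) (u v w x : Fin n) : Prop :=
  (G.Adj u v ∧ ¬ L.Adj u v) ∧ (G.Adj w x ∧ ¬ L.Adj w x) ∧ (¬ G.Adj u w ∧ u ≠ w) ∧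
    (¬ G.Adj v x ∧ v ≠ x)

theorem Switchable.pairwise_ne {L G : SimpleGraph (Fin n)} {u v w x : Fin n}
    (h : Switchable L G u v w x) :
    u ≠ v ∧ u ≠ w ∧ u ≠ x ∧ v ≠ w ∧ v ≠ x ∧ w ≠ x := by
  obtain ⟨⟨h1, -⟩, ⟨h2, -⟩, ⟨h3, h4⟩, h5, h6⟩ := h
  refine ⟨h1.ne, h4, ?_, ?_, h6, h2.ne⟩
  · rintro rfl; exact h3 h2.symm
  · rintro rfl; exact h5 h2

theorem switch_adj (G : SimpleGraph (Fin n)) (u v w x a b : Fin n) :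
    (switch G u v w x).Adj a b ↔
      (G.Adj a b ∧ ¬ ((a = u ∧ b = v ∨ a = v ∧ b = u) ∨ (a = w ∧ b = x ∨ a = x ∧ b = w))) ∨
      (((a = u ∧ b = w ∨ a = w ∧ b = u) ∨ (a = v ∧ b = x ∨ a = x ∧ b = v)) ∧ a ≠ b) := by
  simp only [switch, SimpleGraph.sup_adj, SimpleGraph.sdiff_adj, SimpleGraph.edge_adj]
  by_cases hab : a = b
  · subst hab; simp
  · simp [hab]

theorem adj_switch {L G : SimpleGraph (Fin n)} {u v w x : Fin n}
    (h : Switchable L G u v w x) (a b : Fin n) :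
    adj (switch G u v w x) a b = adj G a b
      - ((if a = u ∧ b = v then 1 else 0) + if a = v ∧ b = u then 1 else 0)
      - ((if a = w ∧ b = x then 1 else 0) + if a = x ∧ b = w then 1 else 0)
      + ((if a = u ∧ b = w then 1 else 0) + if a = w ∧ b = u then 1 else 0)
      + ((if a = v ∧ b = x then 1 else 0) + if a = x ∧ b = v then 1 else 0) := by
  obtain ⟨h1, h2, h3, h4, h5, h6⟩ := h.pairwise_ne
  obtain ⟨⟨g1, -⟩, ⟨g2, -⟩, ⟨g3, -⟩, g4, -⟩ := h
  have g1' := g1.symm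
  have g2' := g2.symm
  have g3' : ¬ G.Adj w u := fun h => g3 h.symm
  have g4' : ¬ G.Adj x v := fun h => g4 h.symm
  classical
  rw [adj_congr (switch_adj G u v w x a b), adj_congr (Iff.refl (G.Adj a b))]
  by_cases au : a = u
  · subst au
    by_cases bv : b = v
    · subst bv; simp [*, h1.symm, h2.symm, h3.symm, h4.symm, h5.symm, h6.symm]
    · by_cases bw : b = w
      · subst bw; simp [*, h1.symm, h2.symm, h3.symm, h4.symm, h5.symm, h6.symm]
      · simp [*, h1.symm, h2.symm, h3.symm, h4.symm, h5.symm, h6.symm]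
  · by_cases av : a = v
    · subst av
      by_cases bv : b = u
      · subst bv; simp [*, h1.symm, h2.symm, h3.symm, h4.symm, h5.symm, h6.symm]
      · by_cases bw : b = x
        · subst bw; simp [*, h1.symm, h2.symm, h3.symm, h4.symm, h5.symm, h6.symm]
        · simp [*, h1.symm, h2.symm, h3.symm, h4.symm, h5.symm, h6.symm]
    · by_cases aw : a = w
      · subst aw
        by_cases bv : b = x
        · subst bv; simp [*, h1.symm, h2.symm, h3.symm, h4.symm, h5.symm, h6.symm]
        · by_cases bw : b = u
          · subst bw; simp [*, h1.symm, h2.symm, h3.symm, h4.symm, h5.symm, h6.symm]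
          · simp [*, h1.symm, h2.symm, h3.symm, h4.symm, h5.symm, h6.symm]
      · by_cases ax : a = x
        · subst ax
          by_cases bv : b = w
          · subst bv; simp [*, h1.symm, h2.symm, h3.symm, h4.symm, h5.symm, h6.symm]
          · by_cases bw : b = v
            · subst bw; simp [*, h1.symm, h2.symm, h3.symm, h4.symm, h5.symm, h6.symm]
            · simp [*, h1.symm, h2.symm, h3.symm, h4.symm, h5.symm, h6.symm]
        · simp [*]

theorem sum_ite_eq_and (a u v : Fin n) :
    ∑ b, (if a = u ∧ b = v then (1 : ℝ) else 0) = if a = u then 1 else 0 := by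
  by_cases h : a = u <;> simp [h]

theorem switch_mem {r : ℕ} {L G : SimpleGraph (Fin n)} {u v w x : Fin n}
    (hG : G ∈ regSet r L) (h : Switchable L G u v w x) :
    switch G u v w x ∈ regSet r L := by
  rw [mem_regSet, isRegularGraph_iff] at hG ⊢
  refine ⟨fun a => ?_, fun a b hab => ?_⟩
  · simp only [adj_switch h, sum_add_distrib, sum_sub_distrib, sum_ite_eq_and, hG.1 a]
    ring
  · obtain ⟨⟨-, g1⟩, ⟨-, g2⟩, -, -⟩ := h
    rw [switch_adj]
    refine Or.inl ⟨hG.2 hab, ?_⟩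
    rintro ((⟨rfl, rfl⟩ | ⟨rfl, rfl⟩) | (⟨rfl, rfl⟩ | ⟨rfl, rfl⟩))
    · exact g1 hab
    · exact g1 hab.symm
    · exact g2 hab
    · exact g2 hab.symm

theorem switch_switchable {L G : SimpleGraph (Fin n)} {u v w x : Fin n} (hL : L ≤ G)
    (h : Switchable L G u v w x) : Switchable L (switch G u v w x) u w v x := by
  obtain ⟨h1, h2, h3, h4, h5, h6⟩ := h.pairwise_ne
  obtain ⟨-, -, ⟨g3, -⟩, g4, -⟩ := h
  refine ⟨⟨?_, fun h => g3 (hL h)⟩, ⟨?_, fun h => g4 (hL h)⟩, ⟨?_, h1⟩, ?_, h6⟩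
  · simp [switch_adj, h2]
  · simp [switch_adj, h5]
  · simp [switch_adj, h1, h2, h3, h4, h1.symm]
  · simp [switch_adj, h6, h2.symm, h3.symm, h4.symm, h5.symm, h6.symm]

theorem switch_switch {L G : SimpleGraph (Fin n)} {u v w x : Fin n} (hL : L ≤ G)
    (h : Switchable L G u v w x) : switch (switch G u v w x) u w v x = G := by
  have h' := switch_switchable hL h
  ext a b
  have key : adj (switch (switch G u v w x) u w v x) a b = adj G a b := by
    rw [adj_switch h', adj_switch h]; ring
  unfold adj at key
  constructor
  · intro hab
    by_contra hc
    simp [hab, hc] at key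
  · intro hab
    by_contra hc
    simp [hab, hc] at key

theorem fr_mul_eq_ite (L G : SimpleGraph (Fin n)) (u v w x : Fin n)
    [Decidable (Switchable L G u v w x)] :
    fr L G u v * fr L G w x * (1 - cl G u w) * (1 - cl G v x) =
      if Switchable L G u v w x then 1 else 0 := by
  unfold Switchable fr cl adj
  by_cases h1 : G.Adj u v ∧ ¬ L.Adj u v
  · by_cases h2 : G.Adj w x ∧ ¬ L.Adj w x
    · by_cases h3 : G.Adj u w
      · simp [h1, h2, h3, h3.ne]
      · by_cases h4 : G.Adj v x
        · simp [h1, h2, h3, h4, h4.ne]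
        · by_cases h5 : u = w
          · simp [h5]
          · by_cases h6 : v = x
            · simp [h6]
            · simp [h1, h2, h3, h4, h5, h6]
    · simp [h2]
  · simp [h1]

theorem gsum_switch (r : ℕ) (L : SimpleGraph (Fin n)) (u v w x : Fin n) :
    gsum r L (fun G => fr L G u v * fr L G w x * (1 - cl G u w) * (1 - cl G v x)) =
      gsum r L (fun G => fr L G u w * fr L G v x * (1 - cl G u v) * (1 - cl G w x)) := by
  classical
  simp only [gsum, fr_mul_eq_ite, sum_boole]
  norm_cast
  refine card_bij' (fun G _ => switch G u v w x) (fun G _ => switch G u w v x) ?_ ?_ ?_ ?_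
  · intro G hG
    rw [mem_filter] at hG ⊢
    exact ⟨switch_mem hG.1 hG.2, switch_switchable (mem_regSet.1 hG.1).2 hG.2⟩
  · intro G hG
    rw [mem_filter] at hG ⊢
    exact ⟨switch_mem hG.1 hG.2, switch_switchable (mem_regSet.1 hG.1).2 hG.2⟩
  · intro G hG
    rw [mem_filter] at hG
    exact switch_switch (mem_regSet.1 hG.1).2 hG.2
  · intro G hG
    rw [mem_filter] at hG
    exact switch_switch (mem_regSet.1 hG.1).2 hG.2

end

section

variable {n : ℕ}

theorem gsum_congr {r : ℕ} {L : SimpleGraph (Fin n)} {φ ψ : SimpleGraph (Fin n) → ℝ}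
    (h : ∀ G ∈ regSet r L, φ G = ψ G) : gsum r L φ = gsum r L ψ :=
  sum_congr rfl h

theorem gsum_mono {r : ℕ} {L : SimpleGraph (Fin n)} {φ ψ : SimpleGraph (Fin n) → ℝ}
    (h : ∀ G ∈ regSet r L, φ G ≤ ψ G) : gsum r L φ ≤ gsum r L ψ :=
  sum_le_sum h

theorem gsum_nonneg {r : ℕ} {L : SimpleGraph (Fin n)} {φ : SimpleGraph (Fin n) → ℝ}
    (h : ∀ G ∈ regSet r L, 0 ≤ φ G) : 0 ≤ gsum r L φ :=
  sum_nonneg h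

theorem gsum_add (r : ℕ) (L : SimpleGraph (Fin n)) (φ ψ : SimpleGraph (Fin n) → ℝ) :
    gsum r L (fun G => φ G + ψ G) = gsum r L φ + gsum r L ψ :=
  sum_add_distrib

theorem gsum_sub (r : ℕ) (L : SimpleGraph (Fin n)) (φ ψ : SimpleGraph (Fin n) → ℝ) :
    gsum r L (fun G => φ G - ψ G) = gsum r L φ - gsum r L ψ :=
  sum_sub_distrib _ _

theorem gsum_mul_const (r : ℕ) (L : SimpleGraph (Fin n)) (φ : SimpleGraph (Fin n) → ℝ) (c : ℝ) :
    gsum r L (fun G => φ G * c) = gsum r L φ * c :=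
  (sum_mul _ _ _).symm

theorem gsum_const_mul (r : ℕ) (L : SimpleGraph (Fin n)) (φ : SimpleGraph (Fin n) → ℝ) (c : ℝ) :
    gsum r L (fun G => c * φ G) = c * gsum r L φ :=
  (mul_sum _ _ _).symm

theorem gsum_const (r : ℕ) (L : SimpleGraph (Fin n)) (c : ℝ) :
    gsum r L (fun _ => c) = cnt r L * c := by
  rw [cnt, ← gsum_mul_const]; simp

theorem gsum_sum {ι : Type*} (r : ℕ) (L : SimpleGraph (Fin n)) (s : Finset ι)
    (φ : ι → SimpleGraph (Fin n) → ℝ) :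
    gsum r L (fun G => ∑ i ∈ s, φ i G) = ∑ i ∈ s, gsum r L (φ i) :=
  sum_comm

theorem cnt_nonneg (r : ℕ) (L : SimpleGraph (Fin n)) : 0 ≤ cnt r L :=
  gsum_nonneg fun _ _ => zero_le_one

theorem gsum_fr_eq_cnt (r : ℕ) {L : SimpleGraph (Fin n)} {u v : Fin n} (huv : u ≠ v)
    (hL : ¬ L.Adj u v) :
    gsum r L (fun G => fr L G u v) = cnt r (L ⊔ SimpleGraph.edge u v) := by
  rw [cnt, ← gsum_fr r huv hL]; simp

theorem cl_eq_fr_add {L G : SimpleGraph (Fin n)} (h : L ≤ G) (x y : Fin n) :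
    cl G x y = fr L G x y + cl L x y := by
  rw [cl, cl, adj_eq_fr_add h]; ring

theorem cl_eq_fr {L G : SimpleGraph (Fin n)} {x y : Fin n} (hne : x ≠ y)
    (hL : ¬ L.Adj x y) : cl G x y = fr L G x y := by
  rw [fr_eq_adj hL, cl, if_neg hne, add_zero]

theorem fr_mul_cl (L G : SimpleGraph (Fin n)) (x y : Fin n) :
    fr L G x y * cl L x y = 0 := by
  by_cases h : L.Adj x y
  · rw [fr_eq_zero h, zero_mul]
  · by_cases hxy : x = y
    · rw [hxy, fr_self, zero_mul]
    · rw [cl_eq_zero h hxy, mul_zero]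

/-- Summed switching identity. -/
theorem gsum_switch_sum (r : ℕ) {L : SimpleGraph (Fin n)} {u v : Fin n} (huv : u ≠ v)
    (hL : ¬ L.Adj u v) :
    gsum r L (fun G => fr L G u v * (tot r L - ∑ w, cl G u w * res r L w
        - ∑ x, cl G v x * res r L x + ∑ w, ∑ x, cl G u w * fr L G w x * cl G x v)) =
      gsum r L (fun G => (1 - fr L G u v) * (res r L u * res r L v
        - ∑ w, ∑ x, fr L G u w * cl G w x * fr L G x v)) := by
  have h1 : ∑ w, ∑ x, gsum r L (fun G => fr L G u v * fr L G w x * (1 - cl G u w) * (1 - cl G v x))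
      = ∑ w, ∑ x, gsum r L
        (fun G => fr L G u w * fr L G v x * (1 - cl G u v) * (1 - cl G w x)) :=
    sum_congr rfl fun w _ => sum_congr rfl fun x _ => gsum_switch r L u v w x
  simp only [← gsum_sum] at h1
  have h2 : ∀ G ∈ regSet r L,
      ∑ w, ∑ x, fr L G u v * fr L G w x * (1 - cl G u w) * (1 - cl G v x) =
      fr L G u v * (tot r L - ∑ w, cl G u w * res r L w
        - ∑ x, cl G v x * res r L x + ∑ w, ∑ x, cl G u w * fr L G w x * cl G x v) := by
    intro G hG
    have e1 : tot r L = ∑ w, ∑ x, fr L G w x := by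
      simp only [sum_fr hG, tot]
    have e2 : ∑ w, cl G u w * res r L w = ∑ w, ∑ x, cl G u w * fr L G w x := by
      simp only [← mul_sum, sum_fr hG]
    have e3 : ∑ x, cl G v x * res r L x = ∑ w, ∑ x, cl G v x * fr L G w x := by
      rw [sum_comm]
      refine sum_congr rfl fun x _ => ?_
      rw [← mul_sum, ← sum_fr hG]
      simp only [fr_symm L G x]
    rw [e1, e2, e3]
    simp only [← sum_sub_distrib, ← sum_add_distrib, mul_sum]
    refine sum_congr rfl fun w _ => sum_congr rfl fun x _ => ?_
    rw [cl_symm G x v]; ring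
  have h3 : ∀ G ∈ regSet r L,
      ∑ w, ∑ x, fr L G u w * fr L G v x * (1 - cl G u v) * (1 - cl G w x) =
      (1 - fr L G u v) * (res r L u * res r L v
        - ∑ w, ∑ x, fr L G u w * cl G w x * fr L G x v) := by
    intro G hG
    rw [← sum_fr hG, ← sum_fr hG, sum_mul_sum, cl_eq_fr huv hL]
    simp only [← sum_sub_distrib, ← sum_add_distrib, mul_sum]
    refine sum_congr rfl fun w _ => sum_congr rfl fun x _ => ?_
    rw [fr_symm L G x v]; ring
  rw [gsum_congr h2, gsum_congr h3] at h1
  exact h1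

/-- Every degree of `L` is at most `k`. -/
def DegLe (L : SimpleGraph (Fin n)) (k : ℝ) : Prop := ∀ x, ∑ y, adj L x y ≤ k

theorem DegLe.mono {L : SimpleGraph (Fin n)} {k l : ℝ} (h : DegLe L k) (hkl : k ≤ l) :
    DegLe L l := fun x => (h x).trans hkl

theorem DegLe.sup_edge {L : SimpleGraph (Fin n)} {k : ℝ} (h : DegLe L k) {u v : Fin n}
    (huv : u ≠ v) (hL : ¬ L.Adj u v) : DegLe (L ⊔ SimpleGraph.edge u v) (k + 1) := by
  intro x
  rw [sum_adj_sup_edge huv hL]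
  have := h x
  by_cases h1 : x = u
  · rw [if_pos h1, if_neg (h1 ▸ huv)]; linarith
  · by_cases h2 : x = v
    · rw [if_neg h1, if_pos h2]; linarith
    · rw [if_neg h1, if_neg h2]; linarith

theorem DegLe.le_res {L : SimpleGraph (Fin n)} {k : ℝ} (h : DegLe L k) (r : ℕ) (x : Fin n) :
    r - k ≤ res r L x := by
  rw [res]; linarith [h x]

theorem DegLe.le_tot {L : SimpleGraph (Fin n)} {k : ℝ} (h : DegLe L k) (r : ℕ) :
    n * (r - k) ≤ tot r L := by
  rw [tot]
  calc (n : ℝ) * (r - k) = ∑ _x : Fin n, ((r : ℝ) - k) := by simp [mul_sub]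
    _ ≤ _ := sum_le_sum fun x _ => h.le_res r x

theorem DegLe.sum_cl_le {L : SimpleGraph (Fin n)} {k : ℝ} (h : DegLe L k) (x : Fin n) :
    ∑ y, cl L x y ≤ k + 1 := by
  rw [sum_cl]; linarith [h x]

/-- The standing size assumptions. -/
structure Big (n r : ℕ) : Prop where
  r_big : 100 ≤ (r : ℝ)
  n_big : (r : ℝ) ^ 6 ≤ n

theorem Big.rpos {r : ℕ} (h : Big n r) : 0 < (r : ℝ) := by linarith [h.r_big]

theorem Big.pow_le {r : ℕ} (h : Big n r) {k : ℕ} (hk : k ≤ 6) : (r : ℝ) ^ k ≤ n :=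
  (pow_le_pow_right₀ (by linarith [h.r_big]) hk).trans h.n_big

theorem Big.npos {r : ℕ} (h : Big n r) : 0 < (n : ℝ) :=
  (pow_pos h.rpos 6).trans_le h.n_big

theorem sum_cl_mul_res_le {r : ℕ} {L G : SimpleGraph (Fin n)} (hG : G ∈ regSet r L)
    (u : Fin n) : ∑ w, cl G u w * res r L w ≤ r * (r + 1) := by
  calc ∑ w, cl G u w * res r L w ≤ ∑ w, cl G u w * r :=
        sum_le_sum fun w _ => mul_le_mul_of_nonneg_left (res_le r L w) (cl_nonneg _ _ _)
    _ = _ := by rw [← sum_mul, sum_cl_of_mem hG]; ring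

theorem sum_cl_fr_cl_le {r : ℕ} {L G : SimpleGraph (Fin n)} (hG : G ∈ regSet r L)
    (u v : Fin n) : ∑ w, ∑ x, cl G u w * fr L G w x * cl G x v ≤ r * (r + 1) := by
  refine le_trans ?_ (sum_cl_mul_res_le hG u)
  refine sum_le_sum fun w _ => ?_
  rw [← sum_fr hG, mul_sum]
  refine sum_le_sum fun x _ => ?_
  exact mul_le_of_le_one_right (mul_nonneg (cl_nonneg _ _ _) (fr_nonneg _ _ _ _)) (cl_le_one _ _ _)

theorem sum_fr_cl_fr_le {r : ℕ} {L G : SimpleGraph (Fin n)} (hG : G ∈ regSet r L)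
    (u v : Fin n) : ∑ w, ∑ x, fr L G u w * cl G w x * fr L G x v ≤ r * (r + 1) := by
  calc _ ≤ ∑ w, ∑ x, fr L G u w * cl G w x := sum_le_sum fun w _ => sum_le_sum fun x _ =>
        mul_le_of_le_one_right (mul_nonneg (fr_nonneg _ _ _ _) (cl_nonneg _ _ _))
          (fr_le_one _ _ _ _)
    _ = res r L u * (r + 1) := by
        simp only [← mul_sum, sum_cl_of_mem hG, ← sum_mul, sum_fr hG]
    _ ≤ _ := mul_le_mul_of_nonneg_right (res_le r L u) (by positivity)

theorem cl_fr_cl_nonneg (L G : SimpleGraph (Fin n)) (u v : Fin n) :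
    0 ≤ ∑ w, ∑ x, cl G u w * fr L G w x * cl G x v :=
  sum_nonneg fun _ _ => sum_nonneg fun _ _ =>
    mul_nonneg (mul_nonneg (cl_nonneg _ _ _) (fr_nonneg _ _ _ _)) (cl_nonneg _ _ _)

theorem fr_cl_fr_nonneg (L G : SimpleGraph (Fin n)) (u v : Fin n) :
    0 ≤ ∑ w, ∑ x, fr L G u w * cl G w x * fr L G x v :=
  sum_nonneg fun _ _ => sum_nonneg fun _ _ =>
    mul_nonneg (mul_nonneg (fr_nonneg _ _ _ _) (cl_nonneg _ _ _)) (fr_nonneg _ _ _ _)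

theorem Big.tot_bounds {r : ℕ} (h : Big n r) {L : SimpleGraph (Fin n)} (hd : DegLe L 10) :
    n * r * (9 / 10) ≤ tot r L := by
  have := hd.le_tot r
  have := h.r_big
  have := h.npos
  nlinarith

theorem Big.sq_le {r : ℕ} (h : Big n r) : 1000000 * (r : ℝ) ^ 3 ≤ n := by
  have h1 := h.n_big
  have h2 := h.r_big
  have : (100 : ℝ) ^ 3 ≤ (r : ℝ) ^ 3 := pow_le_pow_left₀ (by norm_num) h2 3
  nlinarith [pow_pos h.rpos 3]

/-- Crude bound on the effect of adding one edge. -/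
theorem cnt_sup_edge_le {r : ℕ} (h : Big n r) {L : SimpleGraph (Fin n)} (hd : DegLe L 10)
    {u v : Fin n} (huv : u ≠ v) (hL : ¬ L.Adj u v) :
    cnt r (L ⊔ SimpleGraph.edge u v) ≤ 2 * r / n * cnt r L := by
  have key := gsum_switch_sum r huv hL
  have h1 : gsum r L (fun G => fr L G u v * (tot r L - 2 * (r * (r + 1)))) ≤
      gsum r L (fun G => fr L G u v * (tot r L - ∑ w, cl G u w * res r L w
        - ∑ x, cl G v x * res r L x + ∑ w, ∑ x, cl G u w * fr L G w x * cl G x v)) := by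
    refine gsum_mono fun G hG => mul_le_mul_of_nonneg_left ?_ (fr_nonneg _ _ _ _)
    linarith [sum_cl_mul_res_le hG u, sum_cl_mul_res_le hG v, cl_fr_cl_nonneg L G u v]
  have h2 : gsum r L (fun G => (1 - fr L G u v) * (res r L u * res r L v
        - ∑ w, ∑ x, fr L G u w * cl G w x * fr L G x v)) ≤ gsum r L (fun _ => (r : ℝ) ^ 2) := by
    refine gsum_mono fun G hG => ?_
    have a1 := fr_nonneg L G u v
    have a2 := fr_le_one L G u v
    have a3 := fr_cl_fr_nonneg L G u v
    have a4 := mul_le_mul (res_le r L u) (res_le r L v) (res_nonneg_of_mem hG v) (Nat.cast_nonneg r)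
    calc _ ≤ (1 - fr L G u v) * (res r L u * res r L v) := by
          apply mul_le_mul_of_nonneg_left _ (by linarith); linarith
      _ ≤ 1 * (res r L u * res r L v) := by
          apply mul_le_mul_of_nonneg_right (by linarith)
          exact mul_nonneg (res_nonneg_of_mem hG u) (res_nonneg_of_mem hG v)
      _ ≤ _ := by nlinarith
  rw [gsum_const] at h2
  rw [gsum_mul_const, gsum_fr_eq_cnt r huv hL] at h1
  have h3 : cnt r (L ⊔ SimpleGraph.edge u v) * (n * r / 2) ≤ cnt r L * r ^ 2 := by
    refine le_trans (mul_le_mul_of_nonneg_left ?_ (cnt_nonneg _ _)) ((h1.trans key.le).trans h2)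
    have := h.tot_bounds hd
    have := h.sq_le
    have h3 := h.rpos
    have := h.r_big
    nlinarith [sq_nonneg (r : ℝ), pow_pos h3 3]
  have hn := h.npos
  have hr := h.rpos
  rw [div_mul_eq_mul_div, le_div_iff₀ hn]
  have : (cnt r (L ⊔ SimpleGraph.edge u v) * n) * (r / 2) ≤ (2 * r * cnt r L) * (r / 2) := by
    linarith
  exact le_of_mul_le_mul_right this (by positivity)

/-- Two-edge version of `gsum_fr`. -/
theorem fr_sup_edge {L : SimpleGraph (Fin n)} {u v x y : Fin n}
    (hne : ¬ ((x = u ∧ y = v) ∨ (x = v ∧ y = u))) (G : SimpleGraph (Fin n)) :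
    fr (L ⊔ SimpleGraph.edge u v) G x y = fr L G x y := by
  have : (L ⊔ SimpleGraph.edge u v).Adj x y ↔ L.Adj x y := by
    rw [SimpleGraph.sup_adj, SimpleGraph.edge_adj]; tauto
  by_cases h1 : L.Adj x y
  · rw [fr_eq_zero h1, fr_eq_zero (this.2 h1)]
  · rw [fr_eq_adj h1, fr_eq_adj (fun h' => h1 (this.1 h'))]

theorem gsum_fr_le {r : ℕ} (h : Big n r) {L : SimpleGraph (Fin n)} (hd : DegLe L 10)
    (u v : Fin n) : gsum r L (fun G => fr L G u v) ≤ 2 * r / n * cnt r L := by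
  have hq : 0 ≤ 2 * r / n * cnt r L :=
    mul_nonneg (div_nonneg (mul_nonneg two_pos.le h.rpos.le) h.npos.le) (cnt_nonneg _ _)
  by_cases huv : u = v
  · subst huv
    simpa [fr_self, gsum] using hq
  by_cases hL : L.Adj u v
  · simpa [fr_eq_zero hL, gsum] using hq
  rw [gsum_fr_eq_cnt r huv hL]
  exact cnt_sup_edge_le h hd huv hL

theorem gsum_fr_mul_le {r : ℕ} (h : Big n r) {L : SimpleGraph (Fin n)} (hd : DegLe L 9)
    {u v : Fin n} {φ : SimpleGraph (Fin n) → ℝ} {c : ℝ} (hc : 0 ≤ c)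
    (hφ : u ≠ v → ¬ L.Adj u v → gsum r (L ⊔ SimpleGraph.edge u v) φ
      ≤ c * cnt r (L ⊔ SimpleGraph.edge u v)) :
    gsum r L (fun G => fr L G u v * φ G) ≤ c * (2 * r / n) * cnt r L := by
  have hq : 0 ≤ c * (2 * r / n) * cnt r L :=
    mul_nonneg (mul_nonneg hc (div_nonneg (mul_nonneg two_pos.le h.rpos.le) h.npos.le))
      (cnt_nonneg _ _)
  by_cases huv : u = v
  · subst huv
    simpa [fr_self, gsum] using hq
  by_cases hL : L.Adj u v
  · simpa [fr_eq_zero hL, gsum] using hq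
  rw [gsum_fr r huv hL]
  refine (hφ huv hL).trans ?_
  rw [mul_assoc]
  exact mul_le_mul_of_nonneg_left (cnt_sup_edge_le h (hd.mono (by norm_num)) huv hL) hc

theorem gsum_fr_fr_le {r : ℕ} (h : Big n r) {L : SimpleGraph (Fin n)} (hd : DegLe L 9)
    {u v w x : Fin n} (h1 : ¬ ((w = u ∧ x = v) ∨ (w = v ∧ x = u))) :
    gsum r L (fun G => fr L G u v * fr L G w x) ≤ (2 * r / n) ^ 2 * cnt r L := by
  rw [sq]
  have hq : 0 ≤ 2 * r / (n : ℝ) := div_nonneg (mul_nonneg two_pos.le h.rpos.le) h.npos.le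
  refine gsum_fr_mul_le h hd hq fun huv hL => ?_
  simp only [← fr_sup_edge (L := L) h1]
  exact gsum_fr_le h ((hd.sup_edge huv hL).mono (by norm_num)) _ _

theorem gsum_fr_fr_fr_le {r : ℕ} (h : Big n r) {L : SimpleGraph (Fin n)} (hd : DegLe L 8)
    {u v w x y z : Fin n} (h1 : ¬ ((w = u ∧ x = v) ∨ (w = v ∧ x = u)))
    (h2 : ¬ ((y = u ∧ z = v) ∨ (y = v ∧ z = u))) (h3 : ¬ ((y = w ∧ z = x) ∨ (y = x ∧ z = w))) :
    gsum r L (fun G => fr L G u v * (fr L G w x * fr L G y z)) ≤ (2 * r / n) ^ 3 * cnt r L := by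
  rw [pow_succ]
  have hq : 0 ≤ 2 * r / (n : ℝ) := div_nonneg (mul_nonneg two_pos.le h.rpos.le) h.npos.le
  refine gsum_fr_mul_le h (hd.mono (by norm_num)) (by positivity) fun huv hL => ?_
  simp only [← fr_sup_edge (L := L) h1, ← fr_sup_edge (L := L) h2]
  exact gsum_fr_fr_le h ((hd.sup_edge huv hL).mono (by norm_num)) h3

theorem fff_split {r : ℕ} {L G : SimpleGraph (Fin n)} (hG : G ∈ regSet r L) (u v : Fin n) :
    ∑ w, ∑ x, fr L G u w * fr L G w x * fr L G x v =
      fr L G u v * (res r L u + res r L v - 1) +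
      ∑ w, ∑ x, if w ≠ v ∧ x ≠ u then fr L G u w * (fr L G w x * fr L G x v) else 0 := by
  have e : ∀ w x, fr L G u w * fr L G w x * fr L G x v =
      (if x = u then fr L G u w * fr L G u v else 0) +
      (if w = v then fr L G u v * fr L G v x else 0) -
      (if w = v then (if x = u then fr L G u v else 0) else 0) +
      if w ≠ v ∧ x ≠ u then fr L G u w * (fr L G w x * fr L G x v) else 0 := by
    intro w x
    by_cases h1 : w = v
    · by_cases h2 : x = u
      · subst h1 h2
        rw [fr_symm L G w x]
        simp [fr_mul_self]
      · subst h1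
        simp [h2, mul_assoc, fr_symm L G x w, fr_mul_self]
    · by_cases h2 : x = u
      · subst h2
        simp [h1, fr_symm L G w x, fr_mul_self]
      · simp [h1, h2, mul_assoc]
  simp only [e, sum_add_distrib, sum_sub_distrib]
  congr 1
  have e' : ∀ w, ∑ x, (if w = v then (if x = u then fr L G u v else 0) else 0) =
      if w = v then fr L G u v else 0 := by
    intro w; split_ifs <;> simp
  simp only [e', sum_ite_eq', mem_univ, if_true, ← sum_mul, sum_fr hG]
  rw [sum_comm]
  simp only [sum_ite_eq', mem_univ, if_true, ← mul_sum, sum_fr hG]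
  ring

theorem Big.q_nonneg {r : ℕ} (h : Big n r) : 0 ≤ 2 * r / (n : ℝ) :=
  div_nonneg (mul_nonneg two_pos.le h.rpos.le) h.npos.le

theorem gsum_path_le {r : ℕ} (h : Big n r) {L : SimpleGraph (Fin n)} (hd : DegLe L 8)
    {u v : Fin n} (huv : u ≠ v) (w x : Fin n) :
    gsum r L (fun G => if w ≠ v ∧ x ≠ u then fr L G u w * (fr L G w x * fr L G x v) else 0) ≤
      (2 * r / n) ^ 3 * cnt r L := by
  by_cases hc : w ≠ v ∧ x ≠ u
  · simp only [if_pos hc]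
    refine gsum_fr_fr_fr_le h hd ?_ ?_ ?_
    · rintro (⟨a, b⟩ | ⟨a, b⟩)
      · exact hc.2 (b.trans a)
      · exact hc.2 b
    · rintro (⟨a, b⟩ | ⟨a, b⟩)
      · exact hc.2 a
      · exact huv b.symm
    · rintro (⟨a, b⟩ | ⟨a, b⟩)
      · exact hc.1 (a.symm.trans b.symm)
      · exact hc.1 b.symm
  · simp only [if_neg hc]
    rw [gsum_const, mul_zero]
    exact mul_nonneg (pow_nonneg h.q_nonneg 3) (cnt_nonneg _ _)

theorem gsum_fr_cl_fr_le {r : ℕ} (h : Big n r) {L : SimpleGraph (Fin n)} (hd : DegLe L 8)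
    {u v : Fin n} (huv : u ≠ v) (hL : ¬ L.Adj u v) (w x : Fin n) :
    gsum r L (fun G => fr L G u w * cl L w x * fr L G x v) ≤
      cl L w x * ((2 * r / n) ^ 2 * cnt r L) := by
  have : ∀ G, fr L G u w * cl L w x * fr L G x v = cl L w x * (fr L G u w * fr L G x v) := by
    intro G; ring
  simp only [this, gsum_const_mul]
  by_cases hc : x = u ∧ v = w
  · rw [← hc.2, hc.1, cl_eq_zero (fun h => hL h.symm) huv.symm]; simp
  refine mul_le_mul_of_nonneg_left (gsum_fr_fr_le h (hd.mono (by norm_num)) ?_) (cl_nonneg _ _ _)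
  rintro (⟨a, b⟩ | ⟨a, b⟩)
  · exact hc ⟨a, b⟩
  · exact huv b.symm

theorem gsum_fr_cl_fr_sum_le {r : ℕ} (h : Big n r) {L : SimpleGraph (Fin n)} (hd : DegLe L 8)
    {u v : Fin n} (huv : u ≠ v) (hL : ¬ L.Adj u v) :
    gsum r L (fun G => ∑ w, ∑ x, fr L G u w * cl L w x * fr L G x v) ≤
      n * 9 * ((2 * r / n) ^ 2 * cnt r L) := by
  rw [gsum_sum]
  simp only [gsum_sum]
  calc _ ≤ ∑ w, ∑ x, cl L w x * ((2 * r / n) ^ 2 * cnt r L) :=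
        sum_le_sum fun w _ => sum_le_sum fun x _ => gsum_fr_cl_fr_le h hd huv hL w x
    _ = (∑ w, ∑ x, cl L w x) * ((2 * r / n) ^ 2 * cnt r L) := by simp only [sum_mul]
    _ ≤ (∑ _w : Fin n, (9 : ℝ)) * ((2 * r / n) ^ 2 * cnt r L) := by
        apply mul_le_mul_of_nonneg_right _ (mul_nonneg (pow_nonneg h.q_nonneg 2) (cnt_nonneg _ _))
        exact sum_le_sum fun w _ => (hd.sum_cl_le w).trans (by norm_num)
    _ = _ := by simp

theorem fr_cl_fr_split {r : ℕ} {L G : SimpleGraph (Fin n)} (hG : G ∈ regSet r L) (u v : Fin n) :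
    ∑ w, ∑ x, fr L G u w * cl G w x * fr L G x v =
      fr L G u v * (res r L u + res r L v - 1) +
      (∑ w, ∑ x, if w ≠ v ∧ x ≠ u then fr L G u w * (fr L G w x * fr L G x v) else 0) +
      ∑ w, ∑ x, fr L G u w * cl L w x * fr L G x v := by
  rw [← fff_split hG]
  simp only [← sum_add_distrib]
  refine sum_congr rfl fun w _ => sum_congr rfl fun x _ => ?_
  rw [cl_eq_fr_add (mem_regSet.1 hG).2 w x]; ring

/-- First-order estimate for the effect of adding one edge. -/
theorem abs_cnt_sup_edge_mul_tot_sub_le {r : ℕ} (h : Big n r) {L : SimpleGraph (Fin n)}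
    (hd : DegLe L 8) {u v : Fin n} (huv : u ≠ v) (hL : ¬ L.Adj u v) :
    |cnt r (L ⊔ SimpleGraph.edge u v) * tot r L - cnt r L * (res r L u * res r L v)| ≤
      15 * r ^ 3 / n * cnt r L := by
  set c := cnt r L with hc
  set c1 := cnt r (L ⊔ SimpleGraph.edge u v) with hc1
  have hc0 : 0 ≤ c := cnt_nonneg _ _
  have hc10 : 0 ≤ c1 := cnt_nonneg _ _
  have hle : c1 ≤ 2 * r / n * c := cnt_sup_edge_le h (hd.mono (by norm_num)) huv hL
  have hrb := h.r_big
  have hnpos := h.npos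
  have key := gsum_switch_sum r huv hL
  set A : SimpleGraph (Fin n) → ℝ := fun G => ∑ w, cl G u w * res r L w
    + ∑ x, cl G v x * res r L x - ∑ w, ∑ x, cl G u w * fr L G w x * cl G x v
    - res r L u * res r L v + ∑ w, ∑ x, fr L G u w * cl G w x * fr L G x v with hA
  have key2 : c1 * tot r L - c * (res r L u * res r L v) =
      gsum r L (fun G => fr L G u v * A G) -
        gsum r L (fun G => ∑ w, ∑ x, fr L G u w * cl G w x * fr L G x v) := by
    rw [hc1, ← gsum_fr_eq_cnt r huv hL, ← gsum_mul_const, hc, ← gsum_const]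
    have e1 : ∀ G, fr L G u v * (tot r L - ∑ w, cl G u w * res r L w
        - ∑ x, cl G v x * res r L x + ∑ w, ∑ x, cl G u w * fr L G w x * cl G x v) =
        fr L G u v * tot r L - fr L G u v * A G
          - fr L G u v * (res r L u * res r L v
        - ∑ w, ∑ x, fr L G u w * cl G w x * fr L G x v) := by
      intro G; rw [hA]; ring
    have e2 : ∀ G, (1 - fr L G u v) * (res r L u * res r L v
        - ∑ w, ∑ x, fr L G u w * cl G w x * fr L G x v) = res r L u * res r L v
        - ∑ w, ∑ x, fr L G u w * cl G w x * fr L G x v -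
        fr L G u v * (res r L u * res r L v
        - ∑ w, ∑ x, fr L G u w * cl G w x * fr L G x v) := by
      intro G; ring
    simp only [e1, e2, gsum_sub] at key
    linarith
  have hAabs : ∀ G ∈ regSet r L, |A G| ≤ 3 * (r * (r + 1)) := by
    intro G hG
    have b1 := sum_cl_mul_res_le hG u
    have b2 := sum_cl_mul_res_le hG v
    have b3 := cl_fr_cl_nonneg L G u v
    have b4 := sum_cl_fr_cl_le hG u v
    have b5 := fr_cl_fr_nonneg L G u v
    have b6 := sum_fr_cl_fr_le hG u v
    have b7 := mul_le_mul (res_le r L u) (res_le r L v) (res_nonneg_of_mem hG v) (Nat.cast_nonneg r)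
    have b8 := mul_nonneg (res_nonneg_of_mem hG u) (res_nonneg_of_mem hG v)
    have b9 : ∀ z, 0 ≤ ∑ w, cl G z w * res r L w := fun z =>
      sum_nonneg fun w _ => mul_nonneg (cl_nonneg _ _ _) (res_nonneg_of_mem hG w)
    have b10 := b9 u
    have b11 := b9 v
    rw [abs_le, hA]
    constructor <;> nlinarith
  have h1 : |gsum r L (fun G => fr L G u v * A G)| ≤ c1 * (3 * (r * (r + 1))) := by
    rw [hc1, ← gsum_fr_eq_cnt r huv hL, ← gsum_mul_const]
    refine (abs_sum_le_sum_abs _ _).trans (sum_le_sum fun G hG => ?_)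
    rw [abs_mul, abs_of_nonneg (fr_nonneg _ _ _ _)]
    exact mul_le_mul_of_nonneg_left (hAabs G hG) (fr_nonneg _ _ _ _)
  have h2 : gsum r L (fun G => ∑ w, ∑ x, fr L G u w * cl G w x * fr L G x v) ≤
      c1 * (2 * r) + n ^ 2 * ((2 * r / n) ^ 3 * c) + n * 9 * ((2 * r / n) ^ 2 * c) := by
    rw [gsum_congr fun G hG => fr_cl_fr_split hG u v, gsum_add, gsum_add, gsum_mul_const,
      gsum_fr_eq_cnt r huv hL]
    refine add_le_add (add_le_add ?_ ?_) (gsum_fr_cl_fr_sum_le h hd huv hL)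
    · exact mul_le_mul_of_nonneg_left (by linarith [res_le r L u, res_le r L v]) hc10
    · rw [gsum_sum]
      simp only [gsum_sum]
      calc _ ≤ ∑ _w : Fin n, ∑ _x : Fin n, ((2 * r / n : ℝ) ^ 3 * c) :=
            sum_le_sum fun w _ => sum_le_sum fun x _ => gsum_path_le h hd huv w x
        _ = _ := by simp; ring
  have h3 : 0 ≤ gsum r L (fun G => ∑ w, ∑ x, fr L G u w * cl G w x * fr L G x v) :=
    gsum_nonneg fun G _ => fr_cl_fr_nonneg L G u v
  rw [key2]
  have h4 : c1 * (3 * (r * (r + 1))) + (c1 * (2 * r) + n ^ 2 * ((2 * r / n) ^ 3 * c)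
      + n * 9 * ((2 * r / n) ^ 2 * c)) ≤ 15 * r ^ 3 / n * c := by
    have : c1 * (3 * (r * (r + 1)) + 2 * r) ≤ (2 * r / n * c) * (3 * (r * (r + 1)) + 2 * r) :=
      mul_le_mul_of_nonneg_right hle (by positivity)
    have e : (2 * r / n * c) * (3 * (r * (r + 1)) + 2 * r) + n ^ 2 * ((2 * r / n) ^ 3 * c)
      + n * 9 * ((2 * r / n) ^ 2 * c) = (14 * r ^ 3 + 46 * r ^ 2) / n * c := by
      field_simp; ring
    have : (14 * (r : ℝ) ^ 3 + 46 * r ^ 2) / n * c ≤ 15 * r ^ 3 / n * c := by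
      apply mul_le_mul_of_nonneg_right _ hc0
      apply div_le_div_of_nonneg_right _ hnpos.le
      nlinarith [sq_nonneg (r : ℝ)]
    linarith
  rw [abs_le] at h1 ⊢
  constructor <;> linarith [h1.1, h1.2]

theorem abs_cnt_sup_edge_sub_le {r : ℕ} (h : Big n r) {L : SimpleGraph (Fin n)}
    (hd : DegLe L 8) {u v : Fin n} (huv : u ≠ v) (hL : ¬ L.Adj u v) {D : ℝ}
    (hD : |D - tot r L| ≤ 10) :
    |cnt r (L ⊔ SimpleGraph.edge u v) - cnt r L * (res r L u * res r L v / D)| ≤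
      20 * r ^ 2 / n ^ 2 * cnt r L := by
  have key := abs_cnt_sup_edge_mul_tot_sub_le h hd huv hL
  set c := cnt r L with hc
  set c1 := cnt r (L ⊔ SimpleGraph.edge u v) with hc1
  have hc0 : 0 ≤ c := cnt_nonneg _ _
  have hrb := h.r_big
  have hrp := h.rpos
  have hn := h.npos
  have ht := h.tot_bounds (hd.mono (by norm_num))
  have hn2 := h.sq_le
  have hnr : 100 ≤ n * (r : ℝ) := by
    have := h.pow_le (k := 1) (by norm_num)
    nlinarith
  have htp : 0 < tot r L := by nlinarith
  rw [abs_le] at hD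
  have hDl : n * (r : ℝ) * (4 / 5) ≤ D := by linarith
  have hDp : 0 < D := by nlinarith
  have hu := res_le r L u
  have hv := res_le r L v
  have hu0 : 0 ≤ res r L u := by linarith [hd.le_res r u]
  have hv0 : 0 ≤ res r L v := by linarith [hd.le_res r v]
  have huv2 : res r L u * res r L v ≤ r ^ 2 := by nlinarith
  have e1 : |c1 - c * (res r L u * res r L v / tot r L)| ≤ (18 * r ^ 2 / n ^ 2) * c := by
    have : c1 - c * (res r L u * res r L v / tot r L) =
        (c1 * tot r L - c * (res r L u * res r L v)) / tot r L := by field_simp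
    rw [this, abs_div, abs_of_pos htp, div_le_iff₀ htp]
    refine key.trans ?_
    have : 15 * (r : ℝ) ^ 3 / n * c = (18 * r ^ 2 / n ^ 2) * c * (n * r * (15 / 18)) := by
      field_simp
    rw [this]
    refine mul_le_mul_of_nonneg_left ?_ (by positivity)
    nlinarith
  have e2 : |c * (res r L u * res r L v / tot r L) - c * (res r L u * res r L v / D)| ≤
      (2 * r ^ 2 / n ^ 2) * c := by
    have : c * (res r L u * res r L v / tot r L) - c * (res r L u * res r L v / D) =
        c * ((res r L u * res r L v) * (D - tot r L) / (tot r L * D)) := by field_simp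
    rw [this, abs_mul, abs_of_nonneg hc0, mul_comm]
    refine mul_le_mul_of_nonneg_right ?_ hc0
    rw [abs_div, abs_mul, abs_of_nonneg (mul_nonneg hu0 hv0), abs_of_pos (mul_pos htp hDp),
      div_le_div_iff₀ (mul_pos htp hDp) (by positivity)]
    have f1 : res r L u * res r L v * |D - tot r L| ≤ r ^ 2 * 10 :=
      mul_le_mul huv2 (abs_le.2 hD) (abs_nonneg _) (by positivity)
    have f2 : (n * (r : ℝ) * (9 / 10)) * (n * (r : ℝ) * (4 / 5)) ≤ tot r L * D :=
      mul_le_mul ht hDl (by positivity) htp.le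
    calc _ ≤ r ^ 2 * 10 * (n : ℝ) ^ 2 := mul_le_mul_of_nonneg_right f1 (by positivity)
      _ ≤ 2 * r ^ 2 * ((n * (r : ℝ) * (9 / 10)) * (n * (r : ℝ) * (4 / 5))) := by
          have : (100 : ℝ) ^ 2 ≤ r ^ 2 := pow_le_pow_left₀ (by norm_num) hrb 2
          have h3 : 0 ≤ (n : ℝ) ^ 2 * r ^ 2 := by positivity
          nlinarith
      _ ≤ _ := mul_le_mul_of_nonneg_left f2 (by positivity)
  have := abs_add_le (c1 - c * (res r L u * res r L v / tot r L))
    (c * (res r L u * res r L v / tot r L) - c * (res r L u * res r L v / D))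
  rw [sub_add_sub_cancel] at this
  refine this.trans ((add_le_add e1 e2).trans (le_of_eq ?_))
  ring

end

section

variable {n : ℕ}

/-- Sum of the squared residual degrees. -/
noncomputable def sqTot (r : ℕ) (L : SimpleGraph (Fin n)) : ℝ := ∑ x, res r L x ^ 2

/-- Sum of the residual degrees of the `L`-neighbours of `u`. -/
noncomputable def nbRes (r : ℕ) (L : SimpleGraph (Fin n)) (u : Fin n) : ℝ :=
  ∑ t, adj L u t * res r L t

/-- Sum of products of residual degrees over ordered edges of `L`. -/
noncomputable def edgeTot (r : ℕ) (L : SimpleGraph (Fin n)) : ℝ :=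
  ∑ s, res r L s * nbRes r L s

theorem DegLe.res_pos {r : ℕ} (h : Big n r) {L : SimpleGraph (Fin n)} (hd : DegLe L 10)
    (x : Fin n) : 90 ≤ res r L x := by
  linarith [hd.le_res r x, h.r_big]

theorem Big.of_abs_le {r : ℕ} (h : Big n r) {L : SimpleGraph (Fin n)} (hd : DegLe L 10) {D : ℝ}
    (hD : |D - tot r L| ≤ 10) : n * (r : ℝ) * (4 / 5) ≤ D := by
  have ht := h.tot_bounds hd
  have hrb := h.r_big
  have hnr : 100 ≤ n * (r : ℝ) := by
    have := h.pow_le (k := 1) (by norm_num)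
    nlinarith
  rw [abs_le] at hD
  linarith

theorem mul_div_le_of_le {r : ℕ} (h : Big n r) {a b D : ℝ} (ha : 0 ≤ a) (har : a ≤ r)
    (hb : 0 ≤ b) (hbr : b ≤ r) (hD : n * (r : ℝ) * (4 / 5) ≤ D) :
    0 ≤ a * b / D ∧ a * b / D ≤ 2 * r / n := by
  have hn := h.npos
  have hr := h.rpos
  have hDp : 0 < D := lt_of_lt_of_le (by positivity) hD
  refine ⟨by positivity, ?_⟩
  rw [div_le_div_iff₀ hDp hn]
  have : a * b ≤ r * r := mul_le_mul har hbr hb hr.le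
  calc a * b * n ≤ r * r * n := mul_le_mul_of_nonneg_right this hn.le
    _ ≤ 2 * r * (n * r * (4 / 5)) := by nlinarith [mul_pos (mul_pos hr hr) hn]
    _ ≤ _ := mul_le_mul_of_nonneg_left hD (by positivity)

theorem abs_gsum_fr_sub_le {r : ℕ} (h : Big n r) {L : SimpleGraph (Fin n)}
    (hd : DegLe L 8) {u v : Fin n} (huv : u ≠ v) (hL : ¬ L.Adj u v) {D : ℝ}
    (hD : |D - tot r L| ≤ 10) :
    |gsum r L (fun G => fr L G u v) - cnt r L * (res r L u * res r L v / D)| ≤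
      20 * r ^ 2 / n ^ 2 * cnt r L := by
  rw [gsum_fr_eq_cnt r huv hL]
  exact abs_cnt_sup_edge_sub_le h hd huv hL hD

theorem abs_gsum_fr_mul_sub_le {r : ℕ} (h : Big n r) {L : SimpleGraph (Fin n)}
    (hd : DegLe L 8) {u v : Fin n} (huv : u ≠ v) (hL : ¬ L.Adj u v) {D : ℝ}
    (hD : |D - tot r L| ≤ 10) {φ : SimpleGraph (Fin n) → ℝ} {p e : ℝ} (hp : 0 ≤ p)
    (he : 0 ≤ e)
    (hφ : |gsum r (L ⊔ SimpleGraph.edge u v) φ - cnt r (L ⊔ SimpleGraph.edge u v) * p| ≤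
      e * cnt r (L ⊔ SimpleGraph.edge u v)) :
    |gsum r L (fun G => fr L G u v * φ G) - cnt r L * (res r L u * res r L v / D * p)| ≤
      (e * (2 * r / n) + 20 * r ^ 2 / n ^ 2 * p) * cnt r L := by
  rw [gsum_fr r huv hL]
  set c1 := cnt r (L ⊔ SimpleGraph.edge u v)
  have h1 : |c1 * p - cnt r L * (res r L u * res r L v / D * p)| ≤
      (20 * r ^ 2 / n ^ 2 * p) * cnt r L := by
    have := abs_cnt_sup_edge_sub_le h hd huv hL hD
    have e1 : c1 * p - cnt r L * (res r L u * res r L v / D * p) =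
      (c1 - cnt r L * (res r L u * res r L v / D)) * p := by ring
    rw [e1, abs_mul, abs_of_nonneg hp]
    calc _ ≤ (20 * r ^ 2 / n ^ 2 * cnt r L) * p := mul_le_mul_of_nonneg_right this hp
      _ = _ := by ring
  have h2 : e * c1 ≤ e * (2 * r / n) * cnt r L := by
    rw [mul_assoc]
    exact mul_le_mul_of_nonneg_left (cnt_sup_edge_le h (hd.mono (by norm_num)) huv hL) he
  have h3 := abs_add_le (gsum r (L ⊔ SimpleGraph.edge u v) φ - c1 * p)
    (c1 * p - cnt r L * (res r L u * res r L v / D * p))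
  rw [sub_add_sub_cancel] at h3
  linarith

theorem abs_sub_tot_sup_edge {r : ℕ} {L : SimpleGraph (Fin n)} {u v : Fin n} (huv : u ≠ v)
    (hL : ¬ L.Adj u v) {D a : ℝ} (hD : |D - tot r L| ≤ a) :
    |D - tot r (L ⊔ SimpleGraph.edge u v)| ≤ a + 2 := by
  rw [tot_sup_edge r huv hL]
  rw [abs_le] at hD ⊢
  constructor <;> linarith

theorem abs_gsum_fr_fr_sub_le {r : ℕ} (h : Big n r) {L : SimpleGraph (Fin n)}
    (hd : DegLe L 7) {u v w x : Fin n} (huv : u ≠ v) (hL : ¬ L.Adj u v) (hwx : w ≠ x)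
    (hL' : ¬ L.Adj w x) (h1 : ¬ ((w = u ∧ x = v) ∨ (w = v ∧ x = u))) {D : ℝ}
    (hD : |D - tot r L| ≤ 8) :
    |gsum r L (fun G => fr L G u v * fr L G w x) - cnt r L *
      (res r L u * res r L v / D * (res r (L ⊔ SimpleGraph.edge u v) w *
        res r (L ⊔ SimpleGraph.edge u v) x / D))| ≤ 80 * r ^ 3 / n ^ 3 * cnt r L := by
  have hd' := hd.sup_edge huv hL
  have hD' := h.of_abs_le (hd.mono (by norm_num)) (hD.trans (by norm_num))
  have hb := mul_div_le_of_le h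
    ((by norm_num : (0 : ℝ) ≤ 90).trans (DegLe.res_pos h (hd'.mono (by norm_num)) w))
    (res_le r _ w) ((by norm_num : (0 : ℝ) ≤ 90).trans (DegLe.res_pos h (hd'.mono (by norm_num)) x))
    (res_le r _ x) hD'
  have hadj : ¬ (L ⊔ SimpleGraph.edge u v).Adj w x := by
    rw [SimpleGraph.sup_adj, SimpleGraph.edge_adj]; tauto
  have hn := h.npos
  have hr := h.rpos
  have := abs_gsum_fr_mul_sub_le h (hd.mono (by norm_num)) huv hL (D := D)
    (hD.trans (by norm_num)) hb.1 (by positivity : 0 ≤ 20 * (r : ℝ) ^ 2 / n ^ 2)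
    (φ := fun G => fr (L ⊔ SimpleGraph.edge u v) G w x)
    (abs_gsum_fr_sub_le h (hd'.mono (by norm_num)) hwx hadj
      ((abs_sub_tot_sup_edge huv hL hD).trans (by norm_num)))
  simp only [fr_sup_edge (L := L) h1] at this
  refine this.trans (mul_le_mul_of_nonneg_right ?_ (cnt_nonneg _ _))
  calc _ ≤ 20 * (r : ℝ) ^ 2 / n ^ 2 * (2 * r / n) + 20 * r ^ 2 / n ^ 2 * (2 * r / n) :=
        add_le_add le_rfl (mul_le_mul_of_nonneg_left hb.2 (by positivity))
    _ = _ := by field_simp; ring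

theorem abs_gsum_fr_fr_fr_sub_le {r : ℕ} (h : Big n r) {L : SimpleGraph (Fin n)}
    (hd : DegLe L 6) {u v w x y z : Fin n} (huv : u ≠ v) (hL : ¬ L.Adj u v) (hwx : w ≠ x)
    (hL' : ¬ L.Adj w x) (hyz : y ≠ z) (hL'' : ¬ L.Adj y z)
    (h1 : ¬ ((w = u ∧ x = v) ∨ (w = v ∧ x = u)))
    (h2 : ¬ ((y = u ∧ z = v) ∨ (y = v ∧ z = u)))
    (h3 : ¬ ((y = w ∧ z = x) ∨ (y = x ∧ z = w))) {D : ℝ}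
    (hD : |D - tot r L| ≤ 6) :
    |gsum r L (fun G => fr L G u v * (fr L G w x * fr L G y z)) - cnt r L *
      (res r L u * res r L v / D * (res r (L ⊔ SimpleGraph.edge u v) w *
        res r (L ⊔ SimpleGraph.edge u v) x / D *
        (res r (L ⊔ SimpleGraph.edge u v ⊔ SimpleGraph.edge w x) y *
        res r (L ⊔ SimpleGraph.edge u v ⊔ SimpleGraph.edge w x) z / D)))| ≤
      240 * r ^ 4 / n ^ 4 * cnt r L := by
  have hadj : ¬ (L ⊔ SimpleGraph.edge u v).Adj w x := by
    rw [SimpleGraph.sup_adj, SimpleGraph.edge_adj]; tauto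
  have hadj' : ¬ (L ⊔ SimpleGraph.edge u v).Adj y z := by
    rw [SimpleGraph.sup_adj, SimpleGraph.edge_adj]; tauto
  have hd' := hd.sup_edge huv hL
  have hd'' := hd'.sup_edge hwx hadj
  have hD' := h.of_abs_le (hd.mono (by norm_num)) (hD.trans (by norm_num))
  have hb := mul_div_le_of_le h
    ((by norm_num : (0 : ℝ) ≤ 90).trans (DegLe.res_pos h (hd'.mono (by norm_num)) w))
    (res_le r _ w) ((by norm_num : (0 : ℝ) ≤ 90).trans (DegLe.res_pos h (hd'.mono (by norm_num)) x))
    (res_le r _ x) hD'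
  have hb' := mul_div_le_of_le h
    ((by norm_num : (0 : ℝ) ≤ 90).trans (DegLe.res_pos h (hd''.mono (by norm_num)) y))
    (res_le r _ y)
    ((by norm_num : (0 : ℝ) ≤ 90).trans (DegLe.res_pos h (hd''.mono (by norm_num)) z))
    (res_le r _ z) hD'
  have hn := h.npos
  have hr := h.rpos
  have := abs_gsum_fr_mul_sub_le h (hd.mono (by norm_num)) huv hL (D := D)
    (hD.trans (by norm_num)) (mul_nonneg hb.1 hb'.1)
    (by positivity : 0 ≤ 80 * (r : ℝ) ^ 3 / n ^ 3)
    (abs_gsum_fr_fr_sub_le h (hd'.mono (by norm_num)) hwx hadj hyz hadj' h3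
      ((abs_sub_tot_sup_edge huv hL hD).trans (by norm_num)))
  simp only [fr_sup_edge (L := L) h1, fr_sup_edge (L := L) h2] at this
  refine this.trans (mul_le_mul_of_nonneg_right ?_ (cnt_nonneg _ _))
  calc _ ≤ 80 * (r : ℝ) ^ 3 / n ^ 3 * (2 * r / n) + 20 * r ^ 2 / n ^ 2 *
        ((2 * r / n) * (2 * r / n)) :=
        add_le_add le_rfl (mul_le_mul_of_nonneg_left
          (mul_le_mul hb.2 hb'.2 hb'.1 (by positivity)) (by positivity))
    _ = _ := by field_simp; ring

/-- Two-path counts starting with a prescribed edge. -/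
theorem abs_gsum_fr_sum_fr_res_sub_le {r : ℕ} (h : Big n r) {L : SimpleGraph (Fin n)}
    (hd : DegLe L 2) {u v : Fin n} (huv : u ≠ v) (hL : ¬ L.Adj u v) :
    |gsum r L (fun G => fr L G u v * ∑ s, fr L G u s * res r L s) -
      cnt r (L ⊔ SimpleGraph.edge u v) *
        (res r L v + (res r L u - 1) * (sqTot r L / tot r L))| ≤
      56 * r ^ 4 / n ^ 2 * cnt r L := by
  set c1 := cnt r (L ⊔ SimpleGraph.edge u v) with hc1
  set D := tot r L with hDdef
  have hn := h.npos
  have hr := h.rpos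
  have hrb := h.r_big
  have hc10 : 0 ≤ c1 := cnt_nonneg _ _
  have hd' := hd.sup_edge huv hL
  have hD0 : |D - tot r L| ≤ 0 := by simp [hDdef]
  have hDl := h.of_abs_le (hd.mono (by norm_num)) (hD0.trans (by norm_num))
  have hDp : 0 < D := lt_of_lt_of_le (by positivity) hDl
  have hres : ∀ x, 90 ≤ res r L x := fun x => DegLe.res_pos h (hd.mono (by norm_num)) x
  have hresr : ∀ x, res r L x ≤ r := fun x => res_le r L x
  have hpt : ∀ s, |gsum r L (fun G => fr L G u v * fr L G u s) * res r L s -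
      ((if s = v then c1 * res r L v else 0) + c1 * ((res r L u - 1) * res r L s ^ 2 / D))| ≤
      c1 * (20 * r ^ 3 / n ^ 2) + c1 * (cl L u s + if s = v then 1 else 0) * (2 * r ^ 2 / n) := by
    intro s
    have hpos : 0 ≤ (res r L u - 1) * res r L s ^ 2 / D := by
      have := hres u
      apply div_nonneg (mul_nonneg (by linarith) (sq_nonneg _)) hDp.le
    have hle : (res r L u - 1) * res r L s ^ 2 / D ≤ 2 * r ^ 2 / n := by
      have h1 := (mul_div_le_of_le h (a := res r L u - 1) (b := res r L s)
        (by linarith [hres u]) (by linarith [hresr u]) (by linarith [hres s]) (hresr s) hDl)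
      calc (res r L u - 1) * res r L s ^ 2 / D =
          ((res r L u - 1) * res r L s / D) * res r L s := by ring
        _ ≤ (2 * r / n) * r := mul_le_mul h1.2 (hresr s) (by linarith [hres s]) (by positivity)
        _ = _ := by ring
    have hA : 0 ≤ c1 * (20 * r ^ 3 / n ^ 2) := by positivity
    have hB : 0 ≤ c1 * (cl L u s + if s = v then 1 else 0) * (2 * r ^ 2 / n) := by
      have := cl_nonneg L u s
      split_ifs <;> positivity
    have hexc : 1 ≤ cl L u s + (if s = v then (1 : ℝ) else 0) →
        c1 * ((res r L u - 1) * res r L s ^ 2 / D) ≤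
        c1 * (20 * r ^ 3 / n ^ 2) + c1 * (cl L u s + if s = v then 1 else 0) * (2 * r ^ 2 / n) := by
      intro h1
      calc _ ≤ c1 * (2 * r ^ 2 / n) := mul_le_mul_of_nonneg_left hle hc10
        _ = c1 * 1 * (2 * r ^ 2 / n) := by ring
        _ ≤ c1 * (cl L u s + if s = v then 1 else 0) * (2 * r ^ 2 / n) := by gcongr
        _ ≤ _ := by linarith
    have hpp : 0 ≤ c1 * ((res r L u - 1) * res r L s ^ 2 / D) := mul_nonneg hc10 hpos
    by_cases hsv : s = v
    · subst hsv
      simp only [fr_mul_self, gsum_fr_eq_cnt r huv hL, if_true]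
      rw [show c1 * res r L s - (c1 * res r L s + c1 * ((res r L u - 1) * res r L s ^ 2 / D)) =
        -(c1 * ((res r L u - 1) * res r L s ^ 2 / D)) by ring, abs_neg, abs_of_nonneg hpp]
      have := hexc (by simp; exact cl_nonneg _ _ _)
      simpa using this
    · simp only [if_neg hsv, zero_add, add_zero] at hexc ⊢
      by_cases hsu : s = u
      · subst hsu
        simp only [fr_self, mul_zero]
        rw [gsum_const, mul_zero, zero_mul, zero_sub, abs_neg, abs_of_nonneg hpp]
        exact hexc (by simp [cl, adj_self])
      by_cases hLs : L.Adj u s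
      · simp only [fr_eq_zero hLs, mul_zero]
        rw [gsum_const, mul_zero, zero_mul, zero_sub, abs_neg, abs_of_nonneg hpp]
        refine hexc ?_
        rw [cl, adj_of_adj hLs]; split_ifs <;> norm_num
      have hne : ¬ ((u = u ∧ s = v) ∨ (u = v ∧ s = u)) := by tauto
      have hadj : ¬ (L ⊔ SimpleGraph.edge u v).Adj u s := by
        rw [SimpleGraph.sup_adj, SimpleGraph.edge_adj]; tauto
      have key := abs_gsum_fr_sub_le h (hd'.mono (by norm_num)) (Ne.symm hsu) hadj
        ((abs_sub_tot_sup_edge huv hL hD0).trans (by norm_num))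
      rw [gsum_fr r huv hL]
      simp only [fr_sup_edge (L := L) hne] at key
      rw [res_sup_edge r huv hL, res_sup_edge r huv hL, if_pos rfl, if_neg huv, if_neg hsu,
        if_neg hsv, sub_zero, sub_zero, sub_zero] at key
      rw [show c1 * ((res r L u - 1) * res r L s ^ 2 / D) =
        (c1 * ((res r L u - 1) * res r L s / D)) * res r L s by ring, ← sub_mul, abs_mul,
        abs_of_nonneg (by linarith [hres s] : 0 ≤ res r L s)]
      have h2 := cl_nonneg L u s
      have h3 : 0 ≤ c1 * cl L u s * (2 * r ^ 2 / n) := by positivity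
      calc _ ≤ (20 * r ^ 2 / n ^ 2 * c1) * r :=
            mul_le_mul key (hresr s) (by linarith [hres s]) (by positivity)
        _ = c1 * (20 * r ^ 3 / n ^ 2) := by ring
        _ ≤ _ := by linarith
  have e1 : gsum r L (fun G => fr L G u v * ∑ s, fr L G u s * res r L s) =
      ∑ s, gsum r L (fun G => fr L G u v * fr L G u s) * res r L s := by
    simp only [← gsum_mul_const, ← gsum_sum, mul_sum, mul_assoc]
  have e2 : c1 * (res r L v + (res r L u - 1) * (sqTot r L / D)) =
      ∑ s, ((if s = v then c1 * res r L v else 0) + c1 * ((res r L u - 1) * res r L s ^ 2 / D)) := by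
    rw [sum_add_distrib, sum_ite_eq', if_pos (mem_univ _), ← mul_sum, ← sum_div, ← mul_sum, sqTot]
    ring
  rw [e1, e2, ← sum_sub_distrib]
  have hle : c1 ≤ 2 * r / n * cnt r L := cnt_sup_edge_le h (hd.mono (by norm_num)) huv hL
  calc _ ≤ ∑ s, (c1 * (20 * r ^ 3 / n ^ 2) +
        c1 * (cl L u s + if s = v then 1 else 0) * (2 * r ^ 2 / n)) :=
        (abs_sum_le_sum_abs _ _).trans (sum_le_sum fun s _ => hpt s)
    _ = c1 * (20 * r ^ 3 / n + (∑ s, cl L u s + 1) * (2 * r ^ 2 / n)) := by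
        rw [sum_add_distrib, ← sum_mul, ← sum_mul, ← mul_sum, sum_add_distrib]
        simp
        field_simp
    _ ≤ c1 * (28 * r ^ 3 / n) := by
        apply mul_le_mul_of_nonneg_left _ hc10
        have := hd.sum_cl_le u
        calc 20 * (r : ℝ) ^ 3 / n + (∑ s, cl L u s + 1) * (2 * r ^ 2 / n) ≤
            20 * (r : ℝ) ^ 3 / n + 4 * (2 * r ^ 2 / n) := by
              gcongr; linarith
          _ = (20 * (r : ℝ) ^ 3 + 8 * (r : ℝ) ^ 2) / (n : ℝ) := by ring
          _ ≤ _ := by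
            apply div_le_div_of_nonneg_right _ hn.le
            nlinarith [sq_nonneg (r : ℝ)]
    _ ≤ (2 * r / n * cnt r L) * (28 * r ^ 3 / n) := by gcongr
    _ = _ := by field_simp; ring

end

section

variable {n : ℕ}

theorem cl_self (L : SimpleGraph (Fin n)) (x : Fin n) : cl L x x = 1 := by
  simp [cl, adj_self]

theorem cl_of_adj {L : SimpleGraph (Fin n)} {x y : Fin n} (h : L.Adj x y) : cl L x y = 1 := by
  rw [cl, adj_of_adj h, if_neg h.ne, add_zero]

theorem abs_zero_sub_le {p e : ℝ} (hp : 0 ≤ p) (h : p ≤ e) : |0 - p| ≤ e := by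
  rw [zero_sub, abs_neg, abs_of_nonneg hp]; exact h

theorem abs_gsum_fr_cl_fr_sub_le {r : ℕ} (h : Big n r) {L : SimpleGraph (Fin n)}
    (hd : DegLe L 2) {u v : Fin n} (huv : u ≠ v) (hL : ¬ L.Adj u v) (s t : Fin n) :
    |gsum r L (fun G => fr L G u s * cl L s t * fr L G t v) - cnt r L * (cl L s t *
      (res r L u * res r L s / tot r L * ((res r L t - if s = t then 1 else 0) * res r L v
        / tot r L)))| ≤
      cnt r L * (cl L s t * (80 * r ^ 3 / n ^ 3) +
        cl L s t * (cl L u s + cl L t v) * (2 * r / n) ^ 2) := by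
  have hn := h.npos
  have hr := h.rpos
  have hD0 : |tot r L - tot r L| ≤ 0 := by simp
  have hDl := h.of_abs_le (hd.mono (by norm_num)) (hD0.trans (by norm_num))
  have hres : ∀ x, 90 ≤ res r L x := fun x => DegLe.res_pos h (hd.mono (by norm_num)) x
  have hresr : ∀ x, res r L x ≤ r := fun x => res_le r L x
  have hres0 : ∀ x, 0 ≤ res r L x := fun x => by linarith [hres x]
  have hc := cnt_nonneg r L
  have hlt : 0 ≤ res r L t - (if s = t then 1 else 0) ∧
      res r L t - (if s = t then 1 else 0) ≤ r := by
    have := hres t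
    have := hresr t
    split_ifs <;> constructor <;> linarith
  have b1 := mul_div_le_of_le h (hres0 u) (hresr u) (hres0 s) (hresr s) hDl
  have b2 := mul_div_le_of_le h hlt.1 hlt.2 (hres0 v) (hresr v) hDl
  set p := res r L u * res r L s / tot r L * ((res r L t - if s = t then 1 else 0) * res r L v
        / tot r L) with hp
  have hp0 : 0 ≤ p := mul_nonneg b1.1 b2.1
  have hp1 : p ≤ (2 * r / n) ^ 2 := by
    rw [sq]; exact mul_le_mul b1.2 b2.2 b2.1 (by positivity)
  have c1 := cl_nonneg L s t
  have c2 := cl_nonneg L u s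
  have c3 := cl_nonneg L t v
  have e1 : ∀ G, fr L G u s * cl L s t * fr L G t v = cl L s t * (fr L G u s * fr L G t v) := by
    intro G; ring
  simp only [e1, gsum_const_mul]
  rw [show cnt r L * (cl L s t * p) = cl L s t * (cnt r L * p) by ring, ← mul_sub, abs_mul,
    abs_of_nonneg c1, show cnt r L * (cl L s t * (80 * r ^ 3 / n ^ 3) +
        cl L s t * (cl L u s + cl L t v) * (2 * r / n) ^ 2) = cl L s t *
        (cnt r L * ((80 * r ^ 3 / n ^ 3) + (cl L u s + cl L t v) * (2 * r / n) ^ 2)) by ring]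
  by_cases hst : cl L s t = 0
  · rw [hst, zero_mul, zero_mul]
  refine mul_le_mul_of_nonneg_left ?_ c1
  have hexc : 1 ≤ cl L u s + cl L t v → cnt r L * p ≤
      cnt r L * ((80 * r ^ 3 / n ^ 3) + (cl L u s + cl L t v) * (2 * r / n) ^ 2) := by
    intro h1
    refine mul_le_mul_of_nonneg_left ?_ hc
    have : 0 ≤ 80 * (r : ℝ) ^ 3 / n ^ 3 := by positivity
    have h2 : 1 * (2 * r / n : ℝ) ^ 2 ≤ (cl L u s + cl L t v) * (2 * r / n) ^ 2 :=
      mul_le_mul_of_nonneg_right h1 (by positivity)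
    linarith
  by_cases hus : u = s ∨ L.Adj u s
  · have : ∀ G, fr L G u s = 0 := fun G => by
      rcases hus with h1 | h1
      · rw [h1, fr_self]
      · exact fr_eq_zero h1 G
    simp only [this, zero_mul]
    rw [gsum_const, mul_zero]
    refine abs_zero_sub_le (mul_nonneg hc hp0) (hexc ?_)
    rcases hus with h1 | h1
    · rw [h1, cl_self]; linarith
    · rw [cl_of_adj h1]; linarith
  by_cases htv : t = v ∨ L.Adj t v
  · have : ∀ G, fr L G t v = 0 := fun G => by
      rcases htv with h1 | h1
      · rw [h1, fr_self]
      · exact fr_eq_zero h1 G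
    simp only [this, mul_zero]
    rw [gsum_const, mul_zero]
    refine abs_zero_sub_le (mul_nonneg hc hp0) (hexc ?_)
    rcases htv with h1 | h1
    · rw [h1, cl_self]; linarith
    · rw [cl_of_adj h1]; linarith
  push Not at hus htv
  have hst' : s = t ∨ L.Adj s t := by
    by_contra hcon
    push Not at hcon
    exact hst (cl_eq_zero hcon.2 hcon.1)
  have htu : t ≠ u := by
    rintro rfl
    rcases hst' with h1 | h1
    · exact hus.1 h1.symm
    · exact hus.2 h1.symm
  have hvs : v ≠ s := by
    rintro rfl
    rcases hst' with h1 | h1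
    · exact htv.1 h1.symm
    · exact htv.2 h1.symm
  have hne : ¬ ((t = u ∧ v = s) ∨ (t = s ∧ v = u)) := by
    rintro (h1 | h1)
    · exact htu h1.1
    · exact huv h1.2.symm
  have key := abs_gsum_fr_fr_sub_le h (hd.mono (by norm_num)) hus.1 hus.2 htv.1 htv.2 hne
    (hD0.trans (by norm_num))
  rw [res_sup_edge r hus.1 hus.2, res_sup_edge r hus.1 hus.2, if_neg htu, if_neg huv.symm,
    if_neg hvs, sub_zero, sub_zero, sub_zero] at key
  simp only [eq_comm (a := t) (b := s)] at key
  rw [← hp] at key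
  refine key.trans ?_
  rw [mul_comm]
  refine mul_le_mul_of_nonneg_left ?_ hc
  have : 0 ≤ (cl L u s + cl L t v) * (2 * r / n : ℝ) ^ 2 := by positivity
  linarith

theorem sum_cl_symm (L : SimpleGraph (Fin n)) (y : Fin n) : ∑ x, cl L x y = ∑ x, cl L y x :=
  sum_congr rfl fun x _ => cl_symm L x y

theorem sum_sum_cl_le {L : SimpleGraph (Fin n)} (hd : DegLe L 2) :
    ∑ s, ∑ t, cl L s t ≤ 3 * n := by
  calc ∑ s, ∑ t, cl L s t ≤ ∑ _s : Fin n, (3 : ℝ) :=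
        sum_le_sum fun s _ => (hd.sum_cl_le s).trans (by norm_num)
    _ = _ := by simp [mul_comm]

theorem sum_sum_cl_mul_cl_le {L : SimpleGraph (Fin n)} (hd : DegLe L 2) (u : Fin n) :
    ∑ s, ∑ t, cl L s t * cl L u s ≤ 9 := by
  calc ∑ s, ∑ t, cl L s t * cl L u s = ∑ s, (∑ t, cl L s t) * cl L u s := by simp only [sum_mul]
    _ ≤ ∑ s, 3 * cl L u s := sum_le_sum fun s _ =>
        mul_le_mul_of_nonneg_right ((hd.sum_cl_le s).trans (by norm_num)) (cl_nonneg _ _ _)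
    _ = 3 * ∑ s, cl L u s := by rw [mul_sum]
    _ ≤ _ := by linarith [hd.sum_cl_le u]

theorem sum_sum_cl_mul_cl_le' {L : SimpleGraph (Fin n)} (hd : DegLe L 2) (v : Fin n) :
    ∑ s, ∑ t, cl L s t * cl L t v ≤ 9 := by
  rw [sum_comm]
  refine le_trans (le_of_eq ?_) (sum_sum_cl_mul_cl_le hd v)
  refine sum_congr rfl fun s _ => sum_congr rfl fun t _ => ?_
  rw [cl_symm L t s, cl_symm L s v]

theorem sum_sum_cl_res (r : ℕ) (L : SimpleGraph (Fin n)) :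
    ∑ s, ∑ t, cl L s t * (res r L s * (res r L t - if s = t then 1 else 0)) =
      sqTot r L - tot r L + edgeTot r L := by
  have : ∀ s t, cl L s t * (res r L s * (res r L t - if s = t then 1 else 0)) =
      (if s = t then res r L s ^ 2 - res r L s else 0) + res r L s * (adj L s t * res r L t) := by
    intro s t
    by_cases hst : s = t
    · subst hst; simp [cl_self, adj_self]; ring
    · simp [cl, hst]; ring
  simp only [this, sum_add_distrib, sum_ite_eq, mem_univ, if_true, sum_sub_distrib, sqTot, tot,
    edgeTot, nbRes, mul_sum]

/-- Counts of two free edges joined by an edge of `L` or a vertex. -/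
theorem abs_gsum_fr_cl_fr_sum_sub_le {r : ℕ} (h : Big n r) {L : SimpleGraph (Fin n)}
    (hd : DegLe L 2) {u v : Fin n} (huv : u ≠ v) (hL : ¬ L.Adj u v) :
    |gsum r L (fun G => ∑ s, ∑ t, fr L G u s * cl L s t * fr L G t v) -
      cnt r L * (res r L u * res r L v *
        (sqTot r L - tot r L + edgeTot r L) / tot r L ^ 2)| ≤
      241 * r ^ 3 / n ^ 2 * cnt r L := by
  have hn := h.npos
  have hr := h.rpos
  have hrb := h.r_big
  have e1 : gsum r L (fun G => ∑ s, ∑ t, fr L G u s * cl L s t * fr L G t v) =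
      ∑ s, ∑ t, gsum r L (fun G => fr L G u s * cl L s t * fr L G t v) := by
    rw [gsum_sum]; simp only [gsum_sum]
  have e2 : cnt r L * (res r L u * res r L v *
        (sqTot r L - tot r L + edgeTot r L) / tot r L ^ 2) =
      ∑ s, ∑ t, cnt r L * (cl L s t * (res r L u * res r L s / tot r L *
        ((res r L t - if s = t then 1 else 0) * res r L v / tot r L))) := by
    rw [← sum_sum_cl_res, mul_div_assoc, sum_div, mul_sum, mul_sum]
    refine sum_congr rfl fun s _ => ?_
    rw [sum_div, mul_sum, mul_sum]
    refine sum_congr rfl fun t _ => ?_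
    ring
  rw [e1, e2, ← sum_sub_distrib]
  simp only [← sum_sub_distrib]
  calc _ ≤ ∑ s, ∑ t, cnt r L * (cl L s t * (80 * r ^ 3 / n ^ 3) +
        cl L s t * (cl L u s + cl L t v) * (2 * r / n) ^ 2) :=
        (abs_sum_le_sum_abs _ _).trans (sum_le_sum fun s _ => (abs_sum_le_sum_abs _ _).trans
          (sum_le_sum fun t _ => abs_gsum_fr_cl_fr_sub_le h hd huv hL s t))
    _ = cnt r L * ((∑ s, ∑ t, cl L s t) * (80 * r ^ 3 / n ^ 3) +
        (∑ s, ∑ t, cl L s t * cl L u s + ∑ s, ∑ t, cl L s t * cl L t v) * (2 * r / n) ^ 2) := by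
        simp only [← sum_add_distrib, sum_mul, mul_sum, mul_add, add_mul]
    _ ≤ cnt r L * (3 * n * (80 * r ^ 3 / n ^ 3) + (9 + 9) * (2 * r / n) ^ 2) := by
        have a1 := sum_sum_cl_le hd
        have a2 := sum_sum_cl_mul_cl_le hd u
        have a3 := sum_sum_cl_mul_cl_le' hd v
        refine mul_le_mul_of_nonneg_left ?_ (cnt_nonneg _ _)
        gcongr
    _ = cnt r L * ((240 * r ^ 3 + 72 * r ^ 2) / n ^ 2) := by field_simp; ring
    _ ≤ cnt r L * (241 * r ^ 3 / n ^ 2) := by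
        refine mul_le_mul_of_nonneg_left ?_ (cnt_nonneg _ _)
        apply div_le_div_of_nonneg_right _ (by positivity)
        nlinarith [sq_nonneg (r : ℝ)]
    _ = _ := by ring

theorem abs_gsum_path_generic {r : ℕ} (h : Big n r) {L : SimpleGraph (Fin n)}
    (hd : DegLe L 2) {u v w x : Fin n} (huv : u ≠ v) (hwv : w ≠ v) (hxu : x ≠ u)
    (huw : u ≠ w) (hLuw : ¬ L.Adj u w) (hwx : w ≠ x) (hLwx : ¬ L.Adj w x)
    (hxv : x ≠ v) (hLxv : ¬ L.Adj x v) :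
    |gsum r L (fun G => if w ≠ v ∧ x ≠ u then fr L G u w * (fr L G w x * fr L G x v) else 0) -
      cnt r L * (res r L u * res r L w / tot r L * ((res r L w - 1) * res r L x / tot r L *
        ((res r L x - 1) * res r L v / tot r L)))| ≤
      cnt r L * (240 * r ^ 4 / n ^ 4) := by
  have hD0 : |tot r L - tot r L| ≤ 0 := by simp
  have hne1 : ¬ ((w = u ∧ x = w) ∨ (w = w ∧ x = u)) := by tauto
  have hne2 : ¬ ((x = u ∧ v = w) ∨ (x = w ∧ v = u)) := by
    rintro (h1 | h1)
    · exact hxu h1.1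
    · exact huv h1.2.symm
  have hne3 : ¬ ((x = w ∧ v = x) ∨ (x = x ∧ v = w)) := by
    rintro (h1 | h1)
    · exact hwx h1.1.symm
    · exact hwv h1.2.symm
  have key := abs_gsum_fr_fr_fr_sub_le h (hd.mono (by norm_num)) huw hLuw hwx hLwx
    hxv hLxv hne1 hne2 hne3 (hD0.trans (by norm_num))
  have hadj : ¬ (L ⊔ SimpleGraph.edge u w).Adj w x := by
    rw [SimpleGraph.sup_adj, SimpleGraph.edge_adj]; tauto
  have r1 : res r (L ⊔ SimpleGraph.edge u w) w = res r L w - 1 := by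
    rw [res_sup_edge r huw hLuw, if_neg huw.symm, if_pos rfl, sub_zero]
  have r2 : res r (L ⊔ SimpleGraph.edge u w) x = res r L x := by
    rw [res_sup_edge r huw hLuw, if_neg hxu, if_neg hwx.symm, sub_zero, sub_zero]
  have r3 : res r (L ⊔ SimpleGraph.edge u w ⊔ SimpleGraph.edge w x) x = res r L x - 1 := by
    rw [res_sup_edge r hwx hadj, r2, if_neg hwx.symm, if_pos rfl, sub_zero]
  have r4 : res r (L ⊔ SimpleGraph.edge u w ⊔ SimpleGraph.edge w x) v = res r L v := by
    rw [res_sup_edge r hwx hadj, res_sup_edge r huw hLuw, if_neg huv.symm, if_neg hwv.symm,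
      if_neg hxv.symm, sub_zero, sub_zero, sub_zero, sub_zero]
  rw [r1, r2, r3, r4] at key
  have hcond : w ≠ v ∧ x ≠ u := ⟨hwv, hxu⟩
  simp only [if_pos hcond]
  rw [mul_comm (cnt r L) (240 * (r : ℝ) ^ 4 / (n : ℝ) ^ 4)]
  exact key

theorem abs_gsum_path_sub_le {r : ℕ} (h : Big n r) {L : SimpleGraph (Fin n)}
    (hd : DegLe L 2) {u v : Fin n} (huv : u ≠ v) (w x : Fin n) :
    |gsum r L (fun G => if w ≠ v ∧ x ≠ u then fr L G u w * (fr L G w x * fr L G x v) else 0) -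
      cnt r L * (res r L u * res r L w / tot r L * ((res r L w - 1) * res r L x / tot r L *
        ((res r L x - 1) * res r L v / tot r L)))| ≤
      cnt r L * (240 * r ^ 4 / n ^ 4 + (cl L u w + cl L w x + cl L x v +
        ((if w = v then 1 else 0) + if x = u then 1 else 0)) * (2 * r / n) ^ 3) := by
  have hn := h.npos
  have hr := h.rpos
  have hD0 : |tot r L - tot r L| ≤ 0 := by simp
  have hDl := h.of_abs_le (hd.mono (by norm_num)) (hD0.trans (by norm_num))
  have hres : ∀ x, 90 ≤ res r L x := fun x => DegLe.res_pos h (hd.mono (by norm_num)) x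
  have hresr : ∀ x, res r L x ≤ r := fun x => res_le r L x
  have hres0 : ∀ x, 0 ≤ res r L x := fun x => by linarith [hres x]
  have hres1 : ∀ x, 0 ≤ res r L x - 1 := fun x => by linarith [hres x]
  have hresr1 : ∀ x, res r L x - 1 ≤ r := fun x => by linarith [hresr x]
  have hc := cnt_nonneg r L
  have b1 := mul_div_le_of_le h (hres0 u) (hresr u) (hres0 w) (hresr w) hDl
  have b2 := mul_div_le_of_le h (hres1 w) (hresr1 w) (hres0 x) (hresr x) hDl
  have b3 := mul_div_le_of_le h (hres1 x) (hresr1 x) (hres0 v) (hresr v) hDl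
  set p := res r L u * res r L w / tot r L * ((res r L w - 1) * res r L x / tot r L *
        ((res r L x - 1) * res r L v / tot r L)) with hp
  have hp0 : 0 ≤ p := mul_nonneg b1.1 (mul_nonneg b2.1 b3.1)
  have hp1 : p ≤ (2 * r / n) ^ 3 := by
    rw [pow_succ', sq]
    exact mul_le_mul b1.2 (mul_le_mul b2.2 b3.2 b3.1 (by positivity)) (mul_nonneg b2.1 b3.1)
      (by positivity)
  have c1 := cl_nonneg L u w
  have c2 := cl_nonneg L w x
  have c3 := cl_nonneg L x v
  have c4 : (0 : ℝ) ≤ if w = v then 1 else 0 := by split_ifs <;> norm_num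
  have c5 : (0 : ℝ) ≤ if x = u then 1 else 0 := by split_ifs <;> norm_num
  set W := cl L u w + cl L w x + cl L x v +
        ((if w = v then 1 else 0) + if x = u then 1 else 0) with hW
  have hW0 : 0 ≤ W := by positivity
  have hexc : 1 ≤ W → cnt r L * p ≤
      cnt r L * (240 * r ^ 4 / n ^ 4 + W * (2 * r / n) ^ 3) := by
    intro h1
    refine mul_le_mul_of_nonneg_left ?_ hc
    have : 0 ≤ 240 * (r : ℝ) ^ 4 / n ^ 4 := by positivity
    have h2 : 1 * (2 * r / n : ℝ) ^ 3 ≤ W * (2 * r / n) ^ 3 :=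
      mul_le_mul_of_nonneg_right h1 (by positivity)
    linarith
  have hzero : (∀ G, (if w ≠ v ∧ x ≠ u then fr L G u w * (fr L G w x * fr L G x v) else 0) = 0) →
      1 ≤ W → |gsum r L (fun G => if w ≠ v ∧ x ≠ u then
        fr L G u w * (fr L G w x * fr L G x v) else 0) - cnt r L * p| ≤
        cnt r L * (240 * r ^ 4 / n ^ 4 + W * (2 * r / n) ^ 3) := by
    intro h1 h2
    simp only [h1]
    rw [gsum_const, mul_zero]
    exact abs_zero_sub_le (mul_nonneg hc hp0) (hexc h2)
  by_cases hwv : w = v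
  · refine hzero (fun G => by simp [hwv]) ?_
    rw [hW, if_pos hwv]; linarith
  by_cases hxu : x = u
  · refine hzero (fun G => by simp [hxu]) ?_
    rw [hW, if_pos hxu]; linarith
  by_cases huw : u = w ∨ L.Adj u w
  · rcases huw with h1 | h1
    · refine hzero (fun G => by simp [h1, fr_self]) ?_
      have h2 : cl L u w = 1 := by rw [h1, cl_self]
      linarith
    · exact hzero (fun G => by simp [fr_eq_zero h1]) (by rw [hW, cl_of_adj h1]; linarith)
  by_cases hwx : w = x ∨ L.Adj w x
  · rcases hwx with h1 | h1
    · refine hzero (fun G => by simp [h1, fr_self]) ?_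
      rw [← h1, cl_self] at hW
      rw [← h1] at c3 c5
      linarith
    · exact hzero (fun G => by simp [fr_eq_zero h1]) (by rw [hW, cl_of_adj h1]; linarith)
  by_cases hxv : x = v ∨ L.Adj x v
  · rcases hxv with h1 | h1
    · refine hzero (fun G => by simp [h1, fr_self]) ?_
      rw [h1, cl_self] at hW
      rw [h1] at c2 c5
      linarith
    · exact hzero (fun G => by simp [fr_eq_zero h1]) (by rw [hW, cl_of_adj h1]; linarith)
  push Not at huw hwx hxv
  refine (abs_gsum_path_generic h hd huv hwv hxu huw.1 huw.2 hwx.1 hwx.2 hxv.1 hxv.2).trans ?_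
  refine mul_le_mul_of_nonneg_left ?_ hc
  have : 0 ≤ W * (2 * r / n : ℝ) ^ 3 := by positivity
  linarith

/-- Counts of paths of three distinct free edges. -/
theorem abs_gsum_path_sum_sub_le {r : ℕ} (h : Big n r) {L : SimpleGraph (Fin n)}
    (hd : DegLe L 2) {u v : Fin n} (huv : u ≠ v) :
    |gsum r L (fun G => ∑ w, ∑ x, if w ≠ v ∧ x ≠ u then
        fr L G u w * (fr L G w x * fr L G x v) else 0) -
      cnt r L * (res r L u * res r L v * (sqTot r L - tot r L) ^ 2 / tot r L ^ 3)| ≤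
      241 * r ^ 4 / n ^ 2 * cnt r L := by
  have hn := h.npos
  have hr := h.rpos
  have hrb := h.r_big
  have e1 : gsum r L (fun G => ∑ w, ∑ x, if w ≠ v ∧ x ≠ u then
        fr L G u w * (fr L G w x * fr L G x v) else 0) =
      ∑ w, ∑ x, gsum r L (fun G => if w ≠ v ∧ x ≠ u then
        fr L G u w * (fr L G w x * fr L G x v) else 0) := by
    rw [gsum_sum]; simp only [gsum_sum]
  have e3 : sqTot r L - tot r L = ∑ w, res r L w * (res r L w - 1) := by
    rw [sqTot, tot, ← sum_sub_distrib]
    exact sum_congr rfl fun w _ => by ring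
  have e2 : cnt r L * (res r L u * res r L v * (sqTot r L - tot r L) ^ 2 / tot r L ^ 3) =
      ∑ w, ∑ x, cnt r L * (res r L u * res r L w / tot r L * ((res r L w - 1) * res r L x /
        tot r L * ((res r L x - 1) * res r L v / tot r L))) := by
    rw [e3, sq, sum_mul_sum, mul_div_assoc, sum_div, mul_sum, mul_sum]
    refine sum_congr rfl fun s _ => ?_
    rw [sum_div, mul_sum, mul_sum]
    refine sum_congr rfl fun t _ => ?_
    ring
  rw [e1, e2, ← sum_sub_distrib]
  simp only [← sum_sub_distrib]
  calc _ ≤ ∑ w, ∑ x, cnt r L * (240 * r ^ 4 / n ^ 4 + (cl L u w + cl L w x + cl L x v +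
        ((if w = v then 1 else 0) + if x = u then 1 else 0)) * (2 * r / n) ^ 3) :=
        (abs_sum_le_sum_abs _ _).trans (sum_le_sum fun s _ => (abs_sum_le_sum_abs _ _).trans
          (sum_le_sum fun t _ => abs_gsum_path_sub_le h hd huv s t))
    _ = cnt r L * (n ^ 2 * (240 * r ^ 4 / n ^ 4) + (n * ∑ w, cl L u w + ∑ w, ∑ x, cl L w x +
        n * ∑ x, cl L x v + (n + n)) * (2 * r / n) ^ 3) := by
        simp only [← mul_sum, sum_add_distrib, ← sum_mul, sum_const, card_univ, Fintype.card_fin,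
          nsmul_eq_mul, sum_ite_eq', mem_univ, if_true]
        ring
    _ ≤ cnt r L * (n ^ 2 * (240 * r ^ 4 / n ^ 4) + (n * 3 + 3 * n +
        n * 3 + (n + n)) * (2 * r / n) ^ 3) := by
        have a1 := sum_sum_cl_le hd
        have a2 : ∑ w, cl L u w ≤ 3 := (hd.sum_cl_le u).trans (by norm_num)
        have a3 : ∑ x, cl L x v ≤ 3 := (sum_cl_symm L v).le.trans ((hd.sum_cl_le v).trans
          (by norm_num))
        refine mul_le_mul_of_nonneg_left ?_ (cnt_nonneg _ _)
        gcongr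
    _ = cnt r L * ((240 * r ^ 4 + 88 * r ^ 3) / n ^ 2) := by field_simp; ring
    _ ≤ cnt r L * (241 * r ^ 4 / n ^ 2) := by
        refine mul_le_mul_of_nonneg_left ?_ (cnt_nonneg _ _)
        apply div_le_div_of_nonneg_right _ (by positivity)
        nlinarith [pow_pos hr 3]
    _ = _ := by ring

end

section

variable {n : ℕ}

theorem gsum_zero (r : ℕ) (L : SimpleGraph (Fin n)) : gsum r L (fun _ => 0) = 0 := by
  simp [gsum]

theorem gsum_fr_path_cl_le {r : ℕ} (h : Big n r) {L : SimpleGraph (Fin n)} (hd : DegLe L 2)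
    {u v : Fin n} (huv : u ≠ v) (hL : ¬ L.Adj u v) :
    gsum r L (fun G => ∑ s, ∑ t, fr L G u v * (fr L G u s * fr L G s t * cl L t v)) ≤
      24 * r ^ 3 / n ^ 2 * cnt r L := by
  have hn := h.npos
  have hq := h.q_nonneg
  have hc := cnt_nonneg r L
  rw [gsum_sum]
  simp only [gsum_sum]
  calc _ ≤ ∑ s, ∑ t, cl L t v * ((2 * r / n) ^ 3 * cnt r L) := by
        refine sum_le_sum fun s _ => sum_le_sum fun t _ => ?_
        have hpos : 0 ≤ cl L t v * ((2 * (r : ℝ) / n) ^ 3 * cnt r L) :=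
          mul_nonneg (cl_nonneg _ _ _) (mul_nonneg (pow_nonneg hq 3) hc)
        by_cases hsv : s = v
        · refine le_trans (le_of_eq ?_) hpos
          rw [← gsum_zero r L]
          refine gsum_congr fun G _ => ?_
          subst hsv
          rw [cl_symm, mul_assoc, fr_mul_cl, mul_zero, mul_zero]
        by_cases htu : t = u
        · refine le_trans (le_of_eq ?_) hpos
          rw [← gsum_zero r L]
          refine gsum_congr fun G _ => ?_
          subst htu
          rw [cl_eq_zero hL huv, mul_zero, mul_zero]
        by_cases hsu : s = u
        · refine le_trans (le_of_eq ?_) hpos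
          rw [← gsum_zero r L]
          refine gsum_congr fun G _ => ?_
          subst hsu
          rw [fr_self]; ring
        have := gsum_fr_fr_fr_le h (hd.mono (by norm_num)) (u := u) (v := v) (w := u) (x := s)
          (y := s) (z := t) (by tauto) (by tauto) (by tauto)
        calc _ = cl L t v * gsum r L (fun G => fr L G u v * (fr L G u s * fr L G s t)) := by
              rw [← gsum_const_mul]; exact gsum_congr fun G _ => by ring
          _ ≤ _ := mul_le_mul_of_nonneg_left this (cl_nonneg _ _ _)
    _ = n * ((∑ t, cl L t v) * ((2 * r / n) ^ 3 * cnt r L)) := by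
        simp [sum_mul, mul_sum]
    _ ≤ n * (3 * ((2 * r / n) ^ 3 * cnt r L)) := by
        have : ∑ t, cl L t v ≤ 3 := by
          rw [sum_cl_symm]; exact (hd.sum_cl_le v).trans (by norm_num)
        gcongr
    _ = _ := by field_simp; ring

theorem gsum_fr_fr_cl_fr_le {r : ℕ} (h : Big n r) {L : SimpleGraph (Fin n)} (hd : DegLe L 2)
    {u v : Fin n} (huv : u ≠ v) :
    gsum r L (fun G => ∑ s, ∑ t, fr L G u v * (fr L G u s * cl L s t * fr L G t v)) ≤
      24 * r ^ 3 / n ^ 2 * cnt r L := by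
  have hn := h.npos
  have hq := h.q_nonneg
  have hc := cnt_nonneg r L
  rw [gsum_sum]
  simp only [gsum_sum]
  calc _ ≤ ∑ s, ∑ t, cl L s t * ((2 * r / n) ^ 3 * cnt r L) := by
        refine sum_le_sum fun s _ => sum_le_sum fun t _ => ?_
        have hpos : 0 ≤ cl L s t * ((2 * (r : ℝ) / n) ^ 3 * cnt r L) :=
          mul_nonneg (cl_nonneg _ _ _) (mul_nonneg (pow_nonneg hq 3) hc)
        by_cases hsv : s = v
        · refine le_trans (le_of_eq ?_) hpos
          rw [← gsum_zero r L]
          refine gsum_congr fun G _ => ?_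
          subst hsv
          have := fr_mul_cl L G t s
          rw [cl_symm] at this
          calc _ = fr L G u s * fr L G u s * (fr L G t s * cl L s t) := by ring
            _ = 0 := by rw [this, mul_zero]
        by_cases htu : t = u
        · refine le_trans (le_of_eq ?_) hpos
          rw [← gsum_zero r L]
          refine gsum_congr fun G _ => ?_
          subst htu
          rw [cl_symm, fr_mul_cl]; ring
        by_cases hsu : s = u
        · refine le_trans (le_of_eq ?_) hpos
          rw [← gsum_zero r L]
          refine gsum_congr fun G _ => ?_
          subst hsu
          rw [fr_self]; ring
        by_cases htv : t = v
        · refine le_trans (le_of_eq ?_) hpos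
          rw [← gsum_zero r L]
          refine gsum_congr fun G _ => ?_
          subst htv
          rw [fr_self]; ring
        have := gsum_fr_fr_fr_le h (hd.mono (by norm_num)) (u := u) (v := v) (w := u) (x := s)
          (y := t) (z := v) (by tauto) (by tauto) (by
            rintro (⟨h1, _⟩ | ⟨_, h2⟩)
            · exact htu h1
            · exact huv h2.symm)
        calc _ = cl L s t * gsum r L (fun G => fr L G u v * (fr L G u s * fr L G t v)) := by
              rw [← gsum_const_mul]; exact gsum_congr fun G _ => by ring
          _ ≤ _ := mul_le_mul_of_nonneg_left this (cl_nonneg _ _ _)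
    _ = (∑ s, ∑ t, cl L s t) * ((2 * r / n) ^ 3 * cnt r L) := by
        simp only [sum_mul]
    _ ≤ (3 * n) * ((2 * r / n) ^ 3 * cnt r L) := by
        have := sum_sum_cl_le hd
        gcongr
    _ = _ := by field_simp; ring

theorem abs_gsum_fr_cl_fr_cl_sub_le {r : ℕ} (h : Big n r) {L : SimpleGraph (Fin n)}
    (hd : DegLe L 2) {u v : Fin n} (huv : u ≠ v) (hL : ¬ L.Adj u v) :
    |gsum r L (fun G => ∑ s, ∑ t, fr L G u v * (cl L u s * fr L G s t * cl L t v)) -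
      cnt r (L ⊔ SimpleGraph.edge u v)| ≤ 36 * r ^ 2 / n ^ 2 * cnt r L := by
  have hn := h.npos
  have hq := h.q_nonneg
  have hc := cnt_nonneg r L
  have e : cnt r (L ⊔ SimpleGraph.edge u v) =
      ∑ s, ∑ t, if s = u ∧ t = v then cnt r (L ⊔ SimpleGraph.edge u v) else 0 := by
    rw [sum_eq_single u _ (by simp)]
    · simp
    · intro b _ hb; simp [hb]
  rw [gsum_sum]
  simp only [gsum_sum]
  rw [e, ← sum_sub_distrib]
  simp only [← sum_sub_distrib]
  calc _ ≤ ∑ s, ∑ t, cl L u s * cl L t v * ((2 * r / n) ^ 2 * cnt r L) := by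
        refine (abs_sum_le_sum_abs _ _).trans (sum_le_sum fun s _ =>
          (abs_sum_le_sum_abs _ _).trans (sum_le_sum fun t _ => ?_))
        have hpos : 0 ≤ cl L u s * cl L t v * ((2 * (r : ℝ) / n) ^ 2 * cnt r L) :=
          mul_nonneg (mul_nonneg (cl_nonneg _ _ _) (cl_nonneg _ _ _))
            (mul_nonneg (pow_nonneg hq 2) hc)
        by_cases h1 : s = u ∧ t = v
        · rw [if_pos h1]
          refine le_trans (le_of_eq ?_) hpos
          rw [abs_eq_zero, sub_eq_zero, ← gsum_fr_eq_cnt r huv hL]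
          refine gsum_congr fun G _ => ?_
          rw [h1.1, h1.2, cl_self, cl_self]
          have := fr_mul_self L G u v
          linarith
        rw [if_neg h1, sub_zero]
        have hnn : 0 ≤ gsum r L (fun G => fr L G u v * (cl L u s * fr L G s t * cl L t v)) :=
          gsum_nonneg fun G _ => mul_nonneg (fr_nonneg _ _ _ _)
            (mul_nonneg (mul_nonneg (cl_nonneg _ _ _) (fr_nonneg _ _ _ _)) (cl_nonneg _ _ _))
        rw [abs_of_nonneg hnn]
        by_cases h2 : s = v ∧ t = u
        · refine le_trans (le_of_eq ?_) hpos
          rw [← gsum_zero r L]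
          refine gsum_congr fun G _ => ?_
          rw [h2.1, h2.2, cl_eq_zero hL huv]; ring
        have := gsum_fr_fr_le h (hd.mono (by norm_num)) (u := u) (v := v) (w := s) (x := t)
          (by tauto)
        calc _ = cl L u s * cl L t v * gsum r L (fun G => fr L G u v * fr L G s t) := by
              rw [← gsum_const_mul]; exact gsum_congr fun G _ => by ring
          _ ≤ _ := mul_le_mul_of_nonneg_left this (mul_nonneg (cl_nonneg _ _ _) (cl_nonneg _ _ _))
    _ = (∑ s, cl L u s) * (∑ t, cl L t v) * ((2 * r / n) ^ 2 * cnt r L) := by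
        rw [sum_mul_sum]; simp only [sum_mul]
    _ ≤ (3 * 3) * ((2 * r / n) ^ 2 * cnt r L) := by
        have h1 : ∑ t, cl L t v ≤ 3 := by
          rw [sum_cl_symm]; exact (hd.sum_cl_le v).trans (by norm_num)
        have h2 : ∑ s, cl L u s ≤ 3 := (hd.sum_cl_le u).trans (by norm_num)
        have h3 : 0 ≤ ∑ t, cl L t v := sum_nonneg fun _ _ => cl_nonneg _ _ _
        gcongr
    _ = _ := by field_simp; ring

/-- The four boundary terms of the switching identity combined. -/
noncomputable def bdry (L G : SimpleGraph (Fin n)) (u v : Fin n) : ℝ :=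
  (∑ s, ∑ t, fr L G u v * (cl L u s * fr L G s t * fr L G t v)) +
  (∑ s, ∑ t, fr L G u v * (fr L G u s * fr L G s t * cl L t v)) +
  (∑ s, ∑ t, fr L G u v * (cl L u s * fr L G s t * cl L t v)) -
  ∑ s, ∑ t, fr L G u v * (fr L G u s * cl L s t * fr L G t v)

theorem abs_gsum_bdry_sub_le {r : ℕ} (h : Big n r) {L : SimpleGraph (Fin n)}
    (hd : DegLe L 2) {u v : Fin n} (huv : u ≠ v) (hL : ¬ L.Adj u v) :
    |gsum r L (fun G => bdry L G u v) - cnt r (L ⊔ SimpleGraph.edge u v)| ≤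
      108 * r ^ 3 / n ^ 2 * cnt r L := by
  unfold bdry
  rw [gsum_sub, gsum_add, gsum_add]
  have hn := h.npos
  have hrb := h.r_big
  have hc := cnt_nonneg r L
  have hF := fr_nonneg L
  have hK := cl_nonneg L
  have a1 := gsum_fr_path_cl_le h hd huv hL
  have a2 := gsum_fr_path_cl_le h hd huv.symm (fun h => hL h.symm)
  have a3 := gsum_fr_fr_cl_fr_le h hd huv
  have a4 := abs_gsum_fr_cl_fr_cl_sub_le h hd huv hL
  have e : gsum r L (fun G => ∑ s, ∑ t, fr L G v u * (fr L G v s * fr L G s t * cl L t u)) =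
      gsum r L (fun G => ∑ s, ∑ t, fr L G u v * (cl L u s * fr L G s t * fr L G t v)) := by
    refine gsum_congr fun G _ => ?_
    rw [sum_comm]
    refine sum_congr rfl fun t _ => sum_congr rfl fun s _ => ?_
    rw [fr_symm L G v u, fr_symm L G v s, fr_symm L G s t, cl_symm L t u]; ring
  rw [e] at a2
  have b1 : 0 ≤ gsum r L (fun G => ∑ s, ∑ t, fr L G u v * (fr L G u s * fr L G s t * cl L t v)) :=
    gsum_nonneg fun G _ => sum_nonneg fun s _ => sum_nonneg fun t _ => mul_nonneg (hF _ _ _)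
      (mul_nonneg (mul_nonneg (hF _ _ _) (hF _ _ _)) (hK _ _))
  have b2 : 0 ≤ gsum r L (fun G => ∑ s, ∑ t, fr L G u v * (cl L u s * fr L G s t * fr L G t v)) :=
    gsum_nonneg fun G _ => sum_nonneg fun s _ => sum_nonneg fun t _ => mul_nonneg (hF _ _ _)
      (mul_nonneg (mul_nonneg (hK _ _) (hF _ _ _)) (hF _ _ _))
  have b3 : 0 ≤ gsum r L (fun G => ∑ s, ∑ t, fr L G u v * (fr L G u s * cl L s t * fr L G t v)) :=
    gsum_nonneg fun G _ => sum_nonneg fun s _ => sum_nonneg fun t _ => mul_nonneg (hF _ _ _)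
      (mul_nonneg (mul_nonneg (hF _ _ _) (hK _ _)) (hF _ _ _))
  have e36 : 36 * (r : ℝ) ^ 2 / n ^ 2 * cnt r L ≤ 36 * r ^ 3 / n ^ 2 * cnt r L := by
    apply mul_le_mul_of_nonneg_right _ hc
    apply div_le_div_of_nonneg_right _ (by positivity)
    nlinarith [pow_pos h.rpos 2]
  have e1 : 108 * (r : ℝ) ^ 3 / n ^ 2 * cnt r L = 24 * r ^ 3 / n ^ 2 * cnt r L +
    24 * r ^ 3 / n ^ 2 * cnt r L + 24 * r ^ 3 / n ^ 2 * cnt r L +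
    36 * r ^ 3 / n ^ 2 * cnt r L := by ring
  rw [e1]
  rw [abs_le] at a4 ⊢
  constructor <;> linarith [a4.1, a4.2]

theorem sum_cl_mul_res {r : ℕ} {L G : SimpleGraph (Fin n)} (hG : G ∈ regSet r L) (u : Fin n) :
    ∑ w, cl G u w * res r L w =
      ∑ w, fr L G u w * res r L w + res r L u + nbRes r L u := by
  have : ∀ w, cl G u w * res r L w = fr L G u w * res r L w +
      ((if u = w then res r L w else 0) + adj L u w * res r L w) := by
    intro w
    rw [cl_eq_fr_add (mem_regSet.1 hG).2, cl]
    split_ifs <;> ring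
  simp only [this, sum_add_distrib, nbRes]
  simp; ring

theorem switch_pointwise {r : ℕ} {L G : SimpleGraph (Fin n)} (hG : G ∈ regSet r L)
    (u v : Fin n) :
    fr L G u v * (tot r L - ∑ w, cl G u w * res r L w
        - ∑ x, cl G v x * res r L x + ∑ w, ∑ x, cl G u w * fr L G w x * cl G x v) -
      (1 - fr L G u v) * (res r L u * res r L v
        - ∑ w, ∑ x, fr L G u w * cl G w x * fr L G x v) =
    fr L G u v * (tot r L + res r L u * res r L v - nbRes r L u - nbRes r L v - 1)
      - fr L G u v * ∑ w, fr L G u w * res r L w - fr L G v u * ∑ w, fr L G v w * res r L w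
      + bdry L G u v - res r L u * res r L v
      + (∑ w, ∑ x, if w ≠ v ∧ x ≠ u then fr L G u w * (fr L G w x * fr L G x v) else 0)
      + ∑ w, ∑ x, fr L G u w * cl L w x * fr L G x v := by
  have e1 : ∑ w, ∑ x, cl G u w * fr L G w x * cl G x v =
      ∑ w, ∑ x, fr L G u w * fr L G w x * fr L G x v +
      ∑ w, ∑ x, cl L u w * fr L G w x * fr L G x v +
      ∑ w, ∑ x, fr L G u w * fr L G w x * cl L x v +
      ∑ w, ∑ x, cl L u w * fr L G w x * cl L x v := by
    simp only [← sum_add_distrib]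
    refine sum_congr rfl fun w _ => sum_congr rfl fun x _ => ?_
    rw [cl_eq_fr_add (mem_regSet.1 hG).2, cl_eq_fr_add (mem_regSet.1 hG).2]; ring
  rw [e1, fr_cl_fr_split hG, fff_split hG, sum_cl_mul_res hG, sum_cl_mul_res hG, fr_symm L G v u]
  unfold bdry
  simp only [← mul_sum]
  ring

/-- `D`-normalised quantities in the second-order formula. -/
noncomputable def betaCoef (r : ℕ) (L : SimpleGraph (Fin n)) (u v : Fin n) : ℝ :=
  res r L u * res r L v - nbRes r L u - nbRes r L v
    - (res r L u + res r L v) * (1 + sqTot r L / tot r L) + 2 * (sqTot r L / tot r L)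

noncomputable def gammaCoef (r : ℕ) (L : SimpleGraph (Fin n)) : ℝ :=
  (sqTot r L / tot r L) ^ 2 - sqTot r L / tot r L + edgeTot r L / tot r L

/-- Second-order estimate for the effect of adding one edge. -/
theorem abs_second_order_le {r : ℕ} (h : Big n r) {L : SimpleGraph (Fin n)}
    (hd : DegLe L 2) {u v : Fin n} (huv : u ≠ v) (hL : ¬ L.Adj u v) :
    |cnt r (L ⊔ SimpleGraph.edge u v) * (tot r L + betaCoef r L u v) -
      cnt r L * (res r L u * res r L v) * (1 - gammaCoef r L / tot r L)| ≤
      600 * r ^ 4 / n ^ 2 * cnt r L := by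
  have hn := h.npos
  have hrb := h.r_big
  have hc := cnt_nonneg r L
  have hD : 0 < tot r L := lt_of_lt_of_le (by have := h.rpos; positivity)
    (h.tot_bounds (hd.mono (by norm_num)))
  have key := gsum_switch_sum r huv hL
  rw [← sub_eq_zero, ← gsum_sub, gsum_congr (fun G hG => switch_pointwise hG u v)] at key
  rw [gsum_add, gsum_add, gsum_sub, gsum_add, gsum_sub, gsum_sub, gsum_mul_const,
    gsum_fr_eq_cnt r huv hL, gsum_const] at key
  have a1 := abs_gsum_fr_sum_fr_res_sub_le h hd huv hL
  have a2 := abs_gsum_fr_sum_fr_res_sub_le h hd huv.symm (fun h => hL h.symm)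
  rw [SimpleGraph.edge_comm v u] at a2
  have a3 := abs_gsum_fr_cl_fr_sum_sub_le h hd huv hL
  have a4 := abs_gsum_path_sum_sub_le h hd huv
  have a5 := abs_gsum_bdry_sub_le h hd huv hL
  have e3 : 241 * (r : ℝ) ^ 3 / n ^ 2 * cnt r L ≤ 3 * r ^ 4 / n ^ 2 * cnt r L := by
    apply mul_le_mul_of_nonneg_right _ hc
    apply div_le_div_of_nonneg_right _ (by positivity)
    nlinarith [pow_pos h.rpos 3]
  have e5 : 108 * (r : ℝ) ^ 3 / n ^ 2 * cnt r L ≤ 2 * r ^ 4 / n ^ 2 * cnt r L := by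
    apply mul_le_mul_of_nonneg_right _ hc
    apply div_le_div_of_nonneg_right _ (by positivity)
    nlinarith [pow_pos h.rpos 3]
  have e6 : 0 ≤ (r : ℝ) ^ 4 / n ^ 2 * cnt r L := by positivity
  have e7 : (1 - gammaCoef r L / tot r L) = 1 - (sqTot r L - tot r L) ^ 2 / tot r L ^ 3
      - (sqTot r L - tot r L + edgeTot r L) / tot r L ^ 2 := by
    unfold gammaCoef
    field_simp; ring
  rw [e7]
  unfold betaCoef
  simp only [mul_div_assoc, mul_assoc] at *
  rw [abs_le] at *
  constructor <;> nlinarith [key]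

end

section

variable {n : ℕ}

theorem sqTot_sup_edge (r : ℕ) {L : SimpleGraph (Fin n)} {u v : Fin n} (huv : u ≠ v)
    (hL : ¬ L.Adj u v) : sqTot r (L ⊔ SimpleGraph.edge u v) =
      sqTot r L - 2 * (res r L u + res r L v - 1) := by
  have : ∀ x, res r (L ⊔ SimpleGraph.edge u v) x ^ 2 = res r L x ^ 2 +
      ((if x = u then 1 - 2 * res r L x else 0) + if x = v then 1 - 2 * res r L x else 0) := by
    intro x
    rw [res_sup_edge r huv hL]
    by_cases hu : x = u
    · have : x ≠ v := fun h => huv (hu.symm.trans h)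
      simp only [if_pos hu, if_neg this]; ring
    · by_cases hv : x = v
      · simp only [if_pos hv, if_neg hu]; ring
      · simp only [if_neg hu, if_neg hv]; ring
  simp only [sqTot, this, sum_add_distrib]
  simp; ring

theorem nbRes_sup_edge (r : ℕ) {L : SimpleGraph (Fin n)} {u v : Fin n} (huv : u ≠ v)
    (hL : ¬ L.Adj u v) (s : Fin n) : nbRes r (L ⊔ SimpleGraph.edge u v) s =
      nbRes r L s - adj L s u - adj L s v + ((if s = u then res r L v - 1 else 0) +
        if s = v then res r L u - 1 else 0) := by
  have : ∀ t, adj (L ⊔ SimpleGraph.edge u v) s t * res r (L ⊔ SimpleGraph.edge u v) t =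
      adj L s t * res r L t - (if t = u then adj L s t else 0) - (if t = v then adj L s t else 0)
      + ((if t = v then if s = u then res r L t - 1 else 0 else 0) +
        if t = u then if s = v then res r L t - 1 else 0 else 0) := by
    intro t
    rw [adj_sup_edge huv hL, res_sup_edge r huv hL]
    by_cases hu : t = u
    · have : t ≠ v := fun h => huv (hu.symm.trans h)
      by_cases hs : s = v
      · simp [hu, this, hs, huv]; ring
      · simp [hu, this, hs, huv]; ring
    · by_cases hv : t = v
      · by_cases hs : s = u
        · simp [hv, hu, hs, huv, huv.symm]; ring
        · simp [hv, hu, hs, huv, huv.symm]; ring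
      · simp [hu, hv]
  simp only [nbRes, this, sum_add_distrib, sum_sub_distrib]
  simp

theorem edgeTot_sup_edge (r : ℕ) {L : SimpleGraph (Fin n)} {u v : Fin n} (huv : u ≠ v)
    (hL : ¬ L.Adj u v) : edgeTot r (L ⊔ SimpleGraph.edge u v) =
      edgeTot r L - 2 * (nbRes r L u + nbRes r L v)
        + 2 * ((res r L u - 1) * (res r L v - 1)) := by
  have h1 : ∀ s, res r (L ⊔ SimpleGraph.edge u v) s * nbRes r (L ⊔ SimpleGraph.edge u v) s =
      res r L s * nbRes r (L ⊔ SimpleGraph.edge u v) s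
      - (if s = u then nbRes r (L ⊔ SimpleGraph.edge u v) s else 0)
      - (if s = v then nbRes r (L ⊔ SimpleGraph.edge u v) s else 0) := by
    intro s
    rw [res_sup_edge r huv hL]
    split_ifs <;> ring
  have h2 : ∀ s, res r L s * nbRes r (L ⊔ SimpleGraph.edge u v) s =
      res r L s * nbRes r L s - adj L u s * res r L s - adj L v s * res r L s
      + ((if s = u then res r L s * (res r L v - 1) else 0) +
        if s = v then res r L s * (res r L u - 1) else 0) := by
    intro s
    rw [nbRes_sup_edge r huv hL, adj_symm L s u, adj_symm L s v]
    split_ifs <;> ring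
  unfold edgeTot
  simp only [h1, sum_sub_distrib]
  have h3 : ∀ u, ∑ x, adj L u x * res r L x = nbRes r L u := fun _ => rfl
  simp only [h2, sum_add_distrib, sum_sub_distrib, h3]
  simp only [sum_ite_eq', mem_univ, if_true]
  rw [nbRes_sup_edge r huv hL, nbRes_sup_edge r huv hL]
  simp only [adj_self, adj_of_not_adj hL, adj_of_not_adj fun h : L.Adj v u => hL h.symm,
    if_true, if_neg huv, if_neg huv.symm]
  ring

/-- McKay's exponent. -/
noncomputable def wt (r : ℕ) (L : SimpleGraph (Fin n)) : ℝ :=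
  (sqTot r L / tot r L) ^ 2 / 4 + edgeTot r L / (2 * tot r L) - 1 / 4

theorem wt_sup_edge_sub (r : ℕ) {L : SimpleGraph (Fin n)} {u v : Fin n} (huv : u ≠ v)
    (hL : ¬ L.Adj u v) (hD : 2 < tot r L) :
    wt r (L ⊔ SimpleGraph.edge u v) - wt r L =
      (betaCoef r L u v + gammaCoef r L + 1) / (tot r L - 2) +
      ((sqTot r L / tot r L - res r L u - res r L v + 1) / (tot r L - 2)) ^ 2 := by
  unfold wt betaCoef gammaCoef
  rw [sqTot_sup_edge r huv hL, edgeTot_sup_edge r huv hL, tot_sup_edge r huv hL]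
  have h1 : tot r L ≠ 0 := by linarith
  have h2 : tot r L - 2 ≠ 0 := by linarith
  field_simp
  ring

theorem abs_ratio_sub_le {b g i x t : ℝ} (ht0 : 0 ≤ t) (ht : t ≤ 1 / 100) (hb : |b| ≤ t)
    (hg : |g| ≤ t) (hi0 : 0 ≤ i) (hi : i ≤ t) (hx : |x + (b + g + i)| ≤ t ^ 2) :
    |(1 + b) * Real.exp x - (1 - g) * (1 - i)| ≤ 22 * t ^ 2 ∧ 95 / 100 ≤ Real.exp x := by
  rw [abs_le] at hb hg hx
  have hx4 : |x| ≤ 4 * t := by rw [abs_le]; constructor <;> nlinarith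
  have hx1 : |x| ≤ 1 := by linarith
  have he := Real.abs_exp_sub_one_sub_id_le hx1
  have hx2 : x ^ 2 ≤ 16 * t ^ 2 := by
    rw [← sq_abs]; nlinarith [abs_nonneg x]
  rw [abs_le] at he hx4
  have hE : |Real.exp x - (1 - b - g - i)| ≤ 17 * t ^ 2 := by
    rw [abs_le]; constructor <;> linarith [hx.1, hx.2, he.1, he.2]
  constructor
  · have e : (1 + b) * Real.exp x - (1 - g) * (1 - i) =
      (1 + b) * (Real.exp x - (1 - b - g - i)) + (-(b * b) - b * g - b * i - g * i) := by ring
    rw [e]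
    refine (abs_add_le _ _).trans ?_
    rw [abs_mul]
    have h1 : |1 + b| ≤ 101 / 100 := by rw [abs_le]; constructor <;> linarith [hb.1, hb.2]
    have h2 : |1 + b| * |Real.exp x - (1 - b - g - i)| ≤ 101 / 100 * (17 * t ^ 2) :=
      mul_le_mul h1 hE (abs_nonneg _) (by norm_num)
    have hm : ∀ y z : ℝ, |y| ≤ t → |z| ≤ t → |y * z| ≤ t ^ 2 := by
      intro y z hy hz
      rw [abs_mul, sq]; exact mul_le_mul hy hz (abs_nonneg _) ht0
    have hb' : |b| ≤ t := abs_le.2 hb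
    have hg' : |g| ≤ t := abs_le.2 hg
    have hi' : |i| ≤ t := by rwa [abs_of_nonneg hi0]
    have m1 := abs_le.1 (hm b b hb' hb')
    have m2 := abs_le.1 (hm b g hb' hg')
    have m3 := abs_le.1 (hm b i hb' hi')
    have m4 := abs_le.1 (hm g i hg' hi')
    have h3 : |-(b * b) - b * g - b * i - g * i| ≤ 4 * t ^ 2 := by
      rw [abs_le]; constructor <;> linarith [m1.1, m2.1, m3.1, m4.1, m1.2, m2.2, m3.2, m4.2]
    nlinarith [sq_nonneg t]
  · nlinarith [he.1, hx4.1]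

theorem nbRes_bounds {r : ℕ} (h : Big n r) {L : SimpleGraph (Fin n)} (hd : DegLe L 2)
    (u : Fin n) : 0 ≤ nbRes r L u ∧ nbRes r L u ≤ 2 * r := by
  have hp : ∀ x, 0 ≤ res r L x := fun x => by
    have := DegLe.res_pos h (hd.mono (by norm_num)) x; linarith
  constructor
  · exact sum_nonneg fun t _ => mul_nonneg (adj_nonneg _ _ _) (hp t)
  · calc nbRes r L u ≤ ∑ t, adj L u t * r :=
          sum_le_sum fun t _ => mul_le_mul_of_nonneg_left (res_le _ _ _) (adj_nonneg _ _ _)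
      _ = (∑ t, adj L u t) * r := by rw [sum_mul]
      _ ≤ 2 * r := mul_le_mul_of_nonneg_right (hd u) h.rpos.le

theorem sqTot_div_bounds {r : ℕ} (h : Big n r) {L : SimpleGraph (Fin n)} (hd : DegLe L 2) :
    0 ≤ sqTot r L / tot r L ∧ sqTot r L / tot r L ≤ r := by
  have hp : ∀ x, 0 ≤ res r L x := fun x => by
    have := DegLe.res_pos h (hd.mono (by norm_num)) x; linarith
  have hD : 0 < tot r L := lt_of_lt_of_le (by have := h.rpos; have := h.npos; positivity)
    (h.tot_bounds (hd.mono (by norm_num)))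
  constructor
  · exact div_nonneg (sum_nonneg fun x _ => sq_nonneg _) hD.le
  · rw [div_le_iff₀ hD, tot, mul_sum]
    refine sum_le_sum fun x _ => ?_
    rw [sq]; exact mul_le_mul_of_nonneg_right (res_le _ _ _) (hp x)

theorem edgeTot_div_bounds {r : ℕ} (h : Big n r) {L : SimpleGraph (Fin n)} (hd : DegLe L 2) :
    0 ≤ edgeTot r L / tot r L ∧ edgeTot r L / tot r L ≤ 2 * r := by
  have hp : ∀ x, 0 ≤ res r L x := fun x => by
    have := DegLe.res_pos h (hd.mono (by norm_num)) x; linarith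
  have hD : 0 < tot r L := lt_of_lt_of_le (by have := h.rpos; have := h.npos; positivity)
    (h.tot_bounds (hd.mono (by norm_num)))
  constructor
  · exact div_nonneg (sum_nonneg fun x _ => mul_nonneg (hp x) (nbRes_bounds h hd x).1) hD.le
  · rw [div_le_iff₀ hD, tot, mul_sum]
    refine sum_le_sum fun x _ => ?_
    rw [mul_comm]; exact mul_le_mul_of_nonneg_right (nbRes_bounds h hd x).2 (hp x)

theorem abs_betaCoef_le {r : ℕ} (h : Big n r) {L : SimpleGraph (Fin n)} (hd : DegLe L 2)
    (u v : Fin n) : |betaCoef r L u v| ≤ 4 * r ^ 2 := by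
  have hrb := h.r_big
  have hu0 := DegLe.res_pos h (hd.mono (by norm_num)) u
  have hv0 := DegLe.res_pos h (hd.mono (by norm_num)) v
  have hu1 := res_le r L u
  have hv1 := res_le r L v
  have l1 := nbRes_bounds h hd u
  have l2 := nbRes_bounds h hd v
  have s := sqTot_div_bounds h hd
  unfold betaCoef
  have m1 : 0 ≤ res r L u * res r L v ∧ res r L u * res r L v ≤ r * r :=
    ⟨by nlinarith, mul_le_mul hu1 hv1 (by linarith) (by linarith)⟩
  have m2 : 0 ≤ (res r L u + res r L v) * (sqTot r L / tot r L) ∧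
      (res r L u + res r L v) * (sqTot r L / tot r L) ≤ (r + r) * r :=
    ⟨mul_nonneg (by linarith) s.1, mul_le_mul (by linarith) s.2 s.1 (by linarith)⟩
  rw [abs_le]
  constructor <;> nlinarith [m1.1, m1.2, m2.1, m2.2, s.1, s.2, l1.1, l1.2, l2.1, l2.2]

theorem abs_gammaCoef_le {r : ℕ} (h : Big n r) {L : SimpleGraph (Fin n)} (hd : DegLe L 2) :
    |gammaCoef r L| ≤ 2 * r ^ 2 := by
  have hrb := h.r_big
  have s := sqTot_div_bounds h hd
  have e := edgeTot_div_bounds h hd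
  unfold gammaCoef
  have m : 0 ≤ (sqTot r L / tot r L) ^ 2 ∧ (sqTot r L / tot r L) ^ 2 ≤ (r : ℝ) ^ 2 :=
    ⟨sq_nonneg _, pow_le_pow_left₀ s.1 s.2 2⟩
  rw [abs_le]
  constructor <;> nlinarith [m.1, m.2, s.1, s.2, e.1, e.2]

set_option maxHeartbeats 1600000 in
theorem abs_sub_mul_le_of_second_order {n r D β γ a du dv x c c1 : ℝ} (hn : 0 < n)
    (hrb : 100 ≤ r) (hsq : 1000000 * r ^ 3 ≤ n) (hc : 0 ≤ c) (hDb : n * r * (9 / 10) ≤ D)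
    (hso : |c1 * (D + β) - c * (du * dv) * (1 - γ / D)| ≤ 600 * r ^ 4 / n ^ 2 * c)
    (hβ : |β| ≤ 4 * r ^ 2) (hγ : |γ| ≤ 2 * r ^ 2) (s : 0 ≤ a ∧ a ≤ r)
    (hu0 : r - 2 ≤ du) (hv0 : r - 2 ≤ dv) (hu1 : du ≤ r) (hv1 : dv ≤ r)
    (hx : x = -((β + γ + 1) / (D - 2) + ((a - du - dv + 1) / (D - 2)) ^ 2)) :
    |c1 - c * (du * dv / (D - 1) * Real.exp x)| ≤
      4000 * r ^ 2 / n ^ 2 * (c * (du * dv / (D - 1) * Real.exp x)) := by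
  have hr : 0 < r := by linarith
  obtain ⟨P, hP⟩ : ∃ P, P = du * dv := ⟨_, rfl⟩
  rw [← hP] at hso ⊢
  have hr2 : 10000 ≤ r ^ 2 := by nlinarith only [hrb]
  have hDr : 90 * n ≤ D := by nlinarith only [hrb, hDb, hn]
  have hr3 : r ^ 2 ≤ r ^ 3 := by nlinarith only [hrb, hr2]
  have hDr2 : 1000 * (10 * r ^ 2) ≤ D := by linarith only [hDr, hr3, hsq, hr2]
  have hD0 : 0 < D := by linarith only [hDr2, hr2]
  have hD2 : 10 ≤ D := by linarith only [hDr2, hr2]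
  obtain ⟨t, ht⟩ : ∃ t, t = 10 * r ^ 2 / D := ⟨_, rfl⟩
  have ht0 : 0 ≤ t := by rw [ht]; positivity
  have ht1 : t ≤ 1 / 1000 := by rw [ht, div_le_iff₀ hD0]; linarith
  have hb : |β / D| ≤ t := by
    rw [ht, abs_div, abs_of_pos hD0]; apply div_le_div_of_nonneg_right _ hD0.le; linarith only [hβ, hγ, hr2]
  have hg : |γ / D| ≤ t := by
    rw [ht, abs_div, abs_of_pos hD0]; apply div_le_div_of_nonneg_right _ hD0.le; linarith only [hβ, hγ, hr2]
  have hi : 1 / D ≤ t := by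
    rw [ht]; exact div_le_div_of_nonneg_right (by linarith only [hr2]) hD0.le
  have hx2 : |x + (β / D + γ / D + 1 / D)| ≤ t ^ 2 := by
    have e : x + (β / D + γ / D + 1 / D) = -(2 * (β + γ + 1) / (D * (D - 2)) +
      ((a - du - dv + 1) / (D - 2)) ^ 2) := by
      rw [hx]
      have : D - 2 ≠ 0 := by linarith
      field_simp; ring
    rw [e, abs_neg]
    refine (abs_add_le _ _).trans ?_
    have hD3 : D / 2 ≤ D - 2 := by linarith
    have hDD : 0 < D / 2 := by linarith
    have a1 : |2 * (β + γ + 1) / (D * (D - 2))| ≤ (14 * r ^ 2) / (D * (D / 2)) := by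
      rw [abs_div]
      apply div_le_div₀ (by positivity)
      · rw [abs_le] at hβ hγ ⊢
        constructor <;> linarith only [hβ.1, hβ.2, hγ.1, hγ.2, hr2]
      · positivity
      · rw [abs_of_nonneg (mul_nonneg hD0.le (by linarith only [hD2]))]
        exact mul_le_mul_of_nonneg_left hD3 hD0.le
    have a2 : |((a - du - dv + 1) / (D - 2)) ^ 2| ≤
        (2 * r / (D / 2)) ^ 2 := by
      rw [abs_pow, abs_div]
      apply pow_le_pow_left₀ (by positivity)
      apply div_le_div₀ (by positivity)
      · rw [abs_le]
        constructor <;> linarith only [s.1, s.2, hu0, hv0, hu1, hv1, hrb]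
      · positivity
      · rw [abs_of_nonneg (by linarith)]; linarith
    refine (add_le_add a1 a2).trans ?_
    have e2 : (14 * r ^ 2) / (D * (D / 2)) + (2 * r / (D / 2)) ^ 2 = 44 * r ^ 2 / D ^ 2 := by
      field_simp; ring
    rw [e2, ht, div_pow]
    apply div_le_div_of_nonneg_right _ (by positivity)
    nlinarith only [mul_nonneg (sq_nonneg r) (sub_nonneg.2 hr2), sq_nonneg r]
  obtain ⟨k1, k2⟩ := abs_ratio_sub_le ht0 (by linarith) hb hg (by positivity) hi hx2
  have hPlo : 96 / 100 * r ^ 2 ≤ P := by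
    have : (r - 2) * (r - 2) ≤ P := hP ▸ mul_le_mul hu0 hv0 (by linarith) (by linarith)
    nlinarith only [this, hrb]
  have hP0 : 0 < P := by linarith only [hPlo, hr2]
  obtain ⟨ρ, hρ⟩ : ∃ ρ, ρ = P / (D - 1) * Real.exp x := ⟨_, rfl⟩
  rw [← hρ]
  have hρ0 : P / D * (95 / 100) ≤ ρ := by
    rw [hρ]
    apply mul_le_mul _ k2 (by norm_num) (div_nonneg hP0.le (by linarith))
    exact div_le_div_of_nonneg_left hP0.le (by linarith) (by linarith)
  have hρD : |ρ * (D + β) - P * (1 - γ / D)| ≤ P * (2850 * r ^ 2 / n ^ 2) := by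
    have e : ρ * (D + β) - P * (1 - γ / D) = P * (D / (D - 1)) *
      ((1 + β / D) * Real.exp x - (1 - γ / D) * (1 - 1 / D)) := by
      have : D - 1 ≠ 0 := by linarith
      rw [hρ]; field_simp
    rw [e, abs_mul, abs_of_pos (mul_pos hP0 (div_pos hD0 (by linarith))), mul_assoc]
    apply mul_le_mul_of_nonneg_left _ hP0.le
    have hDD : D / (D - 1) ≤ 23 / 22 := by rw [div_le_iff₀ (by linarith)]; linarith
    calc _ ≤ 23 / 22 * (22 * t ^ 2) := mul_le_mul hDD k1 (abs_nonneg _) (by norm_num)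
      _ = 2300 * r ^ 4 / D ^ 2 := by rw [ht]; ring
      _ ≤ 2300 * r ^ 4 / (n * r * (9 / 10)) ^ 2 := by
          apply div_le_div_of_nonneg_left (by positivity) (by positivity)
          exact pow_le_pow_left₀ (by positivity) hDb 2
      _ = (2300 / (81 / 100)) * r ^ 2 / n ^ 2 := by field_simp; ring
      _ ≤ _ := by
          apply div_le_div_of_nonneg_right _ (by positivity)
          nlinarith only [hr2]
  have h1 : |(c1 - c * ρ) * (D + β)| ≤ c * (P * (3500 * r ^ 2 / n ^ 2)) := by
    have e : (c1 - c * ρ) * (D + β) = (c1 * (D + β) - c * P * (1 - γ / D)) -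
      c * (ρ * (D + β) - P * (1 - γ / D)) := by ring
    rw [e]
    refine (abs_sub _ _).trans ?_
    rw [abs_mul, abs_of_nonneg hc]
    have e2 : 600 * r ^ 4 / n ^ 2 * c ≤ c * (P * (650 * r ^ 2 / n ^ 2)) := by
      rw [mul_comm]
      apply mul_le_mul_of_nonneg_left _ hc
      rw [← mul_div_assoc]
      apply div_le_div_of_nonneg_right _ (by positivity)
      nlinarith only [mul_le_mul_of_nonneg_left hPlo (sq_nonneg r), sq_nonneg (r ^ 2)]
    have e3 := mul_le_mul_of_nonneg_left hρD hc
    have e4 : c * (P * (3500 * r ^ 2 / n ^ 2)) = c * (P * (650 * r ^ 2 / n ^ 2)) +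
      c * (P * (2850 * r ^ 2 / n ^ 2)) := by ring
    rw [e4]; exact add_le_add (hso.trans e2) e3
  have hDβ : D * (99 / 100) ≤ D + β := by
    rw [abs_le] at hβ; linarith only [hβ.1, hDr2, hr2]
  have hDβ0 : 0 < D + β := by linarith only [hDβ, hD0]
  rw [abs_mul, abs_of_pos hDβ0, ← le_div_iff₀ hDβ0] at h1
  refine h1.trans ?_
  rw [div_le_iff₀ hDβ0]
  have h2 : P * (93 / 100) ≤ ρ * (D + β) := by
    calc P * (93 / 100) ≤ P / D * (95 / 100) * (D * (99 / 100)) := by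
          field_simp; norm_num
      _ ≤ _ := mul_le_mul hρ0 hDβ (by positivity) (le_trans (by positivity) hρ0)
  calc c * (P * (3500 * r ^ 2 / n ^ 2)) ≤ c * (P * (93 / 100) * (4000 * r ^ 2 / n ^ 2)) := by
        apply mul_le_mul_of_nonneg_left _ hc
        have : 0 ≤ P * (r ^ 2 / n ^ 2) := by positivity
        have e1 : P * (3500 * r ^ 2 / n ^ 2) = 3500 * (P * (r ^ 2 / n ^ 2)) := by ring
        have e2 : P * (93 / 100) * (4000 * r ^ 2 / n ^ 2) =
          3720 * (P * (r ^ 2 / n ^ 2)) := by ring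
        rw [e1, e2]; linarith
    _ ≤ c * (ρ * (D + β) * (4000 * r ^ 2 / n ^ 2)) := by gcongr
    _ = _ := by ring

/-- Multiplicative form of the second-order estimate. -/
theorem abs_cnt_sup_edge_sub_wt_le {r : ℕ} (h : Big n r) {L : SimpleGraph (Fin n)}
    (hd : DegLe L 2) {u v : Fin n} (huv : u ≠ v) (hL : ¬ L.Adj u v) :
    |cnt r (L ⊔ SimpleGraph.edge u v) - cnt r L * (res r L u * res r L v / (tot r L - 1) *
        Real.exp (wt r L - wt r (L ⊔ SimpleGraph.edge u v)))| ≤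
      4000 * r ^ 2 / n ^ 2 * (cnt r L * (res r L u * res r L v / (tot r L - 1) *
        Real.exp (wt r L - wt r (L ⊔ SimpleGraph.edge u v)))) := by
  have hn := h.npos
  have hD := h.tot_bounds (hd.mono (by norm_num : (2:ℝ) ≤ 10))
  refine abs_sub_mul_le_of_second_order hn h.r_big h.sq_le (cnt_nonneg _ _) hD
    (abs_second_order_le h hd huv hL) (abs_betaCoef_le h hd u v) (abs_gammaCoef_le h hd)
    (sqTot_div_bounds h hd) (hd.le_res r u) (hd.le_res r v) (res_le r L u) (res_le r L v) ?_
  rw [← wt_sup_edge_sub r huv hL, neg_sub]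
  have hsq := h.sq_le
  have hrb := h.r_big
  have h1 : (100 : ℝ) * 1 ≤ r * r ^ 2 := mul_le_mul hrb (by nlinarith) (by norm_num) (by linarith)
  nlinarith

end

section

variable {n : ℕ}

theorem adj_sup_of_disjoint {L J : SimpleGraph (Fin n)} (h : Disjoint L J) (x y : Fin n) :
    adj (L ⊔ J) x y = adj L x y + adj J x y := by
  by_cases hL : L.Adj x y
  · have hJ : ¬ J.Adj x y := fun hJ => (SimpleGraph.disjoint_left.1 h) x y hL hJ
    rw [adj_of_adj hL, adj_of_not_adj hJ, adj_of_adj (Or.inl hL)]; norm_num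
  · by_cases hJ : J.Adj x y
    · rw [adj_of_not_adj hL, adj_of_adj hJ, adj_of_adj (Or.inr hJ)]; norm_num
    · rw [adj_of_not_adj hL, adj_of_not_adj hJ, adj_of_not_adj (not_or.2 ⟨hL, hJ⟩ : ¬ (L ⊔ J).Adj x y)]; norm_num

theorem adj_mono {L J : SimpleGraph (Fin n)} (h : L ≤ J) (x y : Fin n) :
    adj L x y ≤ adj J x y := by
  by_cases hL : L.Adj x y
  · rw [adj_of_adj hL, adj_of_adj (h hL)]
  · rw [adj_of_not_adj hL]; exact adj_nonneg _ _ _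

theorem res_sup_of_disjoint (r : ℕ) {L J : SimpleGraph (Fin n)} (h : Disjoint L J) (x : Fin n) :
    res r (L ⊔ J) x = res r L x - ∑ y, adj J x y := by
  simp only [res, adj_sup_of_disjoint h, sum_add_distrib]; ring

theorem tot_sup_of_disjoint (r : ℕ) {L J : SimpleGraph (Fin n)} (h : Disjoint L J) :
    tot r (L ⊔ J) = tot r L - ∑ x, ∑ y, adj J x y := by
  simp only [tot, res_sup_of_disjoint r h, sum_sub_distrib]

/-- The weighted count. -/
noncomputable def wcnt (r : ℕ) (L : SimpleGraph (Fin n)) : ℝ := cnt r L * Real.exp (wt r L)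

theorem wcnt_nonneg (r : ℕ) (L : SimpleGraph (Fin n)) : 0 ≤ wcnt r L :=
  mul_nonneg (cnt_nonneg _ _) (Real.exp_pos _).le

theorem abs_wcnt_sup_edge_sub_le {r : ℕ} (h : Big n r) {L : SimpleGraph (Fin n)}
    (hd : DegLe L 2) {u v : Fin n} (huv : u ≠ v) (hL : ¬ L.Adj u v) :
    |wcnt r (L ⊔ SimpleGraph.edge u v) - wcnt r L * (res r L u * res r L v / (tot r L - 1))| ≤
      4000 * r ^ 2 / n ^ 2 * (wcnt r L * (res r L u * res r L v / (tot r L - 1))) := by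
  have key := abs_cnt_sup_edge_sub_wt_le h hd huv hL
  have he := Real.exp_pos (wt r (L ⊔ SimpleGraph.edge u v))
  have := mul_le_mul_of_nonneg_right key he.le
  rw [← abs_of_pos he, ← abs_mul, abs_of_pos he] at this
  unfold wcnt
  have e : ∀ a : ℝ, cnt r L * (a * Real.exp (wt r L - wt r (L ⊔ SimpleGraph.edge u v))) *
      Real.exp (wt r (L ⊔ SimpleGraph.edge u v)) = cnt r L * Real.exp (wt r L) * a := by
    intro a
    rw [Real.exp_sub]; field_simp
  rw [sub_mul, e, mul_assoc (4000 * (r : ℝ) ^ 2 / n ^ 2), e] at this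
  exact this

theorem chain_bounds {r : ℕ} (h : Big n r) {L₀ : SimpleGraph (Fin n)} {s : ℝ} (k : ℕ) :
    ∀ J : SimpleGraph (Fin n), Disjoint L₀ J → (∀ x, ∑ y, adj J x y ≤ 1) →
      (∀ x y, J.Adj x y → res r L₀ x = s) → DegLe (L₀ ⊔ J) 2 →
      ∑ x, ∑ y, adj J x y = 2 * k →
      wcnt r (L₀ ⊔ J) ≤ wcnt r L₀ * (∏ i ∈ range k, s ^ 2 / (tot r L₀ - 2 * i - 1)) *
        (1 + 4000 * r ^ 2 / n ^ 2) ^ k ∧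
      wcnt r L₀ * (∏ i ∈ range k, s ^ 2 / (tot r L₀ - 2 * i - 1)) *
        (1 - 4000 * r ^ 2 / n ^ 2) ^ k ≤ wcnt r (L₀ ⊔ J) := by
  have hn := h.npos
  have hr := h.rpos
  have hη1 : 4000 * (r : ℝ) ^ 2 / n ^ 2 ≤ 1 := by
    rw [div_le_one (by positivity)]
    have := h.sq_le
    have hrb := h.r_big
    have h2 : (r : ℝ) ^ 2 ≤ r ^ 3 := pow_le_pow_right₀ (by linarith) (by norm_num)
    have h3 : (1 : ℝ) ≤ r ^ 2 := one_le_pow₀ (by linarith)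
    nlinarith only [h2, h3, this, hn]
  induction k with
  | zero =>
    intro J _ _ _ _ hJ
    have hbot : J = ⊥ := by
      rw [eq_bot_iff]
      intro x y hxy
      exfalso
      have h1 : (1 : ℝ) ≤ ∑ x, ∑ y, adj J x y := by
        calc (1 : ℝ) = adj J x y := (adj_of_adj hxy).symm
          _ ≤ ∑ y, adj J x y := single_le_sum (f := fun y => adj J x y)
              (fun _ _ => adj_nonneg _ _ _) (mem_univ y)
          _ ≤ _ := single_le_sum (f := fun x => ∑ y, adj J x y)
              (fun _ _ => sum_nonneg fun _ _ => adj_nonneg _ _ _) (mem_univ x)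
      rw [hJ] at h1; norm_num at h1
    subst hbot
    simp
  | succ k ih =>
    intro J hdisj hJ1 hJs hdeg hJ
    obtain ⟨u, v, huvJ⟩ : ∃ u v, J.Adj u v := by
      by_contra! hcon
      have : ∑ x, ∑ y, adj J x y = 0 :=
        sum_eq_zero fun x _ => sum_eq_zero fun y _ => adj_of_not_adj (hcon x y)
      rw [this] at hJ; push_cast at hJ; linarith
    have huv : u ≠ v := huvJ.ne
    set J' := J \ SimpleGraph.edge u v with hJ'
    have hle : J' ≤ J := sdiff_le
    have hed : SimpleGraph.edge u v ≤ J := by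
      intro a b hab
      rw [SimpleGraph.edge_adj] at hab
      rcases hab.1 with ⟨rfl, rfl⟩ | ⟨rfl, rfl⟩
      · exact huvJ
      · exact huvJ.symm
    have hsup : J' ⊔ SimpleGraph.edge u v = J := sdiff_sup_cancel hed
    have hnot : ¬ J'.Adj u v := by
      intro hh
      rw [hJ', SimpleGraph.sdiff_adj] at hh
      exact hh.2 (by rw [SimpleGraph.edge_adj]; exact ⟨Or.inl ⟨rfl, rfl⟩, huv⟩)
    have hdisj' : Disjoint L₀ J' := hdisj.mono_right hle
    have hsums : ∀ x, ∑ y, adj J x y = ∑ y, adj J' x y +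
        ((if x = u then 1 else 0) + if x = v then 1 else 0) := by
      intro x
      rw [← sum_adj_sup_edge huv hnot, hsup]
    have hL' : ¬ (L₀ ⊔ J').Adj u v := by
      rintro (h1 | h1)
      · exact SimpleGraph.disjoint_left.1 hdisj u v h1 huvJ
      · exact hnot h1
    have hdeg' : DegLe (L₀ ⊔ J') 2 := fun x =>
      (sum_le_sum fun y _ => adj_mono (sup_le_sup_left hle L₀) x y).trans (hdeg x)
    have hsum' : ∑ x, ∑ y, adj J' x y = 2 * k := by
      simp only [hsums, sum_add_distrib] at hJ
      simp at hJ; linarith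
    have hnn : ∀ x, 0 ≤ ∑ y, adj J' x y := fun x => sum_nonneg fun _ _ => adj_nonneg _ _ _
    have hu : ∑ y, adj J' u y = 0 := by
      have h1 := hJ1 u; rw [hsums u, if_pos rfl, if_neg huv] at h1; linarith [hnn u]
    have hv : ∑ y, adj J' v y = 0 := by
      have h1 := hJ1 v; rw [hsums v, if_pos rfl, if_neg huv.symm] at h1; linarith [hnn v]
    obtain ⟨ih1, ih2⟩ := ih J' hdisj' (fun x => (sum_le_sum fun y _ => adj_mono hle x y).trans
      (hJ1 x)) (fun x y hxy => hJs x y (hle hxy)) hdeg' hsum'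
    have hstep := abs_wcnt_sup_edge_sub_le h hdeg' huv hL'
    rw [sup_assoc, hsup, res_sup_of_disjoint r hdisj', res_sup_of_disjoint r hdisj', hu, hv,
      sub_zero, sub_zero, hJs u v huvJ, hJs v u huvJ.symm, ← sq, tot_sup_of_disjoint r hdisj',
      hsum'] at hstep
    have hD := h.tot_bounds (hdeg'.mono (by norm_num : (2:ℝ) ≤ 10))
    rw [tot_sup_of_disjoint r hdisj', hsum'] at hD
    have hD1 : 0 < tot r L₀ - 2 * k - 1 := by
      have hrb := h.r_big
      have h3 := h.sq_le
      have : (1 : ℝ) ≤ r ^ 3 := one_le_pow₀ (by linarith)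
      nlinarith
    set q := s ^ 2 / (tot r L₀ - 2 * k - 1) with hq
    have hq0 : 0 ≤ q := div_nonneg (sq_nonneg _) hD1.le
    set η := 4000 * (r : ℝ) ^ 2 / n ^ 2 with hη
    have hη0 : 0 ≤ η := by positivity
    rw [abs_le] at hstep
    rw [prod_range_succ]
    constructor
    · calc wcnt r (L₀ ⊔ J) ≤ wcnt r (L₀ ⊔ J') * (q * (1 + η)) := by linarith [hstep.2]
        _ ≤ _ := mul_le_mul_of_nonneg_right ih1 (by positivity)
        _ = _ := by rw [pow_succ]; ring
    · calc _ = _ * (q * (1 - η)) := by rw [pow_succ]; ring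
        _ ≤ wcnt r (L₀ ⊔ J') * (q * (1 - η)) :=
            mul_le_mul_of_nonneg_right ih2 (mul_nonneg hq0 (by linarith))
        _ ≤ _ := by linarith [hstep.1]

end

section

variable {n : ℕ}

theorem wt_of_nbRes {r : ℕ} {L : SimpleGraph (Fin n)} {s : ℝ} (hn : 0 < (n : ℝ)) (hs : s ≠ 0)
    (h : ∀ x, res r L x = s) {a : ℝ} (ha : ∀ x, nbRes r L x = a) :
    tot r L = n * s ∧ wt r L = s ^ 2 / 4 + a / 2 - 1 / 4 := by
  have h1 : tot r L = n * s := by simp [tot, h]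
  refine ⟨h1, ?_⟩
  have h2 : sqTot r L = n * s ^ 2 := by simp [sqTot, h]
  have h3 : edgeTot r L = n * (s * a) := by simp [edgeTot, h, ha]
  rw [wt, h1, h2, h3]
  field_simp

theorem wt_bot {r : ℕ} (hn : 0 < (n : ℝ)) (hr : (r : ℝ) ≠ 0) :
    tot r (⊥ : SimpleGraph (Fin n)) = n * r ∧
      wt r (⊥ : SimpleGraph (Fin n)) = ((r : ℝ) ^ 2 - 1) / 4 := by
  have h := wt_of_nbRes (L := (⊥ : SimpleGraph (Fin n))) (r := r) (s := r) (a := 0) hn hr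
    (fun x => by simp [res, adj]) (fun x => by simp [nbRes, adj])
  exact ⟨h.1, by rw [h.2]; ring⟩

theorem res_matching (r : ℕ) {M : SimpleGraph (Fin n)} (hM : IsRegularGraph M 1) (x : Fin n) :
    res r M x = r - 1 := by
  rw [isRegularGraph_iff] at hM
  rw [res, hM]; norm_num

theorem wt_matching {r : ℕ} (hn : 0 < (n : ℝ)) (hr : (r : ℝ) - 1 ≠ 0) {M : SimpleGraph (Fin n)}
    (hM : IsRegularGraph M 1) :
    tot r M = n * (r - 1) ∧ wt r M = ((r : ℝ) ^ 2 - 2) / 4 := by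
  have h := wt_of_nbRes (L := M) (r := r) (s := r - 1) (a := r - 1) hn hr
    (fun x => res_matching r hM x) (fun x => by
      rw [isRegularGraph_iff] at hM
      simp only [nbRes, res_matching r (isRegularGraph_iff.2 hM), ← sum_mul, hM]; norm_num)
  exact ⟨h.1, by rw [h.2]; ring⟩

theorem adj_inf (A B : SimpleGraph (Fin n)) (x y : Fin n) :
    adj (A ⊓ B) x y = adj A x y * adj B x y := by
  by_cases hA : A.Adj x y
  · by_cases hB : B.Adj x y
    · rw [adj_of_adj hA, adj_of_adj hB, adj_of_adj (⟨hA, hB⟩ : (A ⊓ B).Adj x y)]; norm_num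
    · rw [adj_of_not_adj hB, adj_of_not_adj (fun h : (A ⊓ B).Adj x y => hB h.2)]; norm_num
  · rw [adj_of_not_adj hA, adj_of_not_adj (fun h : (A ⊓ B).Adj x y => hA h.1)]; norm_num

theorem adj_sup (A B : SimpleGraph (Fin n)) (x y : Fin n) :
    adj (A ⊔ B) x y = adj A x y + adj B x y - adj (A ⊓ B) x y := by
  rw [adj_inf]
  by_cases hA : A.Adj x y
  · rw [adj_of_adj hA, adj_of_adj (Or.inl hA : (A ⊔ B).Adj x y)]; ring
  · by_cases hB : B.Adj x y
    · rw [adj_of_adj hB, adj_of_adj (Or.inr hB : (A ⊔ B).Adj x y)]; ring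
    · rw [adj_of_not_adj hB, adj_of_not_adj hA,
        adj_of_not_adj (not_or.2 ⟨hA, hB⟩ : ¬ (A ⊔ B).Adj x y)]; ring

theorem adj_sdiff (A B : SimpleGraph (Fin n)) (x y : Fin n) :
    adj (A \ B) x y = adj A x y - adj (B ⊓ A) x y := by
  rw [adj_inf]
  by_cases hA : A.Adj x y
  · by_cases hB : B.Adj x y
    · rw [adj_of_adj hA, adj_of_adj hB, adj_of_not_adj (fun h : (A \ B).Adj x y => h.2 hB)]
      norm_num
    · rw [adj_of_not_adj hB, adj_of_adj hA, adj_of_adj (⟨hA, hB⟩ : (A \ B).Adj x y)]; norm_num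
  · rw [adj_of_not_adj hA, adj_of_not_adj (fun h : (A \ B).Adj x y => hA h.1)]; norm_num

theorem adj_mul_adj_matching {M : SimpleGraph (Fin n)} (hM : IsRegularGraph M 1) (x y z : Fin n) :
    adj M x y * adj M x z = if y = z then adj M x y else 0 := by
  rw [isRegularGraph_iff] at hM
  by_cases hyz : y = z
  · subst hyz
    rw [if_pos rfl]
    by_cases h : M.Adj x y
    · rw [adj_of_adj h]; norm_num
    · rw [adj_of_not_adj h]; norm_num
  · rw [if_neg hyz]
    by_cases h : M.Adj x y
    · have h1 := hM x
      have h2 : adj M x y + adj M x z ≤ ∑ w, adj M x w := by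
        rw [← sum_pair (f := fun w => adj M x w) hyz]
        exact sum_le_sum_of_subset_of_nonneg (subset_univ _) fun _ _ _ => adj_nonneg _ _ _
      rw [h1, adj_of_adj h] at h2
      have := adj_nonneg M x z
      have h3 : adj M x z = 0 := by push_cast at h2; linarith
      rw [h3, mul_zero]
    · rw [adj_of_not_adj h, zero_mul]

theorem adj_mul_sum_inf {M A : SimpleGraph (Fin n)} (hM : IsRegularGraph M 1) (hA : A ≤ M)
    (x y : Fin n) : adj M x y * ∑ z, adj A x z = adj A x y := by
  have e : ∀ z, adj A x z = adj M x z * adj A x z := by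
    intro z
    by_cases h : A.Adj x z
    · rw [adj_of_adj h, adj_of_adj (hA h)]; norm_num
    · rw [adj_of_not_adj h, mul_zero]
  rw [mul_sum]
  calc ∑ z, adj M x y * adj A x z = ∑ z, if y = z then adj A x z else 0 := by
        refine sum_congr rfl fun z _ => ?_
        rw [e z, ← mul_assoc, adj_mul_adj_matching hM]
        split_ifs with h
        · rw [h]
        · rw [zero_mul]
    _ = _ := by simp

/-- Values of the invariants for the union of two perfect matchings. -/
theorem wt_sup_matching {r : ℕ} {M₁ M₂ : SimpleGraph (Fin n)}
    (h₁ : IsRegularGraph M₁ 1) (h₂ : IsRegularGraph M₂ 1) {k : ℝ}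
    (hk : ∑ x, ∑ y, adj (M₁ ⊓ M₂) x y = 2 * k) :
    tot r (M₁ ⊔ M₂) = n * (r - 2) + 2 * k ∧
    sqTot r (M₁ ⊔ M₂) = n * ((r : ℝ) - 2) ^ 2 + 2 * k * (2 * r - 3) ∧
    edgeTot r (M₁ ⊔ M₂) = 2 * (k * ((r : ℝ) - 1) ^ 2 + (n - 2 * k) * ((r : ℝ) - 2) ^ 2) := by
  have hM1 := isRegularGraph_iff.1 h₁
  have hM2 := isRegularGraph_iff.1 h₂
  set S := M₁ ⊓ M₂ with hS
  set e : Fin n → ℝ := fun x => ∑ y, adj S x y with he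
  have f1 : ∀ x y, adj M₁ x y * e x = adj S x y := fun x y => adj_mul_sum_inf h₁ inf_le_left x y
  have f2 : ∀ x y, adj M₂ x y * e x = adj S x y := fun x y => adj_mul_sum_inf h₂ inf_le_right x y
  have f1' : ∀ x y, adj M₁ x y * e y = adj S x y := fun x y => by
    rw [adj_symm, f1, adj_symm]
  have f2' : ∀ x y, adj M₂ x y * e y = adj S x y := fun x y => by
    rw [adj_symm, f2, adj_symm]
  have f3 : ∀ x y, adj S x y * e x = adj S x y := by
    intro x y
    have hsq : adj M₂ x y * adj M₂ x y = adj M₂ x y := by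
      rw [adj_mul_adj_matching h₂, if_pos rfl]
    calc adj S x y * e x = adj M₂ x y * (adj M₁ x y * e x) := by rw [hS, adj_inf]; ring
      _ = adj S x y := by rw [f1, hS, adj_inf, mul_left_comm, hsq]
  have f3' : ∀ x y, adj S x y * e y = adj S x y := fun x y => by
    rw [adj_symm, f3, adj_symm]
  have hee : ∀ x, e x ^ 2 = e x := by
    intro x
    rw [sq]
    calc e x * e x = ∑ y, adj S x y * e x := by rw [he, sum_mul]
      _ = e x := by simp only [f3]; rfl
  have hes : ∑ x, e x = 2 * k := hk
  have hres : ∀ x, res r (M₁ ⊔ M₂) x = r - 2 + e x := by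
    intro x
    rw [res]
    simp only [adj_sup, sum_add_distrib, sum_sub_distrib, hM1, hM2]
    rw [he]; push_cast; ring
  refine ⟨?_, ?_, ?_⟩
  · simp only [tot, hres, sum_add_distrib, hes]; simp; ring
  · have : ∀ x, res r (M₁ ⊔ M₂) x ^ 2 = ((r : ℝ) - 2) ^ 2 + e x * (2 * r - 3) := by
      intro x
      rw [hres]
      linear_combination hee x
    simp only [sqTot, this, sum_add_distrib, ← sum_mul, hes]; simp
  · have : ∀ x y, res r (M₁ ⊔ M₂) x * (adj (M₁ ⊔ M₂) x y * res r (M₁ ⊔ M₂) y) =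
        ((r : ℝ) - 2) ^ 2 * adj M₁ x y + ((r : ℝ) - 2) ^ 2 * adj M₂ x y
        + (4 * (r - 2) + 2 - ((r - 2) ^ 2 + 2 * (r - 2) + 1)) * adj S x y := by
      intro x y
      rw [hres, hres, adj_sup]
      have g1 : adj M₁ x y * e x * e y = adj S x y := by rw [f1, f3']
      have g2 : adj M₂ x y * e x * e y = adj S x y := by rw [f2, f3']
      have g3 : adj S x y * e x * e y = adj S x y := by rw [f3, f3']
      linear_combination ((r : ℝ) - 2) * f1 x y + ((r : ℝ) - 2) * f1' x y +
        ((r : ℝ) - 2) * f2 x y + ((r : ℝ) - 2) * f2' x y - ((r : ℝ) - 2) * f3 x y -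
        ((r : ℝ) - 2) * f3' x y + g1 + g2 - g3
    have hs1 : ∑ x, ∑ y, adj M₁ x y = n := by simp [hM1]
    have hs2 : ∑ x, ∑ y, adj M₂ x y = n := by simp [hM2]
    have hs3 : ∑ x, ∑ y, adj S x y = 2 * k := hk
    simp only [edgeTot, nbRes, mul_sum, this, sum_add_distrib]
    simp only [← mul_sum, hs1, hs2, hs3]
    ring

theorem wcnt_matching_ge {r N : ℕ} (h : Big n r) (hN : n = 2 * N) {M : SimpleGraph (Fin n)}
    (hM : IsRegularGraph M 1) :
    wcnt r (⊥ : SimpleGraph (Fin n)) * (∏ i ∈ range N, (r : ℝ) ^ 2 / (n * r - 2 * i - 1)) *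
      (1 - 4000 * r ^ 2 / n ^ 2) ^ N ≤ wcnt r M := by
  have hM' := isRegularGraph_iff.1 hM
  have := (chain_bounds h (L₀ := ⊥) (s := r) N M disjoint_bot_left (fun x => by rw [hM']; norm_num)
    (fun x y _ => by simp [res, adj]) (by
      rw [bot_sup_eq]; intro x; rw [hM']; norm_num) (by
      simp only [hM']; rw [hN]; simp)).2
  rwa [(wt_bot h.npos h.rpos.ne').1, bot_sup_eq] at this

theorem wcnt_sup_matching_le {r N k : ℕ} (h : Big n r) (hN : n = 2 * N) (hkN : k ≤ N)
    {M₁ M₂ : SimpleGraph (Fin n)} (h₁ : IsRegularGraph M₁ 1) (h₂ : IsRegularGraph M₂ 1)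
    (hk : ∑ x, ∑ y, adj (M₁ ⊓ M₂) x y = 2 * k) :
    wcnt r (M₁ ⊔ M₂) ≤ wcnt r M₁ *
      (∏ i ∈ range (N - k), ((r : ℝ) - 1) ^ 2 / (n * (r - 1) - 2 * i - 1)) *
      (1 + 4000 * r ^ 2 / n ^ 2) ^ (N - k) := by
  have hM1 := isRegularGraph_iff.1 h₁
  have hM2 := isRegularGraph_iff.1 h₂
  have hrb := h.r_big
  have := (chain_bounds h (L₀ := M₁) (s := r - 1) (N - k) (M₂ \ M₁) disjoint_sdiff_self_right
    (fun x => by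
      calc _ ≤ ∑ y, adj M₂ x y := sum_le_sum fun y _ => adj_mono sdiff_le x y
        _ ≤ 1 := by rw [hM2]; norm_num)
    (fun x y _ => res_matching r h₁ x) (by
      rw [sup_sdiff_self_right]
      intro x
      simp only [adj_sup, sum_add_distrib, sum_sub_distrib, hM1, hM2]
      have : 0 ≤ ∑ y, adj (M₁ ⊓ M₂) x y := sum_nonneg fun _ _ => adj_nonneg _ _ _
      push_cast; linarith) (by
      simp only [adj_sdiff, sum_sub_distrib, hM2, hk]
      rw [Nat.cast_sub hkN, hN]; simp; ring)).1
  rwa [(wt_matching h.npos (by linarith) h₁).1, sup_sdiff_self_right] at this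

end

section

variable {n : ℕ}

/-- The double factorial `(2j - 1)!!` as a real number. -/
noncomputable def df (j : ℕ) : ℝ := ∏ i ∈ range j, (2 * (i : ℝ) + 1)

theorem df_succ (j : ℕ) : df (j + 1) = df j * (2 * j + 1) := by
  rw [df, prod_range_succ, ← df]

theorem df_pos (j : ℕ) : 0 < df j := prod_pos fun i _ => by positivity

/-- The number of perfect matchings extending a partial matching with `j` edges missing. -/
theorem cnt_one_eq_df {N : ℕ} (hN : n = 2 * N) (j : ℕ) : ∀ S : SimpleGraph (Fin n),
    DegLe S 1 → ∑ x, ∑ y, adj S x y = 2 * ((N : ℝ) - j) → cnt 1 S = df j := by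
  induction j with
  | zero =>
    intro S hS hsum
    have hreg : ∀ x, ∑ y, adj S x y = 1 := by
      have h0 : ∑ x, (1 - ∑ y, adj S x y) = 0 := by
        rw [sum_sub_distrib, hsum]; simp [hN]
      intro x
      have := (sum_eq_zero_iff_of_nonneg (fun x _ => sub_nonneg.2 (hS x))).1 h0 x (mem_univ x)
      linarith
    have hset : regSet 1 S = {S} := by
      ext G
      rw [mem_regSet, mem_singleton]
      constructor
      · rintro ⟨hG, hle⟩
        refine le_antisymm (fun x y hxy => ?_) hle
        by_contra hc
        have hfr : ∑ z, fr S G x z = 0 := by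
          rw [sum_fr (mem_regSet.2 ⟨hG, hle⟩), res, hreg]; simp
        have := (sum_eq_zero_iff_of_nonneg (fun z _ => fr_nonneg S G x z)).1 hfr y (mem_univ y)
        rw [fr_eq_adj hc, adj_of_adj hxy] at this
        exact one_ne_zero this
      · rintro rfl
        exact ⟨isRegularGraph_iff.2 fun x => by rw [hreg]; simp, le_rfl⟩
    rw [cnt, gsum, hset]
    simp [df]
  | succ j ih =>
    intro S hS hsum
    have h01 : ∀ x, ∑ y, adj S x y = 0 ∨ ∑ y, adj S x y = 1 := by
      intro x
      by_cases h : ∃ y, S.Adj x y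
      · obtain ⟨y, hy⟩ := h
        right
        refine le_antisymm (hS x) ?_
        rw [← adj_of_adj hy]
        exact single_le_sum (f := fun z => adj S x z) (fun z _ => adj_nonneg S x z) (mem_univ y)
      · left
        exact sum_eq_zero fun y _ => adj_of_not_adj fun hy => h ⟨y, hy⟩
    obtain ⟨u, hu⟩ : ∃ u, ∑ y, adj S u y = 0 := by
      by_contra hc
      have h1 : ∀ x, ∑ y, adj S x y = 1 := fun x => (h01 x).resolve_left fun h => hc ⟨x, h⟩
      simp only [h1] at hsum
      rw [hN] at hsum
      simp at hsum
      linarith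
    have hu' : ∀ y, ¬ S.Adj u y := by
      intro y hy
      have := (sum_eq_zero_iff_of_nonneg (fun z _ => adj_nonneg S u z)).1 hu y (mem_univ y)
      rw [adj_of_adj hy] at this
      exact one_ne_zero this
    have h1 : cnt 1 S = ∑ v, gsum 1 S (fun G => fr S G u v) := by
      rw [← gsum_sum, cnt]
      refine gsum_congr fun G hG => ?_
      rw [sum_fr hG, res, hu]; simp
    have h2 : ∀ v, gsum 1 S (fun G => fr S G u v) =
        (1 - ∑ y, adj S v y - if v = u then 1 else 0) * df j := by
      intro v
      by_cases hvu : v = u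
      · subst hvu
        simp only [fr_self, hu, if_pos]
        simp [gsum]
      rw [if_neg hvu, sub_zero]
      rcases h01 v with hv | hv
      · rw [hv, gsum_fr_eq_cnt 1 (Ne.symm hvu) (hu' v), sub_zero, one_mul]
        refine ih _ ?_ ?_
        · intro x
          rw [sum_adj_sup_edge (Ne.symm hvu) (hu' v)]
          by_cases hxu : x = u
          · subst hxu
            rw [hu, if_pos rfl, if_neg (Ne.symm hvu)]; norm_num
          by_cases hxv : x = v
          · subst hxv
            rw [hv, if_pos rfl, if_neg hvu]; norm_num
          rw [if_neg hxu, if_neg hxv]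
          simpa using hS x
        · simp only [sum_adj_sup_edge (Ne.symm hvu) (hu' v), sum_add_distrib, hsum]
          simp; ring
      · rw [hv, sub_self, zero_mul]
        have : ∀ G ∈ regSet 1 S, fr S G u v = 0 := by
          intro G hG
          have hs : ∑ y, fr S G v y = 0 := by rw [sum_fr hG, res, hv]; simp
          rw [fr_symm]
          exact (sum_eq_zero_iff_of_nonneg (fun z _ => fr_nonneg S G v z)).1 hs u (mem_univ u)
        rw [gsum_congr this]; simp [gsum]
    rw [h1]
    simp only [h2]
    rw [← sum_mul, sum_sub_distrib, sum_sub_distrib, hsum, df_succ]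
    simp [hN]
    ring

open scoped Classical in
/-- The edges of a graph. -/
noncomputable def edges (G : SimpleGraph (Fin n)) : Finset (Sym2 (Fin n)) :=
  univ.filter fun e => e ∈ G.edgeSet

theorem mem_edges {G : SimpleGraph (Fin n)} {e : Sym2 (Fin n)} : e ∈ edges G ↔ e ∈ G.edgeSet := by
  simp [edges]

theorem sum_adj_eq_card_edges (G : SimpleGraph (Fin n)) :
    ∑ x, ∑ y, adj G x y = 2 * (#(edges G) : ℝ) := by
  classical
  have h := G.sum_degrees_eq_twice_card_edges
  have h1 : #G.edgeFinset = #(edges G) := by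
    congr 1
    ext e
    simp [mem_edges]
  rw [h1] at h
  have h2 : ∀ x, ∑ y, adj G x y = G.degree x := by
    intro x
    rw [← SimpleGraph.card_neighborFinset_eq_degree, SimpleGraph.neighborFinset_eq_filter]
    simp only [adj]
    rw [sum_boole]
  simp only [h2]
  exact_mod_cast h

theorem fromEdgeSet_le_iff_subset_edges {M G : SimpleGraph (Fin n)} {S : Finset (Sym2 (Fin n))}
    (hS : S ⊆ edges M) : SimpleGraph.fromEdgeSet (S : Set (Sym2 (Fin n))) ≤ G ↔ S ⊆ edges G := by
  rw [SimpleGraph.fromEdgeSet_le]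
  constructor
  · intro h e he
    exact mem_edges.2 (h ⟨he, M.not_isDiag_of_mem_edgeSet (mem_edges.1 (hS he))⟩)
  · rintro h e ⟨he, -⟩
    exact mem_edges.1 (h he)

theorem edges_fromEdgeSet {M : SimpleGraph (Fin n)} {S : Finset (Sym2 (Fin n))}
    (hS : S ⊆ edges M) : edges (SimpleGraph.fromEdgeSet (S : Set (Sym2 (Fin n)))) = S := by
  ext e
  rw [mem_edges, SimpleGraph.edgeSet_fromEdgeSet]
  exact ⟨fun h => h.1, fun h => ⟨h, M.not_isDiag_of_mem_edgeSet (mem_edges.1 (hS h))⟩⟩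

theorem card_edges_matching {N : ℕ} (hN : n = 2 * N) {M : SimpleGraph (Fin n)}
    (hM : IsRegularGraph M 1) : #(edges M) = N := by
  have h := sum_adj_eq_card_edges M
  simp only [isRegularGraph_iff.1 hM] at h
  simp at h
  have : 2 * #(edges M) = n := by exact_mod_cast h.symm
  omega

open scoped Classical in
/-- Number of common edges. -/
noncomputable def ov (M G : SimpleGraph (Fin n)) : ℕ := #(edges M ∩ edges G)

theorem sum_adj_inf (M G : SimpleGraph (Fin n)) :
    ∑ x, ∑ y, adj (M ⊓ G) x y = 2 * (ov M G : ℝ) := by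
  classical
  rw [sum_adj_eq_card_edges, ov]
  congr 3
  ext e
  simp [mem_edges, SimpleGraph.edgeSet_inf]

/-- Binomial moments of the overlap of a fixed perfect matching with a uniform one. -/
theorem sum_choose_ov {N : ℕ} (hN : n = 2 * N) {M : SimpleGraph (Fin n)}
    (hM : IsRegularGraph M 1) {s : ℕ} (hs : s ≤ N) :
    ∑ G ∈ regSet 1 (⊥ : SimpleGraph (Fin n)), ((ov M G).choose s : ℝ) =
      (N.choose s : ℝ) * df (N - s) := by
  classical
  have h1 : ∀ G : SimpleGraph (Fin n), ((ov M G).choose s : ℝ) =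
      ∑ S ∈ powersetCard s (edges M), if S ⊆ edges G then 1 else 0 := by
    intro G
    rw [ov, ← card_powersetCard, sum_boole]
    congr 2
    ext S
    simp only [mem_powersetCard, mem_filter, subset_inter_iff]
    tauto
  simp only [h1]
  rw [sum_comm]
  have h2 : ∀ S ∈ powersetCard s (edges M), ∑ G ∈ regSet 1 (⊥ : SimpleGraph (Fin n)),
      (if S ⊆ edges G then (1 : ℝ) else 0) = df (N - s) := by
    intro S hS
    rw [mem_powersetCard] at hS
    rw [← cnt_one_eq_df hN (N - s) (SimpleGraph.fromEdgeSet (S : Set (Sym2 (Fin n)))), cnt, gsum,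
      ← sum_filter]
    · congr 1
      ext G
      rw [mem_filter, mem_regSet, mem_regSet, fromEdgeSet_le_iff_subset_edges hS.1]
      simp
    · intro x
      have := isRegularGraph_iff.1 hM x
      rw [Nat.cast_one] at this
      rw [← this]
      exact sum_le_sum fun y _ =>
        adj_mono ((fromEdgeSet_le_iff_subset_edges hS.1).2 hS.1) x y
    · rw [sum_adj_eq_card_edges, edges_fromEdgeSet hS.1, hS.2, Nat.cast_sub hs]
      ring
  rw [sum_congr rfl h2, sum_const, card_powersetCard, card_edges_matching hN hM, nsmul_eq_mul]

theorem ov_le {N : ℕ} (hN : n = 2 * N) {M : SimpleGraph (Fin n)}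
    (hM : IsRegularGraph M 1) (G : SimpleGraph (Fin n)) : ov M G ≤ N := by
  classical
  rw [← card_edges_matching hN hM]
  exact card_le_card inter_subset_left

/-- Number of perfect matchings of `K_{2j}` avoiding a fixed perfect matching. -/
noncomputable def dm (j : ℕ) : ℝ := ∑ i ∈ range (j + 1), (-1) ^ i * (j.choose i : ℝ) * df (j - i)

theorem indicator_eq_alternating_sum {o k N : ℕ} (ho : o ≤ N) (hk : k ≤ N) :
    (if o = k then (1 : ℝ) else 0) = ∑ i ∈ range (N - k + 1),
      (-1) ^ i * ((k + i).choose k : ℝ) * (o.choose (k + i) : ℝ) := by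
  have h1 : ∀ i, ((k + i).choose k : ℝ) * (o.choose (k + i) : ℝ) =
      o.choose k * ((o - k).choose i : ℝ) := by
    intro i
    have := Nat.choose_mul (n := o) (k := k + i) (s := k) (by omega)
    rw [Nat.add_sub_cancel_left] at this
    rw [mul_comm]
    exact_mod_cast this
  simp only [mul_assoc, h1]
  have h2 : ∑ i ∈ range (N - k + 1), (-1 : ℝ) ^ i * ((o.choose k : ℝ) * ((o - k).choose i : ℝ)) =
      o.choose k * ∑ i ∈ range (o - k + 1), (-1 : ℝ) ^ i * ((o - k).choose i : ℝ) := by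
    rw [mul_sum]
    symm
    rw [← sum_subset (range_subset_range.2 (show o - k + 1 ≤ N - k + 1 by omega))]
    · exact sum_congr rfl fun i _ => by ring
    · intro i _ hi
      rw [mem_range, not_lt] at hi
      rw [Nat.choose_eq_zero_of_lt (show o - k < i by omega)]
      simp
  rw [h2]
  have h3 := Int.alternating_sum_range_choose (n := o - k)
  have h4 : ∑ i ∈ range (o - k + 1), (-1 : ℝ) ^ i * ((o - k).choose i : ℝ) =
      if o - k = 0 then 1 else 0 := by
    exact_mod_cast congrArg (Int.cast : ℤ → ℝ) h3
  rw [h4]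
  by_cases hok : o = k
  · subst hok; simp
  · rw [if_neg hok]
    by_cases hle : k ≤ o
    · rw [if_neg (by omega), mul_zero]
    · rw [Nat.choose_eq_zero_of_lt (by omega)]; simp

/-- The law of the overlap of a fixed perfect matching with a uniform one. -/
theorem card_ov_eq {N : ℕ} (hN : n = 2 * N) {M : SimpleGraph (Fin n)}
    (hM : IsRegularGraph M 1) {k : ℕ} (hk : k ≤ N) :
    ∑ G ∈ regSet 1 (⊥ : SimpleGraph (Fin n)), (if ov M G = k then (1 : ℝ) else 0) =
      N.choose k * dm (N - k) := by
  simp only [fun G => indicator_eq_alternating_sum (ov_le hN hM G) hk]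
  rw [sum_comm, dm, mul_sum]
  refine sum_congr rfl fun i hi => ?_
  rw [mem_range] at hi
  rw [← mul_sum, sum_choose_ov hN hM (by omega)]
  have := Nat.choose_mul (n := N) (k := k + i) (s := k) (by omega)
  rw [Nat.add_sub_cancel_left] at this
  have h' : (N.choose (k + i) : ℝ) * ((k + i).choose k : ℝ) =
    N.choose k * ((N - k).choose i : ℝ) := by exact_mod_cast this
  rw [Nat.sub_sub]
  linear_combination (-1) ^ i * df (N - (k + i)) * h'

theorem sum_apply_ov {N : ℕ} (hN : n = 2 * N) {M : SimpleGraph (Fin n)}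
    (hM : IsRegularGraph M 1) (F : ℕ → ℝ) :
    ∑ G ∈ regSet 1 (⊥ : SimpleGraph (Fin n)), F (ov M G) =
      ∑ k ∈ range (N + 1), F k * (N.choose k * dm (N - k)) := by
  have h1 : ∀ G, F (ov M G) = ∑ k ∈ range (N + 1), F k * if ov M G = k then 1 else 0 := by
    intro G
    rw [sum_eq_single (ov M G)]
    · simp
    · intro k _ hk; rw [if_neg (Ne.symm hk), mul_zero]
    · intro h; exact absurd (mem_range.2 (Nat.lt_succ_of_le (ov_le hN hM G))) h
  simp only [h1]
  rw [sum_comm]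
  refine sum_congr rfl fun k hk => ?_
  rw [← mul_sum, card_ov_eq hN hM (Nat.lt_succ_iff.1 (mem_range.1 hk))]

theorem card_matchings {N : ℕ} (hN : n = 2 * N) :
    cnt 1 (⊥ : SimpleGraph (Fin n)) = df N :=
  cnt_one_eq_df hN N ⊥ (fun x => by simp [adj]) (by simp [adj])

end

/-- The product `∏ (j - l) / (j - l - 1/2)` over `l < i`. -/
noncomputable def halfProd (j i : ℕ) : ℝ :=
  ∏ l ∈ range i, (1 + 1 / (2 * ((j : ℝ) - l) - 1))

theorem halfProd_succ (j i : ℕ) :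
    halfProd j (i + 1) = halfProd j i * (1 + 1 / (2 * ((j : ℝ) - i) - 1)) := by
  rw [halfProd, prod_range_succ, ← halfProd]

theorem one_le_halfProd {j i : ℕ} (h : i ≤ j) : 1 ≤ halfProd j i := by
  induction i with
  | zero => simp [halfProd]
  | succ i ih =>
    have hi : (i : ℝ) + 1 ≤ j := by exact_mod_cast h
    rw [halfProd_succ]
    have : 0 ≤ 1 / (2 * ((j : ℝ) - i) - 1) := div_nonneg zero_le_one (by linarith)
    nlinarith [ih (by omega)]

theorem halfProd_le_two_pow {j i : ℕ} (h : i ≤ j) : halfProd j i ≤ 2 ^ i := by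
  induction i with
  | zero => simp [halfProd]
  | succ i ih =>
    have hi : (i : ℝ) + 1 ≤ j := by exact_mod_cast h
    rw [halfProd_succ, pow_succ]
    have h1 : 1 / (2 * ((j : ℝ) - i) - 1) ≤ 1 := (div_le_one (by linarith)).2 (by linarith)
    have h0 : 0 ≤ 1 / (2 * ((j : ℝ) - i) - 1) := div_nonneg zero_le_one (by linarith)
    exact mul_le_mul (ih (by omega)) (by linarith) (by linarith) (by positivity)

theorem halfProd_sub_one_le {j i : ℕ} (h : i ≤ j) : halfProd j i - 1 ≤ i * 2 ^ i / j := by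
  induction i with
  | zero => simp [halfProd]
  | succ i ih =>
    have hi : (i : ℝ) + 1 ≤ j := by exact_mod_cast h
    have hi0 : (0 : ℝ) ≤ i := i.cast_nonneg
    have hj : (0 : ℝ) < j := by linarith
    have hd : 0 < 2 * ((j : ℝ) - i) - 1 := by linarith
    rw [halfProd_succ]
    have h1 : halfProd j i * (1 / (2 * ((j : ℝ) - i) - 1)) ≤ 2 ^ i * ((i + 2) / j) := by
      refine mul_le_mul (halfProd_le_two_pow (by omega)) ?_ (by positivity) (by positivity)
      rw [div_le_div_iff₀ hd hj]
      nlinarith [mul_nonneg hi0 (sub_nonneg.2 hi)]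
    have h2 := ih (by omega)
    calc _ = (halfProd j i - 1) + halfProd j i * (1 / (2 * ((j : ℝ) - i) - 1)) := by ring
      _ ≤ i * 2 ^ i / j + 2 ^ i * ((i + 2) / j) := add_le_add h2 h1
      _ = _ := by push_cast; field_simp; ring

theorem halfProd_sq_mul_le {j i : ℕ} (h : i ≤ j) :
    halfProd j i ^ 2 * ((j : ℝ) - i + 1 / 4) ≤ j + 1 / 4 := by
  induction i with
  | zero => simp [halfProd]
  | succ i ih =>
    have hi : (i : ℝ) + 1 ≤ j := by exact_mod_cast h
    refine le_trans ?_ (ih (by omega))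
    rw [halfProd_succ, mul_pow, mul_assoc]
    refine mul_le_mul_of_nonneg_left ?_ (sq_nonneg _)
    set x := (j : ℝ) - i with hx
    have hx1 : 1 ≤ x := by linarith
    have hd : 0 < 2 * x - 1 := by linarith
    have : 1 + 1 / (2 * x - 1) = 2 * x / (2 * x - 1) := by field_simp; ring
    rw [this, div_pow, div_mul_eq_mul_div, div_le_iff₀ (by positivity)]
    push_cast
    have : (j : ℝ) - (i + 1) + 1 / 4 = x - 3 / 4 := by rw [hx]; ring
    rw [this]
    nlinarith

theorem choose_mul_df {j i : ℕ} (h : i ≤ j) :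
    (j.choose i : ℝ) * df (j - i) * (i.factorial * 2 ^ i) = df j * halfProd j i := by
  induction i with
  | zero => simp [halfProd]
  | succ i ih =>
    have hi : (i : ℝ) + 1 ≤ j := by exact_mod_cast h
    have hd : 2 * ((j : ℝ) - i) - 1 ≠ 0 := by
      have : 0 < 2 * ((j : ℝ) - i) - 1 := by linarith
      exact this.ne'
    rw [halfProd_succ, ← mul_assoc (df j), ← ih (by omega)]
    have h1 : ((j.choose (i + 1) : ℝ)) * (i + 1) = j.choose i * ((j : ℝ) - i) := by
      have := Nat.choose_succ_right_eq j i
      rw [← Nat.cast_sub (by omega)]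
      exact_mod_cast this
    have h2 : df (j - i) = df (j - (i + 1)) * (2 * ((j : ℝ) - i) - 1) := by
      have : j - i = (j - (i + 1)) + 1 := by omega
      rw [this, df_succ, Nat.cast_sub h]; push_cast; ring
    rw [h2, Nat.factorial_succ]
    push_cast
    have h3 : (1 + 1 / (2 * ((j : ℝ) - i) - 1)) * (2 * ((j : ℝ) - i) - 1) = 2 * ((j : ℝ) - i) := by
      field_simp; ring
    calc _ = (j.choose (i + 1) : ℝ) * (i + 1) * df (j - (i + 1)) * i.factorial * 2 ^ i * 2 := by ring
      _ = j.choose i * df (j - (i + 1)) * i.factorial * 2 ^ i * (2 * ((j : ℝ) - i)) := by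
        rw [h1]; ring
      _ = _ := by
        linear_combination (-(j.choose i * df (j - (i + 1)) * i.factorial * 2 ^ i : ℝ)) * h3

theorem choose_mul_df' {j i : ℕ} (h : i ≤ j) :
    (j.choose i : ℝ) * df (j - i) = df j * (halfProd j i / 2 ^ i / i.factorial) := by
  have := choose_mul_df h
  have h1 : (0 : ℝ) < i.factorial := by exact_mod_cast i.factorial_pos
  field_simp
  linarith

theorem dm_eq (j : ℕ) : dm j =
    df j * ∑ i ∈ range (j + 1), (-1) ^ i * (halfProd j i / 2 ^ i / i.factorial) := by
  rw [dm, mul_sum]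
  refine sum_congr rfl fun i hi => ?_
  rw [mul_assoc, choose_mul_df' (Nat.lt_succ_iff.1 (mem_range.1 hi))]
  ring

theorem sum_inv_factorial_le (j : ℕ) : ∑ i ∈ range j, 1 / (i.factorial : ℝ) ≤ 3 := by
  have := Real.sum_le_exp_of_nonneg zero_le_one j
  simp only [one_pow] at this
  linarith [Real.exp_one_lt_d9]

theorem dm_le_three_mul (j : ℕ) : dm j ≤ 3 * df j := by
  rw [dm_eq, mul_comm 3]
  refine mul_le_mul_of_nonneg_left ?_ (df_pos j).le
  refine le_trans (sum_le_sum fun i hi => ?_) (sum_inv_factorial_le (j + 1))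
  have hi' := Nat.lt_succ_iff.1 (mem_range.1 hi)
  have h0 := one_le_halfProd hi'
  have h1 : halfProd j i / 2 ^ i ≤ 1 := (div_le_one (by positivity)).2 (halfProd_le_two_pow hi')
  have h2 : 0 ≤ halfProd j i / 2 ^ i / i.factorial := by positivity
  calc _ ≤ |(-1 : ℝ) ^ i * (halfProd j i / 2 ^ i / i.factorial)| := le_abs_self _
    _ = halfProd j i / 2 ^ i / i.factorial := by
      rw [abs_mul, abs_pow, abs_neg, abs_one, one_pow, one_mul, abs_of_nonneg h2]
    _ ≤ _ := by gcongr

theorem dm_le (j : ℕ) (hj : 1 ≤ j) : dm j ≤ df j * (Real.exp (-(1 / 2)) + 5 / j) := by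
  have hj0 : (0 : ℝ) < j := by exact_mod_cast hj
  rw [dm_eq]
  refine mul_le_mul_of_nonneg_left ?_ (df_pos j).le
  have h1 : ∑ i ∈ range (j + 1), (-1) ^ i * (halfProd j i / 2 ^ i / i.factorial) ≤
      ∑ i ∈ range (j + 1), ((-(1 / 2) : ℝ) ^ i / i.factorial + i / i.factorial / j) := by
    refine sum_le_sum fun i hi => ?_
    have hi' := Nat.lt_succ_iff.1 (mem_range.1 hi)
    have h0 := one_le_halfProd hi'
    have h2 : 0 ≤ (halfProd j i - 1) / 2 ^ i / i.factorial := by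
      have : 0 ≤ halfProd j i - 1 := by linarith
      positivity
    have h3 : (-1 : ℝ) ^ i * (halfProd j i / 2 ^ i / i.factorial) =
        (-(1 / 2) : ℝ) ^ i / i.factorial +
          (-1 : ℝ) ^ i * ((halfProd j i - 1) / 2 ^ i / i.factorial) := by
      rw [neg_pow (1 / 2 : ℝ), one_div_pow]; ring
    rw [h3]
    gcongr
    calc _ ≤ |(-1 : ℝ) ^ i * ((halfProd j i - 1) / 2 ^ i / i.factorial)| := le_abs_self _
      _ = (halfProd j i - 1) / 2 ^ i / i.factorial := by
        rw [abs_mul, abs_pow, abs_neg, abs_one, one_pow, one_mul, abs_of_nonneg h2]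
      _ ≤ (i * 2 ^ i / j) / 2 ^ i / i.factorial := by
        have := halfProd_sub_one_le hi'
        gcongr
      _ = _ := by field_simp
  refine h1.trans ?_
  rw [sum_add_distrib, ← sum_div]
  have h4 : ∑ i ∈ range (j + 1), (i : ℝ) / i.factorial ≤ 3 := by
    rw [sum_range_succ']
    refine le_trans (le_of_eq ?_) (sum_inv_factorial_le j)
    simp only [Nat.cast_zero, zero_div, add_zero]
    refine sum_congr rfl fun i _ => ?_
    rw [Nat.factorial_succ]
    have : (i.factorial : ℝ) ≠ 0 := by exact_mod_cast i.factorial_ne_zero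
    push_cast
    field_simp
  have h5 := Real.exp_bound (x := -(1 / 2)) (by rw [abs_neg, abs_of_pos] <;> norm_num)
    (n := j + 1) (by omega)
  have h6 : |(-(1 / 2) : ℝ)| ^ (j + 1) * ((j + 1).succ / ((j + 1).factorial * (j + 1 : ℕ))) ≤
      2 / j := by
    have e1 : |(-(1 / 2) : ℝ)| = 1 / 2 := by rw [abs_neg, abs_of_pos]; norm_num
    rw [e1]
    have e2 : ((j : ℝ)) ≤ 2 ^ (j + 1) := by
      have : j ≤ 2 ^ (j + 1) := (Nat.lt_two_pow_self (n := j)).le.trans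
        (Nat.pow_le_pow_right (by norm_num) (by omega))
      exact_mod_cast this
    have e3 : (((j + 1).succ : ℕ) : ℝ) / ((j + 1).factorial * (j + 1 : ℕ)) ≤ 2 := by
      have : (1 : ℝ) ≤ (j + 1).factorial := by exact_mod_cast (j + 1).factorial_pos
      rw [div_le_iff₀ (by positivity)]
      push_cast
      nlinarith
    calc _ ≤ (1 / 2 : ℝ) ^ (j + 1) * 2 := by gcongr
      _ ≤ 1 / j * 2 := by
        rw [one_div_pow]
        gcongr
      _ = _ := by ring
  have h7 := (abs_le.1 (h5.trans h6)).1
  have h8 : (∑ i ∈ range (j + 1), (i : ℝ) / i.factorial) / j ≤ 3 / j := by gcongr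
  have h9 : (5 : ℝ) / j = 3 / j + 2 / j := by ring
  linarith

/-- The coefficients of `(1 - z)^(-a)`. -/
noncomputable def nbc (a z : ℝ) (k : ℕ) : ℝ := (∏ l ∈ range k, (a + l)) * z ^ k / k.factorial

theorem nbc_nonneg {a z : ℝ} (ha : 0 ≤ a) (hz : 0 ≤ z) (k : ℕ) : 0 ≤ nbc a z k := by
  have : 0 ≤ ∏ l ∈ range k, (a + l) := prod_nonneg fun l _ => by positivity
  rw [nbc]; positivity

/-- The product governing the number of extensions of a matching by `j` more edges. -/
noncomputable def extProd (N : ℕ) (q : ℝ) (j : ℕ) : ℝ :=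
  ∏ i ∈ range j, q ^ 2 / (2 * N * q - 2 * i - 1)

theorem extProd_sub {N k : ℕ} (h : k ≤ N) {q : ℝ} (hq : 1 ≤ q) :
    extProd N q (N - k) = extProd N q N *
      ((∏ l ∈ range k, (N * (q - 1) + 1 / 2 + l)) * ((q ^ 2)⁻¹) ^ k * 2 ^ k) := by
  induction k with
  | zero => simp
  | succ k ih =>
    have hN : (N : ℝ) ≥ 0 := N.cast_nonneg
    have hq0 : 0 < q := by linarith
    have ha : 0 < (N : ℝ) * (q - 1) + 1 / 2 + k := by
      have : 0 ≤ (N : ℝ) * (q - 1) := mul_nonneg hN (by linarith)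
      positivity
    have h1 : extProd N q (N - k) = extProd N q (N - (k + 1)) *
        (q ^ 2 / (2 * (N * (q - 1) + 1 / 2 + k))) := by
      have e : N - k = (N - (k + 1)) + 1 := by omega
      rw [e, extProd, prod_range_succ, ← extProd, Nat.cast_sub h]
      congr 2; push_cast; ring
    have h2 := ih (by omega)
    rw [h1] at h2
    rw [prod_range_succ]
    have h3 : extProd N q (N - (k + 1)) = extProd N q (N - (k + 1)) *
        (q ^ 2 / (2 * (N * (q - 1) + 1 / 2 + k))) *
        ((2 * (N * (q - 1) + 1 / 2 + k)) / q ^ 2) := by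
      rw [mul_assoc, div_mul_div_comm, mul_comm (q ^ 2), div_self (by positivity), mul_one]
    rw [h3, h2]
    rw [pow_succ, pow_succ]
    ring

theorem choose_mul_df_mul_extProd {N k : ℕ} (h : k ≤ N) {q : ℝ} (hq : 1 ≤ q) :
    (N.choose k : ℝ) * df (N - k) * extProd N q (N - k) =
      df N * extProd N q N * (nbc (N * (q - 1) + 1 / 2) (q ^ 2)⁻¹ k * halfProd N k) := by
  rw [choose_mul_df' h, extProd_sub h hq, nbc]
  field_simp

theorem factorial_two_mul_eq (x : ℕ) : ((2 * x).factorial : ℝ) = df x * 2 ^ x * x.factorial := by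
  induction x with
  | zero => simp [df]
  | succ x ih =>
    have : 2 * (x + 1) = (2 * x + 1) + 1 := by ring
    rw [this, Nat.factorial_succ, Nat.factorial_succ, df_succ, Nat.factorial_succ]
    push_cast
    rw [ih]; ring

theorem df_eq_stirlingSeq {x : ℕ} (hx : 1 ≤ x) : df x = √2 * (2 * x / Real.exp 1) ^ x *
    (Stirling.stirlingSeq (2 * x) / Stirling.stirlingSeq x) := by
  have hx0 : (0 : ℝ) < x := by exact_mod_cast hx
  have he := Real.exp_pos 1
  have hf : (0 : ℝ) < x.factorial := by exact_mod_cast x.factorial_pos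
  rw [Stirling.stirlingSeq, Stirling.stirlingSeq, factorial_two_mul_eq]
  have h1 : √(2 * ((2 * x : ℕ) : ℝ)) = √2 * √(2 * (x : ℝ)) := by
    rw [← Real.sqrt_mul (by norm_num)]; push_cast; rfl
  have h2 : (((2 * x : ℕ) : ℝ) / Real.exp 1) ^ (2 * x) =
      (2 * x / Real.exp 1) ^ x * (2 ^ x * (x / Real.exp 1) ^ x) := by
    rw [← mul_pow, two_mul x, pow_add]; push_cast; congr 2 <;> ring
  rw [h1, h2]
  have h3 : 0 < √(2 * (x : ℝ)) := Real.sqrt_pos.2 (by positivity)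
  have h4 : 0 < √(2 : ℝ) := Real.sqrt_pos.2 (by positivity)
  field_simp

theorem stirlingSeq_pos {x : ℕ} (hx : 1 ≤ x) : 0 < Stirling.stirlingSeq x := by
  obtain ⟨y, rfl⟩ := Nat.exists_eq_add_of_le' hx
  exact Stirling.stirlingSeq'_pos y

theorem df_le {x : ℕ} (hx : 1 ≤ x) : df x ≤ √2 * (2 * x / Real.exp 1) ^ x := by
  rw [df_eq_stirlingSeq hx]
  refine mul_le_of_le_one_right (by positivity) ?_
  rw [div_le_one (stirlingSeq_pos hx)]
  have := Stirling.stirlingSeq'_antitone (show x - 1 ≤ 2 * x - 1 by omega)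
  simp only [Function.comp, Nat.succ_eq_add_one] at this
  rwa [Nat.sub_add_cancel hx, Nat.sub_add_cancel (by omega)] at this

theorem le_df {x : ℕ} (hx : 1 ≤ x) :
    √2 * (2 * x / Real.exp 1) ^ x * Real.exp (-(1 / (4 * x))) ≤ df x := by
  have hx0 : (0 : ℝ) < x := by exact_mod_cast hx
  rw [df_eq_stirlingSeq hx]
  refine mul_le_mul_of_nonneg_left ?_ (by positivity)
  rw [← Real.log_le_log_iff (Real.exp_pos _)
    (div_pos (stirlingSeq_pos (by omega)) (stirlingSeq_pos hx)), Real.log_exp,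
    Real.log_div (stirlingSeq_pos (by omega)).ne' (stirlingSeq_pos hx).ne']
  have h : ∀ m : ℕ, Real.log (Stirling.stirlingSeq x) - Real.log (Stirling.stirlingSeq (x + m)) ≤
      m * (1 / (4 * (x : ℝ) ^ 2)) := by
    intro m
    induction m with
    | zero => simp
    | succ m ih =>
      have h1 := Stirling.log_stirlingSeq_sdiff_le (x + m)
      have h2 : 1 / (12 * ((x : ℝ) + m) * (x + m + 1)) ≤ 1 / (4 * (x : ℝ) ^ 2) := by
        have hm : (0 : ℝ) ≤ m := Nat.cast_nonneg m
        refine one_div_le_one_div_of_le (by positivity) ?_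
        nlinarith [mul_nonneg hx0.le hm]
      rw [← add_assoc]
      push_cast at h1 ⊢
      linarith
  have h1 := h x
  have h2 : (x : ℝ) * (1 / (4 * (x : ℝ) ^ 2)) = 1 / (4 * x) := by field_simp
  rw [h2, ← two_mul] at h1
  linarith

theorem prod_mul_df (N m : ℕ) :
    (∏ i ∈ range N, (2 * ((m + N : ℕ) : ℝ) - 2 * i - 1)) * df m = df (m + N) := by
  induction N generalizing m with
  | zero => simp
  | succ N ih =>
    rw [prod_range_succ, mul_assoc]
    have h1 : (2 * ((m + (N + 1) : ℕ) : ℝ) - 2 * N - 1) * df m = df (m + 1) := by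
      rw [df_succ]; push_cast; ring
    have h2 := ih (m + 1)
    rw [h1]
    have h3 : m + (N + 1) = m + 1 + N := by ring
    rw [h3, h2]

theorem extProd_eq (N m : ℕ) : extProd N ((m : ℝ) + 1) N =
    ((m : ℝ) + 1) ^ (2 * N) * df (N * m) / df (N * (m + 1)) := by
  have h := prod_mul_df N (N * m)
  have h0 := df_pos (N * m)
  have h1 := df_pos (N * (m + 1))
  have h2 : N * m + N = N * (m + 1) := by ring
  rw [h2] at h
  have h3 : (∏ i ∈ range N, (2 * ((N * (m + 1) : ℕ) : ℝ) - 2 * i - 1)) ≠ 0 := by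
    intro hc
    rw [hc, zero_mul] at h
    exact h1.ne h
  rw [extProd, prod_div_distrib, prod_const, card_range, ← pow_mul, ← h]
  have h4 : (∏ i ∈ range N, (2 * N * ((m : ℝ) + 1) - 2 * i - 1)) =
      ∏ i ∈ range N, (2 * ((N * (m + 1) : ℕ) : ℝ) - 2 * i - 1) :=
    prod_congr rfl fun i _ => by push_cast; ring
  rw [h4]
  field_simp

/-- Comparison of the extension products for consecutive degrees, by Stirling's formula. -/
theorem extProd_le {N p : ℕ} (hN : 1 ≤ N) (hp : 1 ≤ p) :
    extProd N ((p : ℝ) + 1) N ≤ extProd N ((p : ℝ) + 2) N *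
      (1 - (((p : ℝ) + 1) ^ 2)⁻¹) ^ (N * p) * Real.exp (1 / N) := by
  have hN0 : (0 : ℝ) < N := by exact_mod_cast hN
  have hp0 : (0 : ℝ) < p := by exact_mod_cast hp
  have e1 := extProd_eq N p
  have e2 := extProd_eq N (p + 1)
  have e3 : (((p + 1 : ℕ) : ℝ) + 1) = (p : ℝ) + 2 := by push_cast; ring
  rw [e3] at e2
  rw [e1, e2]
  have b1 := df_le (x := N * p) (Nat.mul_pos hN hp)
  have b2 := df_le (x := N * (p + 1 + 1)) (Nat.mul_pos hN (by omega))
  have b3 := le_df (x := N * (p + 1)) (Nat.mul_pos hN (by omega))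
  have d1 := df_pos (N * p)
  have d2 := df_pos (N * (p + 1 + 1))
  have d3 := df_pos (N * (p + 1))
  rw [div_mul_eq_mul_div, div_mul_eq_mul_div, div_le_div_iff₀ d3 d2]
  set y : ℝ := 2 * N / Real.exp 1 with hy
  have hy0 : 0 < y := by positivity
  have c1 : (2 * ((N * p : ℕ) : ℝ) / Real.exp 1) = y * p := by push_cast; rw [hy]; ring
  have c2 : (2 * ((N * (p + 1 + 1) : ℕ) : ℝ) / Real.exp 1) = y * (p + 2) := by
    push_cast; rw [hy]; ring
  have c3 : (2 * ((N * (p + 1) : ℕ) : ℝ) / Real.exp 1) = y * (p + 1) := by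
    push_cast; rw [hy]; ring
  rw [c1] at b1
  rw [c2] at b2
  rw [c3] at b3
  set E := Real.exp (-(1 / (4 * ((N * (p + 1) : ℕ) : ℝ)))) with hE
  have hE0 : 0 < E := Real.exp_pos _
  have hEE : 1 ≤ E ^ 2 * Real.exp (1 / N) := by
    rw [hE, ← Real.exp_nat_mul, ← Real.exp_add]
    apply Real.one_le_exp
    have : 1 / (4 * ((N * (p + 1) : ℕ) : ℝ)) ≤ 1 / (4 * N) := by
      push_cast
      gcongr
      nlinarith
    have h2 : 1 / (4 * (N : ℝ)) = 1 / N / 4 := by field_simp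
    have h3 : 0 < 1 / (N : ℝ) := by positivity
    push_cast at this ⊢
    linarith
  have s2 : √(2 : ℝ) * √2 = 2 := Real.mul_self_sqrt (by norm_num)
  have hs : 0 < √(2 : ℝ) := Real.sqrt_pos.2 (by norm_num)
  have b12 : df (N * p) * df (N * (p + 1 + 1)) ≤
      2 * ((y * p) ^ (N * p) * (y * (p + 2)) ^ (N * (p + 1 + 1))) := by
    calc _ ≤ (√2 * (y * p) ^ (N * p)) * (√2 * (y * (p + 2)) ^ (N * (p + 1 + 1))) :=
          mul_le_mul b1 b2 d2.le (by positivity)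
      _ = (√2 * √2) * ((y * p) ^ (N * p) * (y * (p + 2)) ^ (N * (p + 1 + 1))) := by ring
      _ = _ := by rw [s2]
  have b33 : 2 * ((y * (p + 1)) ^ (N * (p + 1))) ^ 2 * E ^ 2 ≤ df (N * (p + 1)) ^ 2 := by
    calc _ = (√2 * √2) * ((y * (p + 1)) ^ (N * (p + 1))) ^ 2 * E ^ 2 := by rw [s2]
      _ = (√2 * (y * (p + 1)) ^ (N * (p + 1)) * E) ^ 2 := by ring
      _ ≤ _ := by gcongr
  have key : ((p : ℝ) + 1) ^ (2 * N) * ((y * p) ^ (N * p) * (y * (p + 2)) ^ (N * (p + 1 + 1))) =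
      ((p : ℝ) + 2) ^ (2 * N) * (1 - (((p : ℝ) + 1) ^ 2)⁻¹) ^ (N * p) *
        ((y * (p + 1)) ^ (N * (p + 1))) ^ 2 := by
    have k1 : 1 - (((p : ℝ) + 1) ^ 2)⁻¹ = (p : ℝ) * (p + 2) / ((p : ℝ) + 1) ^ 2 := by
      field_simp
      ring
    have k2 : N * (p + 1 + 1) = N * p + 2 * N := by ring
    have k3 : ((y * ((p : ℝ) + 1)) ^ (N * (p + 1))) ^ 2 =
        ((y * (p + 1)) ^ 2) ^ (N * p) * (y * (p + 1)) ^ (2 * N) := by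
      rw [← pow_mul, ← pow_mul, ← pow_add]; congr 1; ring
    rw [k1, k2, k3, pow_add, mul_pow y _ (2 * N), mul_pow y _ (2 * N)]
    have k4 : (y * (p : ℝ)) ^ (N * p) * (y * (p + 2)) ^ (N * p) =
        (p * (p + 2) / ((p : ℝ) + 1) ^ 2) ^ (N * p) * ((y * (p + 1)) ^ 2) ^ (N * p) := by
      rw [← mul_pow, ← mul_pow]; congr 1; field_simp
    linear_combination ((p : ℝ) + 1) ^ (2 * N) * y ^ (2 * N) * (p + 2) ^ (2 * N) * k4
  have hz : 0 ≤ 1 - (((p : ℝ) + 1) ^ 2)⁻¹ := by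
    rw [sub_nonneg]
    exact inv_le_one_of_one_le₀ (by nlinarith)
  set K := ((p : ℝ) + 2) ^ (2 * N) * (1 - (((p : ℝ) + 1) ^ 2)⁻¹) ^ (N * p) with hK
  have hK0 : 0 ≤ K := by positivity
  set F := ((y * ((p : ℝ) + 1)) ^ (N * (p + 1))) ^ 2 with hF
  have hF0 : 0 ≤ F := by positivity
  calc ((p : ℝ) + 1) ^ (2 * N) * df (N * p) * df (N * (p + 1 + 1))
      = ((p : ℝ) + 1) ^ (2 * N) * (df (N * p) * df (N * (p + 1 + 1))) := by ring
    _ ≤ ((p : ℝ) + 1) ^ (2 * N) *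
        (2 * ((y * p) ^ (N * p) * (y * (p + 2)) ^ (N * (p + 1 + 1)))) := by gcongr
    _ = 2 * K * F := by linear_combination 2 * key
    _ = 2 * K * F * 1 := by ring
    _ ≤ 2 * K * F * (E ^ 2 * Real.exp (1 / N)) := by gcongr
    _ = K * (2 * F * E ^ 2) * Real.exp (1 / N) := by ring
    _ ≤ K * (df (N * (p + 1)) ^ 2) * Real.exp (1 / N) := by gcongr
    _ = _ := by rw [hK]; ring

theorem nbc_succ_mul (a z : ℝ) (k : ℕ) : nbc a z (k + 1) * (k + 1) = a * z * nbc (a + 1) z k := by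
  have h : (k.factorial : ℝ) ≠ 0 := by exact_mod_cast k.factorial_ne_zero
  rw [nbc, nbc, prod_range_succ', Nat.factorial_succ]
  have : ∏ l ∈ range k, (a + ((l + 1 : ℕ) : ℝ)) = ∏ l ∈ range k, (a + 1 + (l : ℝ)) :=
    prod_congr rfl fun l _ => by push_cast; ring
  rw [this]
  push_cast
  field_simp
  ring

theorem hasSum_nbc (a : ℝ) {z : ℝ} (h0 : 0 ≤ z) (h1 : z < 1) :
    HasSum (nbc a z) (((1 - z) ^ a)⁻¹) := by
  have h := (Real.one_div_one_sub_rpow_hasFPowerSeriesOnBall_zero a).hasSum (y := z) (by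
    simp [enorm_eq_nnnorm, abs_of_nonneg h0]
    rw [← NNReal.coe_lt_coe]; simpa [abs_of_nonneg h0] using h1)
  rw [zero_add, one_div] at h
  refine (congrArg (HasSum · _) (funext fun k => ?_)).mpr h
  rw [FormalMultilinearSeries.ofScalars_apply_eq, smul_eq_mul, ← Ring.multichoose_eq]
  have h3 : (ascPochhammer ℝ k).eval a = ∏ l ∈ range k, (a + l) := by
    induction k with
    | zero => simp
    | succ k ih => rw [ascPochhammer_succ_eval, prod_range_succ, ih]
  have h2 := Ring.factorial_nsmul_multichoose_eq_ascPochhammer a k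
  rw [Polynomial.ascPochhammer_smeval_eq_eval] at h2
  have h4 : (k.factorial : ℝ) ≠ 0 := by exact_mod_cast k.factorial_ne_zero
  rw [nbc, ← h3, ← h2, nsmul_eq_mul]
  field_simp

theorem hasSum_nbc_mul (a : ℝ) {z : ℝ} (h0 : 0 ≤ z) (h1 : z < 1) :
    HasSum (fun k => nbc a z k * k) (((1 - z) ^ a)⁻¹ * (a * z / (1 - z))) := by
  have h := (hasSum_nbc (a + 1) h0 h1).mul_left (a * z)
  simp only [← nbc_succ_mul] at h
  rw [Real.rpow_add_one (by linarith)] at h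
  have h2 := (hasSum_nat_add_iff (f := fun k => nbc a z k * k) 1).1 (by
    push_cast; exact h)
  simp only [range_one, sum_singleton, Nat.cast_zero, mul_zero, add_zero] at h2
  refine (congrArg (HasSum _ ·) ?_).mpr h2
  have : 1 - z ≠ 0 := by linarith
  rw [mul_inv]
  field_simp

theorem hasSum_nbc_mul_sq (a : ℝ) {z : ℝ} (h0 : 0 ≤ z) (h1 : z < 1) :
    HasSum (fun k => nbc a z k * k ^ 2)
      (((1 - z) ^ a)⁻¹ * (a * z / (1 - z) * (1 + (a + 1) * z / (1 - z)))) := by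
  have h := (((hasSum_nbc_mul (a + 1) h0 h1).add (hasSum_nbc (a + 1) h0 h1)).mul_left (a * z))
  have h3 : ∀ k : ℕ, a * z * (nbc (a + 1) z k * k + nbc (a + 1) z k) =
      nbc a z (k + 1) * ((k + 1 : ℕ) : ℝ) ^ 2 := by
    intro k
    push_cast
    linear_combination -((k : ℝ) + 1) * nbc_succ_mul a z k
  simp only [h3] at h
  rw [Real.rpow_add_one (by linarith)] at h
  have h2 := (hasSum_nat_add_iff (f := fun k => nbc a z k * (k : ℝ) ^ 2) 1).1 h
  simp only [range_one, sum_singleton, Nat.cast_zero, mul_zero, add_zero, ne_eq,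
    OfNat.ofNat_ne_zero, not_false_eq_true, zero_pow] at h2
  refine (congrArg (HasSum _ ·) ?_).mpr h2
  have : 1 - z ≠ 0 := by linarith
  rw [mul_inv]
  field_simp
  ring

/-- Quadratic test functions against the negative binomial weights. -/
theorem sum_nbc_mul_le {a z : ℝ} (ha : 0 ≤ a) (h0 : 0 ≤ z) (h1 : z < 1) (A B C m : ℝ)
    (hpos : ∀ k : ℕ, 0 ≤ A + B * k + C * (k - m) ^ 2) (s : Finset ℕ) :
    ∑ k ∈ s, nbc a z k * (A + B * k + C * (k - m) ^ 2) ≤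
      ((1 - z) ^ a)⁻¹ * (A + B * (a * z / (1 - z)) +
        C * (a * z / (1 - z) ^ 2 + (a * z / (1 - z) - m) ^ 2)) := by
  have h := ((hasSum_nbc a h0 h1).mul_left (A + C * m ^ 2)).add
    (((hasSum_nbc_mul a h0 h1).mul_left (B - 2 * C * m)).add
      ((hasSum_nbc_mul_sq a h0 h1).mul_left C))
  have h2 := sum_le_hasSum s (fun k _ => by
    have : 0 ≤ nbc a z k * (A + B * k + C * (k - m) ^ 2) :=
      mul_nonneg (nbc_nonneg ha h0 k) (hpos k)
    linarith) h
  have hz : 1 - z ≠ 0 := by linarith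
  calc _ = _ := sum_congr rfl fun k _ => by ring
    _ ≤ _ := h2
    _ = _ := by field_simp; ring

theorem one_le_one_sub_mul_exp {t : ℝ} (h0 : 0 ≤ t) (h1 : t ≤ 1 / 2) :
    1 ≤ (1 - t) * Real.exp (t + t ^ 2 / 2 + 2 * t ^ 3) := by
  have h := Real.abs_log_sub_add_sum_range_le (x := t) (by rw [abs_of_nonneg h0]; linarith) 2
  rw [abs_of_nonneg h0] at h
  simp only [sum_range_succ, range_zero, sum_empty] at h
  norm_num at h
  have h2 : t ^ 3 / (1 - t) ≤ 2 * t ^ 3 := by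
    rw [div_le_iff₀ (by linarith)]
    nlinarith [pow_nonneg h0 3]
  have h3 := (abs_le.1 h).1
  have h4 : 0 < 1 - t := by linarith
  calc (1 : ℝ) = Real.exp 0 := Real.exp_zero.symm
    _ ≤ Real.exp (Real.log (1 - t) + (t + t ^ 2 / 2 + 2 * t ^ 3)) :=
        Real.exp_le_exp.2 (by linarith)
    _ = _ := by rw [Real.exp_add, Real.exp_log h4]

/-- The overlap fraction entering the exponential correction. -/
noncomputable def ovFrac (q t : ℝ) : ℝ := t * q / (q - 1 + t)

theorem le_ovFrac {q t : ℝ} (hq : 1 < q) (h0 : 0 ≤ t) (h1 : t ≤ 1) :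
    t + t * (1 - t) / q ≤ ovFrac q t := by
  have hq0 : 0 < q := by linarith
  rw [ovFrac, le_div_iff₀ (by linarith), add_mul, div_mul_eq_mul_div, ← le_sub_iff_add_le',
    div_le_iff₀ hq0]
  have : 0 ≤ t * (1 - t) * (1 - t) := by
    have : 0 ≤ 1 - t := by linarith
    positivity
  nlinarith

theorem ovFrac_nonneg {q t : ℝ} (hq : 1 < q) (h0 : 0 ≤ t) : 0 ≤ ovFrac q t := by
  rw [ovFrac]
  have : 0 < q - 1 + t := by linarith
  have : 0 < q := by linarith
  positivity

/-- The quadratic majorant of the overlap weights. -/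
noncomputable def quadMaj (N : ℕ) (q t : ℝ) : ℝ :=
  1 - t / (2 * q) + 7 / q ^ 3 + 100 * √N * (t - 1 / (q + 1)) ^ 2

theorem quadMaj_nonneg {N : ℕ} (hN : 1 ≤ N) {q t : ℝ} (hq : 99 ≤ q) (ht : 0 ≤ t) :
    0 ≤ quadMaj N q t := by
  have hs : 1 ≤ √(N : ℝ) := Real.one_le_sqrt.2 (by exact_mod_cast hN)
  have hq0 : 0 < q := by linarith
  have h1 : t / (2 * q) ≤ t / 2 := by
    apply div_le_div_of_nonneg_left ht (by norm_num) (by linarith)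
  have h2 : 0 ≤ 7 / q ^ 3 := by positivity
  have h3 : 1 / (q + 1) ≤ 1 / 100 := one_div_le_one_div_of_le (by norm_num) (by linarith)
  have h5 : (t - 1 / (q + 1)) ^ 2 ≤ √N * (t - 1 / (q + 1)) ^ 2 :=
    le_mul_of_one_le_left (sq_nonneg _) hs
  rw [quadMaj]
  rcases le_total t 2 with h | h
  · nlinarith [sq_nonneg (t - 1 / (q + 1))]
  · have h4 : t / 2 ≤ t - 1 / (q + 1) := by linarith
    nlinarith [mul_self_le_mul_self (by linarith) h4]

theorem exp_le_quadMaj {N : ℕ} (hN : 1 ≤ N) {q t : ℝ} (hq : 99 ≤ q) (h0 : 0 ≤ t)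
    (h1 : t ≤ 1 / 2) : Real.exp (t ^ 3 - t * (1 - t) / (2 * q)) ≤ quadMaj N q t := by
  have hs : 1 ≤ √(N : ℝ) := Real.one_le_sqrt.2 (by exact_mod_cast hN)
  have hq0 : 0 < q := by linarith
  obtain ⟨w, hw⟩ : ∃ w, w = 1 / q := ⟨_, rfl⟩
  obtain ⟨t₀, ht₀⟩ : ∃ t₀, t₀ = 1 / (q + 1) := ⟨_, rfl⟩
  have hw0 : 0 < w := by rw [hw]; positivity
  have hw1 : w ≤ 1 / 99 := by rw [hw]; exact one_div_le_one_div_of_le (by norm_num) hq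
  have ht0 : 0 < t₀ := by rw [ht₀]; positivity
  have htw : t₀ ≤ w := by rw [ht₀, hw]; exact one_div_le_one_div_of_le hq0 (by linarith)
  have e1 : t * (1 - t) / (2 * q) = t * (1 - t) * w / 2 := by rw [hw]; field_simp
  have e2 : quadMaj N q t = 1 - t * w / 2 + 7 * w ^ 3 + 100 * √N * (t - t₀) ^ 2 := by
    rw [quadMaj, ht₀, hw]; field_simp
  rw [e1, e2]
  have h5 : (t - t₀) ^ 2 ≤ √N * (t - t₀) ^ 2 := le_mul_of_one_le_left (sq_nonneg _) hs
  obtain ⟨x, hx⟩ : ∃ x, x = t - t₀ := ⟨_, rfl⟩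
  rw [← hx] at h5 ⊢
  set g := t * (1 - t) * w / 2 with hg
  have hg0 : 0 ≤ g := by
    have : 0 ≤ 1 - t := by linarith
    positivity
  have hg1 : g ≤ t * w / 2 := by rw [hg]; nlinarith [mul_nonneg (mul_nonneg h0 h0) hw0.le]
  have ht3 : 0 ≤ t ^ 3 := by positivity
  have ht3' : t ^ 3 ≤ 1 / 8 := by
    calc t ^ 3 ≤ (1 / 2) ^ 3 := by gcongr
      _ = _ := by norm_num
  have hgb : g ≤ 1 / 8 := by nlinarith
  have hexp := Real.abs_exp_sub_one_sub_id_le (x := t ^ 3 - g) (by rw [abs_le]; constructor <;> linarith)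
  have hexp' := (abs_le.1 hexp).2
  have hsq : (t ^ 3 - g) ^ 2 ≤ t ^ 3 / 8 + t ^ 2 * w ^ 2 / 4 := by
    have : g ^ 2 ≤ (t * w / 2) ^ 2 := by gcongr
    nlinarith only [mul_nonneg ht3 hg0, this, ht3, ht3', mul_nonneg ht3 (sub_nonneg.2 ht3')]
  have hx2 : t ^ 2 ≤ 2 * w ^ 2 + 2 * x ^ 2 := by
    have : t ^ 2 = (t₀ + x) ^ 2 := by rw [hx]; ring
    have h6 : t₀ ^ 2 ≤ w ^ 2 := by gcongr
    nlinarith only [sq_nonneg (t₀ - x), this, h6]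
  have hx3 : t ^ 3 ≤ 4 * w ^ 3 + 4 * x ^ 2 := by
    have h6 : t₀ ^ 3 ≤ w ^ 3 := by gcongr
    have hta : t ≤ t₀ + |x| := by
      have := le_abs_self x
      linarith
    have hxa : |x| ≤ 1 := by rw [abs_le]; constructor <;> linarith
    have hx0 := abs_nonneg x
    have h7 : t ^ 3 ≤ (t₀ + |x|) ^ 3 := by gcongr
    have h8 : (t₀ + |x|) ^ 3 ≤ 4 * (t₀ ^ 3 + |x| ^ 3) := by
      nlinarith only [mul_nonneg (add_nonneg ht0.le hx0) (sq_nonneg (t₀ - |x|))]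
    have h9 : |x| ^ 3 ≤ x ^ 2 := by
      rw [← sq_abs x]; exact pow_le_pow_of_le_one hx0 hxa (by norm_num)
    linarith
  have hx2w : t ^ 2 * w ≤ 2 * w ^ 3 + 2 * x ^ 2 := by
    have h6 := mul_nonneg hw0.le (sub_nonneg.2 hx2)
    have h7 : w * x ^ 2 ≤ x ^ 2 := mul_le_of_le_one_left (sq_nonneg x) (by linarith)
    linarith only [h6, h7]
  have hx2w2 : t ^ 2 * w ^ 2 ≤ t ^ 2 * w := by
    have h6 : w ^ 2 ≤ w := by nlinarith only [hw0, hw1]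
    exact mul_le_mul_of_nonneg_left h6 (sq_nonneg t)
  have hge : g = t * w / 2 - t ^ 2 * w / 2 := by rw [hg]; ring
  have hw3 : 0 ≤ w ^ 3 := by positivity
  linarith [sq_nonneg x]

theorem exp_half_le_two : Real.exp (1 / 2) ≤ 2 := by
  have h := Real.exp_one_lt_d9
  have : Real.exp (1 / 2) * Real.exp (1 / 2) = Real.exp 1 := by rw [← Real.exp_add]; norm_num
  nlinarith [Real.exp_pos (1 / 2)]

theorem halfProd_mul_dm_le {N k : ℕ} (hN : 1 ≤ N) (hk : k ≤ N) {q : ℝ} (hq : 99 ≤ q) :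
    halfProd N k * dm (N - k) * (Real.exp (1 / 2) *
      Real.exp (-(ovFrac q (k / N) / 2) - ovFrac q (k / N) ^ 2 / 4)) ≤
    df (N - k) * ((1 + 20 / N) * quadMaj N q (k / N)) := by
  have hN0 : (0 : ℝ) < N := by exact_mod_cast hN
  have hkN : (k : ℝ) ≤ N := by exact_mod_cast hk
  obtain ⟨t, ht⟩ : ∃ t : ℝ, t = k / N := ⟨_, rfl⟩
  have ht0 : 0 ≤ t := by rw [ht]; positivity
  have ht1 : t ≤ 1 := by rw [ht, div_le_one hN0]; exact hkN
  have hkt : (k : ℝ) = N * t := by rw [ht]; field_simp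
  rw [← ht]
  have hdf := df_pos (N - k)
  have hH1 := one_le_halfProd hk
  have hH := halfProd_sq_mul_le hk
  have hu := le_ovFrac (q := q) (by linarith) ht0 ht1
  have hu0 := ovFrac_nonneg (q := q) (by linarith) ht0
  set u := ovFrac q t with hu_def
  set H := halfProd N k with hH_def
  have hq0 : 0 < q := by linarith
  rcases le_total t (1 / 2) with h | h
  · have hNk : (N : ℝ) / 2 ≤ ((N - k : ℕ) : ℝ) := by
      rw [Nat.cast_sub hk, hkt]; nlinarith
    have hNk1 : 1 ≤ N - k := by
      have : (0 : ℝ) < ((N - k : ℕ) : ℝ) := by linarith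
      exact_mod_cast this
    have hdm := dm_le (N - k) hNk1
    have h1 : Real.exp (-(1 / 2)) * Real.exp (1 / 2) = 1 := by rw [← Real.exp_add]; norm_num
    have h2 : (Real.exp (-(1 / 2)) + 5 / ((N - k : ℕ) : ℝ)) * Real.exp (1 / 2) ≤ 1 + 20 / N := by
      have h3 : 5 / ((N - k : ℕ) : ℝ) ≤ 10 / N := by
        calc 5 / ((N - k : ℕ) : ℝ) ≤ 5 / ((N : ℝ) / 2) := by gcongr
          _ = _ := by field_simp; norm_num
      have h4 : 0 ≤ 10 / (N : ℝ) := by positivity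
      have h5 : 20 / (N : ℝ) = 10 / N * 2 := by ring
      rw [add_mul, h1, h5]
      gcongr
      exact exp_half_le_two
    have h6 : H * Real.exp (-(u / 2) - u ^ 2 / 4) ≤ Real.exp (t ^ 3 - t * (1 - t) / (2 * q)) := by
      have h7 : H ^ 2 * (1 - t) ≤ 1 := by
        have h9 : H ^ 2 * (N * (1 - t) + 1 / 4) ≤ N + 1 / 4 := by
          rw [show (N : ℝ) * (1 - t) + 1 / 4 = N - k + 1 / 4 by rw [hkt]; ring]; exact hH
        have h10 : 1 ≤ H ^ 2 := one_le_pow₀ hH1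
        by_contra hc
        push Not at hc
        nlinarith
      have h8 := one_le_one_sub_mul_exp ht0 h
      have h11 : H ^ 2 ≤ Real.exp (t + t ^ 2 / 2 + 2 * t ^ 3) := by
        have : 0 ≤ H ^ 2 := sq_nonneg H
        calc H ^ 2 = H ^ 2 * 1 := by ring
          _ ≤ H ^ 2 * ((1 - t) * Real.exp (t + t ^ 2 / 2 + 2 * t ^ 3)) := by gcongr
          _ = (H ^ 2 * (1 - t)) * Real.exp (t + t ^ 2 / 2 + 2 * t ^ 3) := by ring
          _ ≤ 1 * Real.exp (t + t ^ 2 / 2 + 2 * t ^ 3) := by gcongr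
          _ = _ := one_mul _
      have h12 : H ≤ Real.exp (t / 2 + t ^ 2 / 4 + t ^ 3) := by
        have h13 : Real.exp (t + t ^ 2 / 2 + 2 * t ^ 3) =
            Real.exp (t / 2 + t ^ 2 / 4 + t ^ 3) ^ 2 := by
          rw [← Real.exp_nat_mul]; congr 1; push_cast; ring
        rw [h13] at h11
        exact le_of_sq_le_sq h11 (Real.exp_pos _).le
      have h14 : t ≤ u := by
        have : 0 ≤ t * (1 - t) / q := by
          have : 0 ≤ 1 - t := by linarith
          positivity
        linarith
      have h15 : t ^ 2 ≤ u ^ 2 := by gcongr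
      calc H * Real.exp (-(u / 2) - u ^ 2 / 4)
          ≤ Real.exp (t / 2 + t ^ 2 / 4 + t ^ 3) * Real.exp (-(u / 2) - u ^ 2 / 4) := by gcongr
        _ = Real.exp (t / 2 + t ^ 2 / 4 + t ^ 3 + (-(u / 2) - u ^ 2 / 4)) := (Real.exp_add _ _).symm
        _ ≤ _ := by
            apply Real.exp_le_exp.2
            have : t * (1 - t) / (2 * q) = t * (1 - t) / q / 2 := by field_simp
            rw [this]
            linarith
    have hQ := exp_le_quadMaj hN hq ht0 h
    have hQ0 := quadMaj_nonneg hN hq ht0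
    calc H * dm (N - k) * (Real.exp (1 / 2) * Real.exp (-(u / 2) - u ^ 2 / 4))
        ≤ H * (df (N - k) * (Real.exp (-(1 / 2)) + 5 / ((N - k : ℕ) : ℝ))) *
          (Real.exp (1 / 2) * Real.exp (-(u / 2) - u ^ 2 / 4)) := by gcongr
      _ = df (N - k) * (((Real.exp (-(1 / 2)) + 5 / ((N - k : ℕ) : ℝ)) * Real.exp (1 / 2)) *
          (H * Real.exp (-(u / 2) - u ^ 2 / 4))) := by ring
      _ ≤ df (N - k) * ((1 + 20 / N) * quadMaj N q t) := by
          gcongr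
          exact h6.trans hQ
  · have hs2 : √(N : ℝ) ^ 2 = N := Real.sq_sqrt hN0.le
    have hs : 1 ≤ √(N : ℝ) := Real.one_le_sqrt.2 (by exact_mod_cast hN)
    set s := √(N : ℝ) with hs_def
    have hH2 : H ≤ 3 * s := by
      refine le_of_sq_le_sq ?_ (by positivity)
      nlinarith [sq_nonneg H]
    have h1 : Real.exp (-(u / 2) - u ^ 2 / 4) ≤ 1 := by
      rw [Real.exp_le_one_iff]; nlinarith [sq_nonneg u]
    have h3 : 1 / (q + 1) ≤ 1 / 100 := one_div_le_one_div_of_le (by norm_num) (by linarith)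
    have hQ : 18 * s ≤ quadMaj N q t := by
      rw [quadMaj, ← hs_def]
      have h4 : t / (2 * q) ≤ 1 := by rw [div_le_one (by positivity)]; linarith
      have h5 : 0 ≤ 7 / q ^ 3 := by positivity
      have h6 : 0.24 ≤ (t - 1 / (q + 1)) ^ 2 := by
        have : 0.49 ≤ t - 1 / (q + 1) := by linarith
        nlinarith
      nlinarith
    have hdm := dm_le_three_mul (N - k)
    calc H * dm (N - k) * (Real.exp (1 / 2) * Real.exp (-(u / 2) - u ^ 2 / 4))
        ≤ H * (3 * df (N - k)) * (Real.exp (1 / 2) * Real.exp (-(u / 2) - u ^ 2 / 4)) := by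
          gcongr
      _ ≤ (3 * s) * (3 * df (N - k)) * (2 * 1) := by
          have := exp_half_le_two
          gcongr
      _ = df (N - k) * (1 * (18 * s)) := by ring
      _ ≤ df (N - k) * ((1 + 20 / N) * quadMaj N q t) := by
          have : 0 ≤ 20 / (N : ℝ) := by positivity
          gcongr
          linarith

theorem one_sub_rpow_half_le {z : ℝ} (h0 : 0 ≤ z) (h1 : z ≤ 1 / 2) :
    ((1 - z) ^ ((1 : ℝ) / 2))⁻¹ ≤ 1 + z / 2 + z ^ 2 := by
  rw [← Real.sqrt_eq_rpow]
  have hp : 0 < √(1 - z) := Real.sqrt_pos.2 (by linarith)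
  rw [inv_le_iff_one_le_mul₀ hp]
  have h2 : √(1 - z) ^ 2 = 1 - z := Real.sq_sqrt (by linarith)
  refine le_of_sq_le_sq ?_ (by positivity)
  rw [mul_pow, h2]
  nlinarith [pow_nonneg h0 3, pow_nonneg h0 2, pow_nonneg h0 4, pow_nonneg h0 5]

theorem sum_nbc_mul_quadMaj_le {N : ℕ} {q : ℝ} (hq : 99 ≤ q) (hN : q ^ 6 ≤ 2 * N)
    (s : Finset ℕ) :
    ∑ k ∈ s, nbc (N * (q - 1) + 1 / 2) (q ^ 2)⁻¹ k * quadMaj N q (k / N) ≤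
      ((1 - (q ^ 2)⁻¹) ^ (N * (q - 1) + 1 / 2 : ℝ))⁻¹ *
        (1 - 1 / (2 * q * (q + 1)) + 607 / q ^ 3) := by
  have hq0 : 0 < q := by linarith
  have hq6 : 0 < q ^ 6 := by positivity
  have hN0 : (0 : ℝ) < N := by linarith
  have hN1 : 1 ≤ N := by exact_mod_cast hN0
  have hq2 : 1 < q ^ 2 := by nlinarith
  have hz0 : 0 ≤ (q ^ 2)⁻¹ := by positivity
  have hz1 : (q ^ 2)⁻¹ < 1 := inv_lt_one_of_one_lt₀ hq2
  have ha : 0 ≤ N * (q - 1) + 1 / 2 := by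
    have : 0 ≤ q - 1 := by linarith
    positivity
  have key : ∀ k : ℕ, quadMaj N q (k / N) = (1 + 7 / q ^ 3) + (-(1 / (2 * q * N))) * k +
      (100 * √N / N ^ 2) * ((k : ℝ) - N / (q + 1)) ^ 2 := by
    intro k
    rw [quadMaj]
    field_simp
    ring
  have h := sum_nbc_mul_le ha hz0 hz1 (1 + 7 / q ^ 3) (-(1 / (2 * q * N))) (100 * √N / N ^ 2)
    (N / (q + 1)) (fun k => by
      rw [← key]; exact quadMaj_nonneg hN1 hq (by positivity)) s
  simp only [key]
  refine h.trans (mul_le_mul_of_nonneg_left ?_ (by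
    have : 0 ≤ 1 - (q ^ 2)⁻¹ := by linarith
    positivity))
  have hD : 0 < q ^ 2 - 1 := by linarith
  have hq1 : q - 1 ≠ 0 := by linarith
  have hμ : (N * (q - 1) + 1 / 2) * (q ^ 2)⁻¹ / (1 - (q ^ 2)⁻¹) =
      N / (q + 1) + 1 / (2 * (q ^ 2 - 1)) := by
    have : q ^ 2 - 1 = (q - 1) * (q + 1) := by ring
    have e : 1 - (q ^ 2)⁻¹ = (q - 1) * (q + 1) / q ^ 2 := by field_simp; ring
    rw [e, this]
    field_simp
  have hv : (N * (q - 1) + 1 / 2) * (q ^ 2)⁻¹ / (1 - (q ^ 2)⁻¹) ^ 2 =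
      (N / (q + 1) + 1 / (2 * (q ^ 2 - 1))) * (q ^ 2 / (q ^ 2 - 1)) := by
    rw [← hμ]
    have e : 1 - (q ^ 2)⁻¹ = (q ^ 2 - 1) / q ^ 2 := by field_simp
    rw [e]
    field_simp
  rw [hv, hμ]
  have h1 : 0 ≤ 1 / (2 * (q ^ 2 - 1)) := by positivity
  have h1' : 1 / (2 * (q ^ 2 - 1)) ≤ 1 / 2 := one_div_le_one_div_of_le (by norm_num) (by nlinarith)
  have h2 : (N : ℝ) / (q + 1) ≤ N / 2 := by gcongr; linarith
  have h3 : q ^ 2 / (q ^ 2 - 1) ≤ 2 := by rw [div_le_iff₀ hD]; nlinarith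
  have hN1' : (1 : ℝ) ≤ N := by exact_mod_cast hN1
  have h4 : (N / (q + 1) + 1 / (2 * (q ^ 2 - 1))) * (q ^ 2 / (q ^ 2 - 1)) ≤ 2 * N := by
    calc _ ≤ ((N : ℝ) / 2 + 1 / 2) * 2 := by gcongr
      _ ≤ _ := by linarith
  have h5 : (N / (q + 1) + 1 / (2 * (q ^ 2 - 1)) - N / (q + 1)) ^ 2 ≤ N := by
    have : N / (q + 1) + 1 / (2 * (q ^ 2 - 1)) - N / (q + 1) = 1 / (2 * (q ^ 2 - 1)) := by ring
    rw [this]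
    nlinarith
  have h6 : 1 / (2 * q * (q + 1)) ≤
      1 / (2 * q * N) * (N / (q + 1) + 1 / (2 * (q ^ 2 - 1))) := by
    calc 1 / (2 * q * (q + 1)) = 1 / (2 * q * N) * (N / (q + 1)) := by field_simp
      _ ≤ _ := by gcongr; linarith
  have hs0 : 0 < √(N : ℝ) := Real.sqrt_pos.2 hN0
  have hs2 : √(N : ℝ) ^ 2 = N := Real.sq_sqrt hN0.le
  have h7 : q ^ 3 ≤ 2 * √N := by
    refine le_of_sq_le_sq ?_ (by positivity)
    nlinarith
  have h8 : 100 * √N / N ^ 2 * (2 * N + N) ≤ 600 / q ^ 3 := by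
    have e : 100 * √N / N ^ 2 * (2 * N + N) = 300 / √(N : ℝ) := by
      rw [div_mul_eq_mul_div, div_eq_div_iff (by positivity) hs0.ne']
      linear_combination 300 * (N : ℝ) * hs2
    rw [e, div_le_div_iff₀ hs0 (by positivity)]
    linarith
  have h9 : 100 * √N / N ^ 2 * ((N / (q + 1) + 1 / (2 * (q ^ 2 - 1))) * (q ^ 2 / (q ^ 2 - 1)) +
      (N / (q + 1) + 1 / (2 * (q ^ 2 - 1)) - N / (q + 1)) ^ 2) ≤
      100 * √N / N ^ 2 * (2 * N + N) := by gcongr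
  have h10 : 607 / q ^ 3 = 7 / q ^ 3 + 600 / q ^ 3 := by ring
  rw [h10]
  linarith

theorem extProd_pos {N j : ℕ} (h : j ≤ N) {q : ℝ} (hq : 1 ≤ q) : 0 < extProd N q j := by
  rw [extProd]
  refine prod_pos fun i hi => ?_
  have h1 : (i : ℝ) + 1 ≤ N := by
    have := mem_range.1 hi
    exact_mod_cast (by omega : i + 1 ≤ N)
  have h2 : (N : ℝ) * 1 ≤ N * q := by gcongr
  have : 0 < 2 * N * q - 2 * i - 1 := by linarith
  positivity

/-- Summing the overlap weights over all overlap sizes. -/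
theorem overlap_sum_le {N p : ℕ} (hp : 99 ≤ (p : ℝ) + 1) (hN : ((p : ℝ) + 1) ^ 6 ≤ 2 * N) :
    ∑ k ∈ range (N + 1), (extProd N ((p : ℝ) + 1) (N - k) *
      Real.exp (3 / 4 - ovFrac (p + 1) (k / N) / 2 - ovFrac (p + 1) (k / N) ^ 2 / 4)) *
        (N.choose k * dm (N - k)) ≤
      df N * Real.exp (1 / 4) * extProd N (p + 2) N * Real.exp (800 / ((p : ℝ) + 1) ^ 3) := by
  obtain ⟨q, hqd⟩ : ∃ q : ℝ, q = p + 1 := ⟨_, rfl⟩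
  have hext := fun h1 h2 => extProd_le (N := N) (p := p) h1 h2
  rw [← hqd] at hp hN hext ⊢
  have hq0 : 0 < q := by linarith
  have hq6 : 0 < q ^ 6 := by positivity
  have hN0 : (0 : ℝ) < N := by linarith
  have hN1 : 1 ≤ N := by exact_mod_cast hN0
  have hp1 : 1 ≤ p := by
    have : (0 : ℝ) < p := by linarith
    exact_mod_cast this
  have hE0 : 0 < extProd N q N := extProd_pos le_rfl (by linarith)
  have hP0 : 0 < extProd N (p + 2) N := extProd_pos le_rfl (by linarith [(Nat.cast_nonneg p : (0:ℝ) ≤ p)])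
  have hdf := df_pos N
  have ha : 0 ≤ N * (q - 1) + 1 / 2 := by
    have : 0 ≤ q - 1 := by linarith
    positivity
  set a := N * (q - 1) + 1 / 2 with had
  obtain ⟨z, hz⟩ : ∃ z, z = (q ^ 2)⁻¹ := ⟨_, rfl⟩
  have hz0 : 0 ≤ z := by rw [hz]; positivity
  have hz1 : z ≤ 1 / 2 := by
    rw [hz, inv_eq_one_div]; exact one_div_le_one_div_of_le (by norm_num) (by nlinarith)
  have hsum := sum_nbc_mul_quadMaj_le hp hN (range (N + 1))
  rw [← had, ← hz] at hsum
  have hext := hext hN1 hp1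
  rw [← hz] at hext
  have hz1' : 0 < 1 - z := by linarith
  have hW : (1 - z) ^ (N * p) * ((1 - z) ^ a)⁻¹ = ((1 - z) ^ ((1 : ℝ) / 2))⁻¹ := by
    have e : a = ((N * p : ℕ) : ℝ) + 1 / 2 := by rw [had, hqd]; push_cast; ring
    rw [e, Real.rpow_add hz1', Real.rpow_natCast, mul_inv, ← mul_assoc,
      mul_inv_cancel₀ (pow_pos hz1' _).ne', one_mul]
  have hterm : ∀ k ∈ range (N + 1), (extProd N q (N - k) *
      Real.exp (3 / 4 - ovFrac q (k / N) / 2 - ovFrac q (k / N) ^ 2 / 4)) *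
        (N.choose k * dm (N - k)) ≤ df N * extProd N q N * Real.exp (1 / 4) * (1 + 20 / N) *
          (nbc a z k * quadMaj N q (k / N)) := by
    intro k hk
    have hk' : k ≤ N := by have := mem_range.1 hk; omega
    have h1 := choose_mul_df_mul_extProd hk' (q := q) (by linarith)
    rw [← had, ← hz] at h1
    have h2 := halfProd_mul_dm_le hN1 hk' hp
    have h3 := df_pos (N - k)
    have h4 := nbc_nonneg ha hz0 k
    have e1 : Real.exp (3 / 4 - ovFrac q (k / N) / 2 - ovFrac q (k / N) ^ 2 / 4) =
        Real.exp (1 / 4) * (Real.exp (1 / 2) *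
          Real.exp (-(ovFrac q (k / N) / 2) - ovFrac q (k / N) ^ 2 / 4)) := by
      rw [← Real.exp_add, ← Real.exp_add]; congr 1; ring
    set X := Real.exp (1 / 2) * Real.exp (-(ovFrac q (k / N) / 2) - ovFrac q (k / N) ^ 2 / 4)
    rw [e1]
    refine le_of_mul_le_mul_right ?_ h3
    calc (extProd N q (N - k) * (Real.exp (1 / 4) * X)) * (N.choose k * dm (N - k)) * df (N - k)
        = (N.choose k * df (N - k) * extProd N q (N - k)) * dm (N - k) * X * Real.exp (1 / 4) := by
          ring
      _ = (df N * extProd N q N * nbc a z k * Real.exp (1 / 4)) *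
          (halfProd N k * dm (N - k) * X) := by rw [h1]; ring
      _ ≤ (df N * extProd N q N * nbc a z k * Real.exp (1 / 4)) *
          (df (N - k) * ((1 + 20 / N) * quadMaj N q (k / N))) := by gcongr
      _ = _ := by ring
  refine (sum_le_sum hterm).trans ?_
  rw [← mul_sum]
  obtain ⟨w, hw⟩ : ∃ w, w = 1 / q := ⟨_, rfl⟩
  have hw0 : 0 < w := by rw [hw]; positivity
  have hw1 : w ≤ 1 / 99 := by rw [hw]; exact one_div_le_one_div_of_le (by norm_num) hp
  have hzw : z = w ^ 2 := by rw [hz, hw]; field_simp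
  have hw3 : ∀ c : ℝ, c / q ^ 3 = c * w ^ 3 := by intro c; rw [hw]; field_simp
  rw [hw3] at hsum ⊢
  have hNw : 1 / (N : ℝ) ≤ w ^ 3 := by
    have e : w ^ 3 = 1 / q ^ 3 := by rw [hw]; field_simp
    rw [e]
    apply one_div_le_one_div_of_le (by positivity)
    have : 2 ≤ q ^ 3 := by
      calc (2 : ℝ) ≤ 99 ^ 3 := by norm_num
        _ ≤ q ^ 3 := by gcongr
    nlinarith
  have h20 : 1 + 20 / (N : ℝ) ≤ Real.exp (20 * w ^ 3) := by
    have := Real.add_one_le_exp (20 * w ^ 3)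
    have e : 20 / (N : ℝ) = 20 * (1 / N) := by ring
    rw [e]; linarith
  have h700 : (1 + z / 2 + z ^ 2) * (1 - 1 / (2 * q * (q + 1)) + 607 * w ^ 3) ≤
      Real.exp (700 * w ^ 3) := by
    have h1 : w ^ 2 / 2 - w ^ 3 / 2 ≤ 1 / (2 * q * (q + 1)) := by
      rw [le_div_iff₀ (by positivity)]
      have : q = 1 / w := by rw [hw]; field_simp
      rw [this]
      have : (w ^ 2 / 2 - w ^ 3 / 2) * (2 * (1 / w) * (1 / w + 1)) = 1 - w ^ 2 := by
        field_simp; ring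
      rw [this]; nlinarith
    have h2 := Real.add_one_le_exp (700 * w ^ 3)
    have h3 : (1 + z / 2 + z ^ 2) * (1 - 1 / (2 * q * (q + 1)) + 607 * w ^ 3) ≤
        (1 + z / 2 + z ^ 2) * (1 - w ^ 2 / 2 + 608 * w ^ 3) := by
      have : 0 ≤ w ^ 3 := by positivity
      gcongr ?_ * ?_
      linarith
    refine h3.trans (le_trans ?_ h2)
    rw [hzw]
    have h4 : 0 ≤ w ^ 3 := by positivity
    have h5 : w ^ 4 ≤ w ^ 3 := pow_le_pow_of_le_one hw0.le (by linarith) (by norm_num)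
    have h6 : w ^ 5 ≤ w ^ 3 * (1 / 99) ^ 2 := by
      calc w ^ 5 = w ^ 3 * w ^ 2 := by ring
        _ ≤ _ := by gcongr
    have h7 : w ^ 7 ≤ w ^ 3 * (1 / 99) ^ 4 := by
      calc w ^ 7 = w ^ 3 * w ^ 4 := by ring
        _ ≤ _ := by gcongr
    have h8 : 0 ≤ w ^ 6 := by positivity
    have h9 : 0 ≤ w ^ 4 := by positivity
    nlinarith
  have hhalf := one_sub_rpow_half_le hz0 hz1
  have hV0 : 0 ≤ 1 - 1 / (2 * q * (q + 1)) + 607 * w ^ 3 := by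
    have : 1 / (2 * q * (q + 1)) ≤ 1 := by rw [div_le_one (by positivity)]; nlinarith
    have : 0 ≤ w ^ 3 := by positivity
    linarith
  set V := 1 - 1 / (2 * q * (q + 1)) + 607 * w ^ 3
  have hWa : 0 ≤ ((1 - z) ^ a)⁻¹ := by positivity
  have hc : 0 ≤ 20 / (N : ℝ) := by positivity
  have hw3' : 0 ≤ w ^ 3 := by positivity
  calc df N * extProd N q N * Real.exp (1 / 4) * (1 + 20 / N) *
        ∑ k ∈ range (N + 1), nbc a z k * quadMaj N q (k / N)
      ≤ df N * (extProd N (p + 2) N * (1 - z) ^ (N * p) * Real.exp (1 / N)) * Real.exp (1 / 4) *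
        Real.exp (20 * w ^ 3) * (((1 - z) ^ a)⁻¹ * V) := by
        refine mul_le_mul ?_ hsum ?_ (by positivity)
        · gcongr
        · exact sum_nonneg fun k _ => mul_nonneg (nbc_nonneg ha hz0 k)
            (quadMaj_nonneg hN1 hp (by positivity))
    _ = df N * Real.exp (1 / 4) * extProd N (p + 2) N * (Real.exp (1 / N) * Real.exp (20 * w ^ 3) *
        (((1 - z) ^ (N * p) * ((1 - z) ^ a)⁻¹) * V)) := by ring
    _ ≤ df N * Real.exp (1 / 4) * extProd N (p + 2) N * (Real.exp (w ^ 3) * Real.exp (20 * w ^ 3) *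
        Real.exp (700 * w ^ 3)) := by
        rw [hW]
        gcongr
        exact (mul_le_mul_of_nonneg_right hhalf hV0).trans h700
    _ ≤ _ := by
        rw [← Real.exp_add, ← Real.exp_add]
        gcongr
        linarith

section

variable {n : ℕ}

theorem wt_sub_wt_sup {p N : ℕ} (hp : 1 ≤ p) (hN0 : 0 < N) (hN : n = 2 * N)
    {M₁ M₂ : SimpleGraph (Fin n)} (h₁ : IsRegularGraph M₁ 1) (h₂ : IsRegularGraph M₂ 1) :
    wt (p + 2) M₁ - wt (p + 2) (M₁ ⊔ M₂) =
      3 / 4 - ovFrac (p + 1) (ov M₁ M₂ / N) / 2 - ovFrac (p + 1) (ov M₁ M₂ / N) ^ 2 / 4 := by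
  have hp0 : (0 : ℝ) < p := by exact_mod_cast hp
  have hN0' : (0 : ℝ) < N := by exact_mod_cast hN0
  have hn : (n : ℝ) = 2 * N := by rw [hN]; push_cast; ring
  have hn0 : (0 : ℝ) < n := by rw [hn]; positivity
  obtain ⟨h3, h4, h5⟩ := wt_sup_matching (r := p + 2) h₁ h₂ (sum_adj_inf M₁ M₂)
  have h6 := (wt_matching (r := p + 2) hn0 (by push_cast; linarith) h₁).2
  rw [h6, wt, h3, h4, h5, hn]
  obtain ⟨t, ht⟩ : ∃ t : ℝ, t = ov M₁ M₂ / N := ⟨_, rfl⟩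
  have ht0 : 0 ≤ t := by rw [ht]; positivity
  have hk : (ov M₁ M₂ : ℝ) = N * t := by rw [ht]; field_simp
  rw [← ht, hk]
  have e0 : p + t ≠ 0 := by positivity
  have e1 : (2 * (N : ℝ) * (((p + 2 : ℕ) : ℝ) - 2) ^ 2 +
      2 * (N * t) * (2 * ((p + 2 : ℕ) : ℝ) - 3)) / (2 * N * (((p + 2 : ℕ) : ℝ) - 2) +
        2 * (N * t)) = p + ovFrac (p + 1) t := by
    rw [ovFrac]
    push_cast
    rw [show (p : ℝ) + 2 - 2 = p by ring, show (p : ℝ) + 1 - 1 = p by ring,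
      show 2 * (N : ℝ) * p + 2 * (N * t) = 2 * N * (p + t) by ring]
    field_simp
    ring
  have e2 : 2 * (N * t * (((p + 2 : ℕ) : ℝ) - 1) ^ 2 +
      (2 * N - 2 * (N * t)) * (((p + 2 : ℕ) : ℝ) - 2) ^ 2) /
        (2 * (2 * N * (((p + 2 : ℕ) : ℝ) - 2) + 2 * (N * t))) =
      p + ovFrac (p + 1) t * (1 - p) / 2 := by
    rw [ovFrac]
    push_cast
    rw [show (p : ℝ) + 2 - 2 = p by ring, show (p : ℝ) + 1 - 1 = p by ring,
      show 2 * (N : ℝ) * p + 2 * (N * t) = 2 * N * (p + t) by ring]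
    field_simp
    ring
  rw [e1, e2]
  push_cast
  ring

theorem cnt_eq_wcnt_mul (r : ℕ) (L : SimpleGraph (Fin n)) :
    cnt r L = wcnt r L * Real.exp (-wt r L) := by
  rw [wcnt, mul_assoc, ← Real.exp_add, add_neg_cancel, Real.exp_zero, mul_one]

theorem le_cnt_matching {r N : ℕ} (h : Big n r) (hN : n = 2 * N) {M : SimpleGraph (Fin n)}
    (hM : IsRegularGraph M 1) :
    cnt r (⊥ : SimpleGraph (Fin n)) * Real.exp (1 / 4) * extProd N r N *
      (1 - 4000 * r ^ 2 / n ^ 2) ^ N ≤ cnt r M := by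
  have hr := h.r_big
  have h1 := wcnt_matching_ge h hN hM
  have h2 := (wt_bot (r := r) h.npos (by linarith)).2
  have h3 := (wt_matching (r := r) h.npos (by linarith) hM).2
  have hn : (n : ℝ) = 2 * N := by rw [hN]; push_cast; ring
  have e : ∏ i ∈ range N, (r : ℝ) ^ 2 / (n * r - 2 * i - 1) = extProd N r N := by
    rw [extProd, hn]
  rw [e] at h1
  have h4 : Real.exp (-wt r (⊥ : SimpleGraph (Fin n))) * Real.exp (1 / 4) =
      Real.exp (-wt r M) := by
    rw [← Real.exp_add, h2, h3]; congr 1; ring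
  rw [cnt_eq_wcnt_mul r M, cnt_eq_wcnt_mul r ⊥, ← h4]
  have h5 := mul_le_mul_of_nonneg_right h1
    (mul_pos (Real.exp_pos (-wt r (⊥ : SimpleGraph (Fin n)))) (Real.exp_pos (1 / 4))).le
  refine le_trans (le_of_eq ?_) h5
  ring

theorem cnt_sup_matching_le {p N : ℕ} (h : Big n (p + 2)) (hN : n = 2 * N)
    {M₁ M₂ : SimpleGraph (Fin n)} (h₁ : IsRegularGraph M₁ 1) (h₂ : IsRegularGraph M₂ 1) :
    cnt (p + 2) (M₁ ⊔ M₂) ≤ cnt (p + 2) M₁ *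
      (1 + 4000 * ((p + 2 : ℕ) : ℝ) ^ 2 / n ^ 2) ^ N *
      (extProd N ((p : ℝ) + 1) (N - ov M₁ M₂) * Real.exp (3 / 4 -
        ovFrac (p + 1) (ov M₁ M₂ / N) / 2 - ovFrac (p + 1) (ov M₁ M₂ / N) ^ 2 / 4)) := by
  have hr := h.r_big
  have hn : (n : ℝ) = 2 * N := by rw [hN]; push_cast; ring
  have hk := ov_le hN h₁ M₂
  have h1 := wcnt_sup_matching_le h hN hk h₁ h₂ (sum_adj_inf M₁ M₂)
  have e : ∏ i ∈ range (N - ov M₁ M₂), (((p + 2 : ℕ) : ℝ) - 1) ^ 2 /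
      (n * (((p + 2 : ℕ) : ℝ) - 1) - 2 * i - 1) = extProd N ((p : ℝ) + 1) (N - ov M₁ M₂) := by
    rw [extProd, hn]
    push_cast
    rw [show (p : ℝ) + 2 - 1 = p + 1 by ring]
  rw [e] at h1
  have hp1 : 1 ≤ p := by
    have : (98 : ℝ) ≤ p := by push_cast at hr; linarith
    have : (1 : ℝ) ≤ p := by linarith
    exact_mod_cast this
  have hN0 : 0 < N := by
    have := h.npos
    rw [hn] at this
    have : (0 : ℝ) < N := by linarith
    exact_mod_cast this
  rw [← wt_sub_wt_sup hp1 hN0 hN h₁ h₂, cnt_eq_wcnt_mul _ (M₁ ⊔ M₂), cnt_eq_wcnt_mul _ M₁]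
  have hE : 0 < extProd N ((p : ℝ) + 1) (N - ov M₁ M₂) :=
    extProd_pos (Nat.sub_le _ _) (by linarith [(Nat.cast_nonneg p : (0 : ℝ) ≤ p)])
  have hη : 0 ≤ 4000 * ((p + 2 : ℕ) : ℝ) ^ 2 / (n : ℝ) ^ 2 := by positivity
  have hpow : (1 + 4000 * ((p + 2 : ℕ) : ℝ) ^ 2 / (n : ℝ) ^ 2) ^ (N - ov M₁ M₂) ≤
      (1 + 4000 * ((p + 2 : ℕ) : ℝ) ^ 2 / (n : ℝ) ^ 2) ^ N :=
    pow_le_pow_right₀ (by linarith) (Nat.sub_le _ _)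
  have hw := wcnt_nonneg (p + 2) M₁
  have h5 : Real.exp (-wt (p + 2) M₁) * Real.exp (wt (p + 2) M₁ - wt (p + 2) (M₁ ⊔ M₂)) =
      Real.exp (-wt (p + 2) (M₁ ⊔ M₂)) := by
    rw [← Real.exp_add]; congr 1; ring
  rw [← h5]
  have h6 := h1.trans (mul_le_mul_of_nonneg_left hpow (mul_nonneg hw hE.le))
  have h7 := mul_le_mul_of_nonneg_right h6
    (mul_pos (Real.exp_pos (-wt (p + 2) M₁))
      (Real.exp_pos (wt (p + 2) M₁ - wt (p + 2) (M₁ ⊔ M₂)))).le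
  refine h7.trans (le_of_eq ?_)
  ring

theorem one_add_pow_le_one_sub_pow_mul_exp {x : ℝ} (h0 : 0 ≤ x) (h1 : x ≤ 1 / 2) (N : ℕ) :
    (1 + x) ^ N ≤ (1 - x) ^ N * Real.exp (4 * x * N) := by
  have e : Real.exp (4 * x * N) = Real.exp (4 * x) ^ N := by
    rw [← Real.exp_nat_mul]; congr 1; ring
  rw [e, ← mul_pow]
  have h2 := Real.add_one_le_exp (4 * x)
  have h3 : (1 - x) * (4 * x + 1) ≤ (1 - x) * Real.exp (4 * x) :=
    mul_le_mul_of_nonneg_left h2 (by linarith)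
  refine pow_le_pow_left₀ (by linarith) (le_trans ?_ h3) N
  nlinarith

theorem mul_le_of_moment_bounds {A S T u v X E f e P : ℝ} (hT : 0 ≤ T) (hS : 0 ≤ S)
    (hf : 0 ≤ f * e * P * E) (hE : 0 ≤ E) (hX : 0 ≤ X) (hA : A ≤ S * (u * (f * e * P * E)))
    (hlow : f * (T * e * P * v) ≤ S) (hu : u ≤ v * X) : T * A ≤ X * E * S ^ 2 :=
  calc T * A ≤ T * (S * (u * (f * e * P * E))) := by gcongr
    _ ≤ T * (S * ((v * X) * (f * e * P * E))) := by gcongr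
    _ = X * E * S * (f * (T * e * P * v)) := by ring
    _ ≤ X * E * S * S := by gcongr
    _ = _ := by ring

/-- The second moment of the number of perfect matchings of a random regular graph. -/
theorem second_moment {r N : ℕ} (h : Big n r) (hN : n = 2 * N) :
    cnt r (⊥ : SimpleGraph (Fin n)) * ∑ M₁ ∈ regSet 1 (⊥ : SimpleGraph (Fin n)),
        ∑ M₂ ∈ regSet 1 (⊥ : SimpleGraph (Fin n)), cnt r (M₁ ⊔ M₂) ≤
      Real.exp (1000 / ((r : ℝ) - 1) ^ 3) *
        (∑ M ∈ regSet 1 (⊥ : SimpleGraph (Fin n)), cnt r M) ^ 2 := by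
  have hr := h.r_big
  obtain ⟨p, rfl⟩ : ∃ p, r = p + 2 := by
    have : 100 ≤ r := by exact_mod_cast hr
    exact ⟨r - 2, by omega⟩
  have hn : (n : ℝ) = 2 * N := by rw [hN]; push_cast; ring
  have hq : 99 ≤ (p : ℝ) + 1 := by push_cast at hr; linarith
  have hn6 := h.n_big
  have hN6 : ((p : ℝ) + 1) ^ 6 ≤ 2 * N := by
    rw [← hn]
    refine le_trans ?_ hn6
    push_cast
    gcongr
    norm_num
  have hU := overlap_sum_le hq hN6
  set η := 4000 * ((p + 2 : ℕ) : ℝ) ^ 2 / (n : ℝ) ^ 2 with hη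
  set S := ∑ M ∈ regSet 1 (⊥ : SimpleGraph (Fin n)), cnt (p + 2) M with hS
  set T := cnt (p + 2) (⊥ : SimpleGraph (Fin n)) with hT
  have hT0 : 0 ≤ T := cnt_nonneg _ _
  have hS0 : 0 ≤ S := sum_nonneg fun M _ => cnt_nonneg _ _
  have hr0 : (0 : ℝ) < ((p + 2 : ℕ) : ℝ) := by linarith
  have hn0 := h.npos
  have hη0 : 0 ≤ η := by rw [hη]; positivity
  have hηn : η * n ≤ 40 / ((p + 2 : ℕ) : ℝ) ^ 3 := by
    rw [hη, le_div_iff₀ (by positivity), show 4000 * ((p + 2 : ℕ) : ℝ) ^ 2 / (n : ℝ) ^ 2 * n *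
      ((p + 2 : ℕ) : ℝ) ^ 3 = 4000 * ((p + 2 : ℕ) : ℝ) ^ 5 / n by field_simp, div_le_iff₀ hn0]
    nlinarith [mul_le_mul_of_nonneg_left hr (by positivity : 0 ≤ ((p + 2 : ℕ) : ℝ) ^ 5)]
  have hq3 : ((p : ℝ) + 1) ^ 3 ≤ ((p + 2 : ℕ) : ℝ) ^ 3 := by push_cast; gcongr; norm_num
  have hq30 : 0 < ((p : ℝ) + 1) ^ 3 := by positivity
  have hηn' : η * n ≤ 40 / ((p : ℝ) + 1) ^ 3 := hηn.trans (by gcongr)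
  have hη1 : η ≤ 1 / 2 := by
    have h1 : (1 : ℝ) ≤ n := by
      have : 0 < n := by exact_mod_cast hn0
      exact_mod_cast this
    have h2 : 40 / ((p : ℝ) + 1) ^ 3 ≤ 40 / 99 ^ 3 := by gcongr
    norm_num at h2
    nlinarith
  have hcast : extProd N ((p + 2 : ℕ) : ℝ) N = extProd N (p + 2) N := by push_cast; rfl
  have hP0 : 0 < extProd N (p + 2) N := extProd_pos le_rfl (by linarith)
  set P := extProd N ((p : ℝ) + 2) N
  have hlow : df N * (T * Real.exp (1 / 4) * P * (1 - η) ^ N) ≤ S := by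
    rw [← card_matchings hN, cnt, gsum, sum_mul, hS]
    refine sum_le_sum fun M hM => ?_
    rw [one_mul, ← hcast]
    exact le_cnt_matching h hN (mem_regSet.1 hM).1
  have hup : ∑ M₁ ∈ regSet 1 (⊥ : SimpleGraph (Fin n)),
      ∑ M₂ ∈ regSet 1 (⊥ : SimpleGraph (Fin n)), cnt (p + 2) (M₁ ⊔ M₂) ≤
      S * ((1 + η) ^ N * (df N * Real.exp (1 / 4) * P * Real.exp (800 / ((p : ℝ) + 1) ^ 3))) := by
    rw [hS, sum_mul]
    refine sum_le_sum fun M₁ hM₁ => ?_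
    have h₁ := (mem_regSet.1 hM₁).1
    refine (sum_le_sum fun M₂ hM₂ => cnt_sup_matching_le h hN h₁ (mem_regSet.1 hM₂).1).trans ?_
    rw [← mul_sum, sum_apply_ov hN h₁ (fun k => extProd N ((p : ℝ) + 1) (N - k) * Real.exp (3 / 4 -
        ovFrac (p + 1) (k / N) / 2 - ovFrac (p + 1) (k / N) ^ 2 / 4)), ← hη, mul_assoc]
    have := cnt_nonneg (p + 2) M₁
    gcongr
  have hpow := one_add_pow_le_one_sub_pow_mul_exp hη0 hη1 N
  have hdf := df_pos N
  have hfin := mul_le_of_moment_bounds hT0 hS0 (by positivity : 0 ≤ df N * Real.exp (1 / 4) * P *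
    Real.exp (800 / ((p : ℝ) + 1) ^ 3)) (Real.exp_pos (800 / ((p : ℝ) + 1) ^ 3)).le
    (Real.exp_pos (4 * η * N)).le hup hlow hpow
  refine hfin.trans ?_
  rw [← Real.exp_add]
  refine mul_le_mul_of_nonneg_right (Real.exp_le_exp.2 ?_) (sq_nonneg S)
  have e1 : ((p + 2 : ℕ) : ℝ) - 1 = p + 1 := by push_cast; ring
  have e2 : 1000 / ((p : ℝ) + 1) ^ 3 = 200 / ((p : ℝ) + 1) ^ 3 + 800 / ((p : ℝ) + 1) ^ 3 := by
    ring
  have e3 : 200 / ((p : ℝ) + 1) ^ 3 = 5 * (40 / ((p : ℝ) + 1) ^ 3) := by ring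
  rw [e1, e2, e3]
  have : 0 ≤ 40 / ((p : ℝ) + 1) ^ 3 := by positivity
  have e4 : 4 * η * N = 2 * (η * n) := by rw [hn]; ring
  rw [e4]
  linarith

end

section

variable {n : ℕ}

theorem isRegularGraph_sup {H M : SimpleGraph (Fin n)} {d : ℕ} (hH : IsRegularGraph H d)
    (hM : IsRegularGraph M 1) (h : Disjoint H M) : IsRegularGraph (H ⊔ M) (d + 1) := by
  rw [isRegularGraph_iff] at *
  intro x
  have h0 : ∀ y, adj (H ⊓ M) x y = 0 := fun y => by
    rw [h.eq_bot]; simp [adj]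
  simp only [adj_sup, h0, sub_zero, sum_add_distrib, hH, hM]
  push_cast
  ring

theorem isRegularGraph_sdiff {G M : SimpleGraph (Fin n)} {d : ℕ} (hG : IsRegularGraph G (d + 1))
    (hM : IsRegularGraph M 1) (h : M ≤ G) : IsRegularGraph (G \ M) d := by
  rw [isRegularGraph_iff] at *
  intro x
  simp only [adj_sdiff, inf_eq_left.2 h, sum_sub_distrib, hG, hM]
  push_cast
  ring

open scoped Classical in
theorem mu_eq (d : ℕ) (G : SimpleGraph (Fin n)) :
    mu n d G = if IsRegularGraph G d then (cnt d (⊥ : SimpleGraph (Fin n)))⁻¹ else 0 := by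
  have : cnt d (⊥ : SimpleGraph (Fin n)) =
      (Nat.card {H : SimpleGraph (Fin n) // IsRegularGraph H d} : ℝ) := by
    rw [Nat.card_eq_fintype_card, Fintype.card_subtype]
    simp [cnt, gsum, regSet]
  rw [mu, this]

open scoped Classical in
/-- Number of perfect matchings of `G`. -/
noncomputable def pmc (G : SimpleGraph (Fin n)) : ℝ :=
  ∑ M ∈ regSet 1 (⊥ : SimpleGraph (Fin n)), if M ≤ G then 1 else 0

open scoped Classical in
theorem oplusMass_eq (d : ℕ) (G : SimpleGraph (Fin n)) :
    oplusMass (mu n d) (mu n 1) G = if IsRegularGraph G (d + 1) then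
      (cnt d (⊥ : SimpleGraph (Fin n)))⁻¹ * (cnt 1 (⊥ : SimpleGraph (Fin n)))⁻¹ * pmc G else 0 := by
  set c := (cnt d (⊥ : SimpleGraph (Fin n)))⁻¹ * (cnt 1 (⊥ : SimpleGraph (Fin n)))⁻¹ with hc
  have key : ∀ M : SimpleGraph (Fin n), ∑ H : SimpleGraph (Fin n),
      (if Disjoint H M ∧ H ⊔ M = G then mu n d H * mu n 1 M else 0) =
      if IsRegularGraph M 1 then
        (if IsRegularGraph G (d + 1) then c * (if M ≤ G then 1 else 0) else 0) else 0 := by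
    intro M
    by_cases hM : IsRegularGraph M 1
    · rw [if_pos hM]
      by_cases hMG : M ≤ G
      · rw [sum_eq_single (G \ M)]
        · rw [if_pos ⟨disjoint_sdiff_self_left, sdiff_sup_cancel hMG⟩, mu_eq, mu_eq, if_pos hM,
            if_pos hMG, mul_one]
          by_cases hG : IsRegularGraph G (d + 1)
          · rw [if_pos hG, if_pos (isRegularGraph_sdiff hG hM hMG)]
          · rw [if_neg hG, if_neg, zero_mul]
            intro h
            have := isRegularGraph_sup h hM disjoint_sdiff_self_left
            rw [sdiff_sup_cancel hMG] at this
            exact hG this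
        · intro H _ hH
          refine if_neg fun h => hH ?_
          rw [← h.2]
          exact (h.1.sup_sdiff_cancel_right).symm
        · simp
      · rw [if_neg hMG, mul_zero, ite_self]
        refine sum_eq_zero fun H _ => if_neg fun h => hMG ?_
        rw [← h.2]
        exact le_sup_right
    · rw [if_neg hM]
      refine sum_eq_zero fun H _ => ?_
      rw [mu_eq 1 M, if_neg hM, mul_zero, ite_self]
  rw [oplusMass, tsum_fintype, Fintype.sum_prod_type_right]
  simp only [key]
  rw [← sum_filter]
  have : (univ.filter fun M : SimpleGraph (Fin n) => IsRegularGraph M 1) = regSet 1 ⊥ := by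
    simp [regSet]
  rw [this]
  by_cases hG : IsRegularGraph G (d + 1)
  · simp only [if_pos hG, pmc, mul_sum]
  · simp only [if_neg hG, sum_const_zero]

theorem sum_pmc (r : ℕ) : ∑ G ∈ regSet r (⊥ : SimpleGraph (Fin n)), pmc G =
    ∑ M ∈ regSet 1 (⊥ : SimpleGraph (Fin n)), cnt r M := by
  classical
  simp only [pmc]
  rw [sum_comm]
  refine sum_congr rfl fun M _ => ?_
  rw [← sum_filter, cnt, gsum]
  congr 1
  ext G
  simp [regSet]

theorem sum_pmc_sq (r : ℕ) : ∑ G ∈ regSet r (⊥ : SimpleGraph (Fin n)), pmc G ^ 2 =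
    ∑ M₁ ∈ regSet 1 (⊥ : SimpleGraph (Fin n)),
      ∑ M₂ ∈ regSet 1 (⊥ : SimpleGraph (Fin n)), cnt r (M₁ ⊔ M₂) := by
  classical
  simp only [pmc, sq, sum_mul_sum]
  rw [sum_comm]
  refine sum_congr rfl fun M₁ _ => ?_
  rw [sum_comm]
  refine sum_congr rfl fun M₂ _ => ?_
  have : ∀ G : SimpleGraph (Fin n), ((if M₁ ≤ G then 1 else 0) * (if M₂ ≤ G then 1 else 0) : ℝ) =
      if M₁ ⊔ M₂ ≤ G then 1 else 0 := by
    intro G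
    by_cases h1 : M₁ ≤ G <;> by_cases h2 : M₂ ≤ G <;> simp [h1, h2]
  simp only [this]
  rw [← sum_filter, cnt, gsum]
  congr 1
  ext G
  simp [regSet]

theorem tvDist_le_one {α : Type*} [Fintype α] {p q : α → ℝ} (hp : ∀ x, 0 ≤ p x) (hq : ∀ x, 0 ≤ q x)
    (hp1 : ∑ x, p x ≤ 1) (hq1 : ∑ x, q x ≤ 1) : tvDist p q ≤ 1 := by
  rw [tvDist, tsum_fintype]
  have : ∑ x, |p x - q x| ≤ ∑ x, (p x + q x) := sum_le_sum fun x _ => by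
    rw [abs_le]; constructor <;> linarith [hp x, hq x]
  rw [sum_add_distrib] at this
  linarith

theorem mu_nonneg (d : ℕ) (G : SimpleGraph (Fin n)) : 0 ≤ mu n d G := by
  rw [mu]; split_ifs <;> positivity

theorem sum_mu_le_one (d : ℕ) : ∑ G : SimpleGraph (Fin n), mu n d G ≤ 1 := by
  classical
  simp only [mu_eq]
  rw [← sum_filter, sum_const, nsmul_eq_mul]
  have : cnt d (⊥ : SimpleGraph (Fin n)) =
      ((univ.filter fun G : SimpleGraph (Fin n) => IsRegularGraph G d).card : ℝ) := by
    simp [cnt, gsum, regSet]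
  rw [← this]
  exact mul_inv_le_one

theorem oplus_nonneg_and_sum_le_one (d : ℕ) :
    (∀ G, 0 ≤ oplus (mu n d) (mu n 1) G) ∧
      ∑ G : SimpleGraph (Fin n), oplus (mu n d) (mu n 1) G ≤ 1 := by
  have h : ∀ G, 0 ≤ oplusMass (mu n d) (mu n 1) G := fun G => by
    rw [oplusMass, tsum_fintype]
    refine sum_nonneg fun H _ => ?_
    split_ifs
    exacts [mul_nonneg (mu_nonneg _ _) (mu_nonneg _ _), le_rfl]
  simp only [oplus, tsum_fintype]
  refine ⟨fun G => div_nonneg (h G) (sum_nonneg fun G _ => h G), ?_⟩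
  rw [← sum_div]
  exact div_self_le_one _

theorem oplus_eq (d : ℕ) {G : SimpleGraph (Fin n)} (hG : IsRegularGraph G (d + 1))
    (hS : 0 < ∑ M ∈ regSet 1 (⊥ : SimpleGraph (Fin n)), cnt (d + 1) M) :
    oplus (mu n d) (mu n 1) G =
      pmc G / ∑ M ∈ regSet 1 (⊥ : SimpleGraph (Fin n)), cnt (d + 1) M := by
  classical
  have hc : ∀ {r : ℕ} {H : SimpleGraph (Fin n)}, IsRegularGraph H r →
      0 < cnt r (⊥ : SimpleGraph (Fin n)) := by
    intro r H hH
    have : 0 < (regSet r (⊥ : SimpleGraph (Fin n))).card :=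
      card_pos.2 ⟨H, mem_regSet.2 ⟨hH, bot_le⟩⟩
    simp only [cnt, gsum, sum_const, nsmul_eq_mul, mul_one]
    exact_mod_cast this
  obtain ⟨M, hM, hM0⟩ := exists_ne_zero_of_sum_ne_zero hS.ne'
  have hM1 := (mem_regSet.1 hM).1
  obtain ⟨G', hG', -⟩ := exists_ne_zero_of_sum_ne_zero hM0
  obtain ⟨hG1, hG2⟩ := mem_regSet.1 hG'
  have h1 := hc hM1
  have h2 := hc (isRegularGraph_sdiff hG1 hM1 hG2)
  simp only [oplus, oplusMass_eq, if_pos hG, tsum_fintype]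
  rw [← sum_filter, ← mul_sum, ← sum_pmc]
  have : (univ.filter fun M : SimpleGraph (Fin n) => IsRegularGraph M (d + 1)) =
      regSet (d + 1) ⊥ := by
    simp [regSet]
  rw [this]
  exact mul_div_mul_left _ _ (by positivity)

theorem oplus_eq_zero (d : ℕ) {G : SimpleGraph (Fin n)} (hG : ¬ IsRegularGraph G (d + 1)) :
    oplus (mu n d) (mu n 1) G = 0 := by
  classical
  rw [oplus, oplusMass_eq, if_neg hG, zero_div]

/-- Total variation distance through the second moment of the perfect matching count. -/
theorem sq_tvDist_le (d : ℕ) (hT : 0 < cnt (d + 1) (⊥ : SimpleGraph (Fin n)))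
    (hS : 0 < ∑ M ∈ regSet 1 (⊥ : SimpleGraph (Fin n)), cnt (d + 1) M) {R : ℝ}
    (hR : cnt (d + 1) (⊥ : SimpleGraph (Fin n)) * ∑ M₁ ∈ regSet 1 (⊥ : SimpleGraph (Fin n)),
        ∑ M₂ ∈ regSet 1 (⊥ : SimpleGraph (Fin n)), cnt (d + 1) (M₁ ⊔ M₂) ≤
      R * (∑ M ∈ regSet 1 (⊥ : SimpleGraph (Fin n)), cnt (d + 1) M) ^ 2) :
    tvDist (oplus (mu n d) (mu n 1)) (mu n (d + 1)) ^ 2 ≤ (R - 1) / 4 := by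
  classical
  have h1 : ∑' G, |oplus (mu n d) (mu n 1) G - mu n (d + 1) G| =
      ∑ G ∈ regSet (d + 1) (⊥ : SimpleGraph (Fin n)),
        |pmc G / (∑ M ∈ regSet 1 (⊥ : SimpleGraph (Fin n)), cnt (d + 1) M) -
          (cnt (d + 1) (⊥ : SimpleGraph (Fin n)))⁻¹| := by
    rw [tsum_fintype, regSet, sum_filter]
    refine sum_congr rfl fun G _ => ?_
    rw [mu_eq]
    by_cases hG : IsRegularGraph G (d + 1)
    · rw [if_pos hG, if_pos ⟨hG, bot_le⟩, oplus_eq d hG hS]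
    · rw [if_neg hG, if_neg fun h => hG h.1, oplus_eq_zero d hG, sub_zero, abs_zero]
  have hcard : ((regSet (d + 1) (⊥ : SimpleGraph (Fin n))).card : ℝ) =
      cnt (d + 1) (⊥ : SimpleGraph (Fin n)) := by
    simp [cnt, gsum]
  have hsum := sum_pmc (n := n) (d + 1)
  rw [← sum_pmc_sq] at hR
  rw [tvDist, h1]
  set S := ∑ M ∈ regSet 1 (⊥ : SimpleGraph (Fin n)), cnt (d + 1) M
  set T := cnt (d + 1) (⊥ : SimpleGraph (Fin n))
  set Q := ∑ G ∈ regSet (d + 1) (⊥ : SimpleGraph (Fin n)), pmc G ^ 2 with hQ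
  have hCS := sq_sum_le_card_mul_sum_sq (s := regSet (d + 1) (⊥ : SimpleGraph (Fin n)))
    (f := fun G => |pmc G / S - T⁻¹|)
  have h2 : ∑ G ∈ regSet (d + 1) (⊥ : SimpleGraph (Fin n)), |pmc G / S - T⁻¹| ^ 2 =
      Q / S ^ 2 - T⁻¹ := by
    calc _ = ∑ G ∈ regSet (d + 1) (⊥ : SimpleGraph (Fin n)),
          (pmc G ^ 2 * (S ^ 2)⁻¹ - pmc G * (2 * S⁻¹ * T⁻¹) + (T⁻¹) ^ 2) :=
          sum_congr rfl fun G _ => by rw [sq_abs]; ring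
      _ = Q * (S ^ 2)⁻¹ - S * (2 * S⁻¹ * T⁻¹) + T * (T⁻¹) ^ 2 := by
          rw [sum_add_distrib, sum_sub_distrib, ← sum_mul, ← sum_mul, hsum, sum_const,
            nsmul_eq_mul, hcard]
      _ = _ := by field_simp; ring
  rw [h2, hcard] at hCS
  have h3 : T * (Q / S ^ 2 - T⁻¹) ≤ R - 1 := by
    rw [mul_sub, mul_inv_cancel₀ hT.ne', ← mul_div_assoc]
    have : T * Q / S ^ 2 ≤ R := by rw [div_le_iff₀ (by positivity)]; exact hR
    linarith
  rw [mul_pow]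
  linarith

theorem sum_cnt_matching_pos {r N : ℕ} (h : Big n r) (hN : n = 2 * N)
    (hT : 0 < cnt r (⊥ : SimpleGraph (Fin n))) :
    0 < ∑ M ∈ regSet 1 (⊥ : SimpleGraph (Fin n)), cnt r M := by
  have h1 := df_pos N
  rw [← card_matchings hN] at h1
  obtain ⟨M, hM, -⟩ := exists_ne_zero_of_sum_ne_zero h1.ne'
  refine sum_pos' (fun M _ => cnt_nonneg _ _) ⟨M, hM, ?_⟩
  refine lt_of_lt_of_le ?_ (le_cnt_matching h hN (mem_regSet.1 hM).1)
  have hr := h.r_big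
  have hn := h.n_big
  have hn0 := h.npos
  have h2 : 0 < 1 - 4000 * (r : ℝ) ^ 2 / n ^ 2 := by
    rw [sub_pos, div_lt_one (by positivity)]
    have h3 : (100 : ℝ) ^ 4 * r ^ 2 ≤ n := by
      calc (100 : ℝ) ^ 4 * (r : ℝ) ^ 2 ≤ (r : ℝ) ^ 4 * (r : ℝ) ^ 2 := by gcongr
        _ = (r : ℝ) ^ 6 := by ring
        _ ≤ (n : ℝ) := hn
    have h4 : 100 ^ 2 ≤ (r : ℝ) ^ 2 := by gcongr
    nlinarith
  have h3 := extProd_pos (le_refl N) (q := r) (by linarith)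
  have := Real.exp_pos (1 / 4)
  positivity

theorem tvDist_le_of_big {d N : ℕ} (h : Big (2 * N) (d + 1)) :
    tvDist (oplus (mu (2 * N) d) (mu (2 * N) 1)) (mu (2 * N) (d + 1)) ^ 2 ≤ 500 / (d : ℝ) ^ 3 := by
  have hd : 99 ≤ (d : ℝ) := by
    have := h.r_big
    push_cast at this
    linarith
  rcases (cnt_nonneg (d + 1) (⊥ : SimpleGraph (Fin (2 * N)))).eq_or_lt with hT | hT
  · have hreg : ∀ G : SimpleGraph (Fin (2 * N)), ¬ IsRegularGraph G (d + 1) := by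
      intro G hG
      have : 0 < (regSet (d + 1) (⊥ : SimpleGraph (Fin (2 * N)))).card :=
        card_pos.2 ⟨G, mem_regSet.2 ⟨hG, bot_le⟩⟩
      have h2 : (((regSet (d + 1) (⊥ : SimpleGraph (Fin (2 * N)))).card : ℕ) : ℝ) = 0 := by
        rw [hT]; simp [cnt, gsum]
      rw [Nat.cast_eq_zero] at h2
      omega
    have h0 : tvDist (oplus (mu (2 * N) d) (mu (2 * N) 1)) (mu (2 * N) (d + 1)) = 0 := by
      simp [tvDist, oplus_eq_zero d (hreg _), mu, hreg]
    rw [h0, zero_pow two_ne_zero]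
    positivity
  · have hR := second_moment h rfl
    have h1 := sq_tvDist_le d hT (sum_cnt_matching_pos h rfl hT) hR
    refine h1.trans ?_
    have e : ((d + 1 : ℕ) : ℝ) - 1 = d := by push_cast; ring
    rw [e]
    have h2 : 1000 / (d : ℝ) ^ 3 ≤ 1 := by
      rw [div_le_one (by positivity)]
      calc (1000 : ℝ) ≤ 99 ^ 3 := by norm_num
        _ ≤ (d : ℝ) ^ 3 := by gcongr
    have h3 : 0 ≤ 1000 / (d : ℝ) ^ 3 := by positivity
    have h4 := (abs_le.1 (Real.abs_exp_sub_one_sub_id_le (by rwa [abs_of_nonneg h3]))).2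
    have h5 : 500 / (d : ℝ) ^ 3 = 1000 / (d : ℝ) ^ 3 / 2 := by ring
    rw [h5]
    nlinarith

theorem big_of_le_rpow {d n : ℕ} (hd : 99 ≤ d) (h : (d : ℝ) ≤ (n : ℝ) ^ ((1 : ℝ) / 10)) :
    Big n (d + 1) := by
  have hd' : (99 : ℝ) ≤ d := by exact_mod_cast hd
  refine ⟨by push_cast; linarith, ?_⟩
  have h1 : (d : ℝ) ^ 10 ≤ n := by
    calc (d : ℝ) ^ 10 ≤ (((n : ℝ) ^ ((1 : ℝ) / 10)) ^ 10 : ℝ) := by gcongr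
      _ = (n : ℝ) := by
        rw [← Real.rpow_natCast, ← Real.rpow_mul (Nat.cast_nonneg n)]; norm_num
  refine le_trans ?_ h1
  push_cast
  calc ((d : ℝ) + 1) ^ 6 ≤ (2 * d) ^ 6 := by gcongr; linarith
    _ = 64 * (d : ℝ) ^ 6 := by ring
    _ ≤ (d : ℝ) ^ 4 * (d : ℝ) ^ 6 := by
        gcongr
        calc (64 : ℝ) ≤ 99 ^ 4 := by norm_num
          _ ≤ (d : ℝ) ^ 4 := by gcongr
    _ = _ := by ring

end

end RegularSprinkling

/-- There is `C₁ > 0` such that for every even `n = 2m` and every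
`3 ≤ d ≤ n^{1/10}`, `d_TV(μ_{d,n} ⊕ μ_{1,n}, μ_{d+1,n}) ≤ C₁ d^{-1.1}`. -/
theorem statement_13 :
    ∃ C₁ : ℝ, 0 < C₁ ∧
      ∀ m d : ℕ, 3 ≤ d → (d : ℝ) ≤ ((2*m : ℕ) : ℝ) ^ ((1:ℝ)/10) →
        tvDist (oplus (mu (2*m) d) (mu (2*m) 1)) (mu (2*m) (d+1)) ≤
          C₁ * (d : ℝ) ^ (-(1.1 : ℝ)) := by
  refine ⟨10000, by norm_num, fun m d hd hdm => ?_⟩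
  have hd3 : (3 : ℝ) ≤ d := by exact_mod_cast hd
  have hd0 : (0 : ℝ) < d := by linarith
  rcases le_or_gt 99 d with h | h
  · have hb := RegularSprinkling.big_of_le_rpow h hdm
    refine le_of_sq_le_sq ((RegularSprinkling.tvDist_le_of_big hb).trans ?_) (by positivity)
    have e1 : ((d : ℝ) ^ (-(1.1 : ℝ))) ^ 2 = (d : ℝ) ^ (-(2.2 : ℝ)) := by
      rw [← Real.rpow_natCast, ← Real.rpow_mul hd0.le]; norm_num
    have e2 : 500 / (d : ℝ) ^ 3 = 500 * (d : ℝ) ^ (-(3 : ℝ)) := by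
      rw [Real.rpow_neg hd0.le]
      norm_cast
    have h3 : (d : ℝ) ^ (-(3 : ℝ)) ≤ (d : ℝ) ^ (-(2.2 : ℝ)) :=
      Real.rpow_le_rpow_of_exponent_le (by linarith) (by norm_num)
    have h4 : 0 < (d : ℝ) ^ (-(2.2 : ℝ)) := Real.rpow_pos_of_pos hd0 _
    rw [mul_pow, e1, e2]
    linarith
  · obtain ⟨h1, h2⟩ := RegularSprinkling.oplus_nonneg_and_sum_le_one (n := 2 * m) d
    refine (RegularSprinkling.tvDist_le_one h1 (RegularSprinkling.mu_nonneg (d + 1)) h2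
      (RegularSprinkling.sum_mu_le_one (d + 1))).trans ?_
    have hd' : (d : ℝ) ≤ 98 := by exact_mod_cast Nat.le_of_lt_succ h
    have h3 : (d : ℝ) ^ (-(2 : ℝ)) ≤ (d : ℝ) ^ (-(1.1 : ℝ)) :=
      Real.rpow_le_rpow_of_exponent_le (by linarith) (by norm_num)
    have e2 : (d : ℝ) ^ (-(2 : ℝ)) = 1 / (d : ℝ) ^ 2 := by
      rw [Real.rpow_neg hd0.le, one_div]
      norm_cast
    rw [e2] at h3
    have h4 : 1 / (10000 : ℝ) ≤ 1 / (d : ℝ) ^ 2 :=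
      one_div_le_one_div_of_le (by positivity) (by nlinarith)
    linarith
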